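/- arXiv:1111.5403 — 2 statements merged into one kernel-verified Lean document; each statement's English description precedes it below -/
import Mathlib

section
/- Let a > 1 be an integer. Assume the following (GRH-conditional) counting bound of Li–Pomerance: there is a constant C such that for every odd prime q such that a is not a qth power, and every real X ≥ 3, the number of positive integers n ≤ X divisible by some prime r ∈ A_q with r ≥ q²(log q)⁴ is at most C·(X/(q log q) + X·log log X/q²). Then there is a constant C' and a threshold X₀ (both depending only on a) such that for all X ≥ X₀ and all θ with 1/10 ≤ θ ≤ 9/10, setting Y = exp(110·(log X)^θ·(log log X)²), the number of positive integers n ≤ X with ℓ*_a(n) ≤ X/(Y·exp((log X)^θ)) is at most C'·X/((log X)^θ · log log X). -/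
/-- The largest divisor of `n` coprime to `a`. -/
def coprimePart (a n : ℕ) : ℕ :=
  (n.divisors.filter fun d => Nat.Coprime d a).sup id

/-- `ℓ*_a(n)`: the multiplicative order of `a` modulo the largest divisor of `n`
coprime to `a`. -/
noncomputable def lstar (a n : ℕ) : ℕ :=
  orderOf (a : ZMod (coprimePart a n))


open Finset in
noncomputable def sieveF (d Y : ℕ) : Finset ℕ :=
  (Finset.Icc 1 Y).filter (fun f => Squarefree f ∧ Nat.Coprime f d)

noncomputable def sieveG (d Y : ℕ) : ℝ := ∑ f ∈ sieveF d Y, (1 : ℝ) / f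

noncomputable def sieveLam (d Y e : ℕ) : ℝ :=
  (ArithmeticFunction.moebius e : ℝ) * e * ∑ f ∈ (sieveF d Y).filter (fun f => e ∣ f), (1 : ℝ) / f

lemma mem_sieveF {d Y f : ℕ} :
    f ∈ sieveF d Y ↔ 1 ≤ f ∧ f ≤ Y ∧ Squarefree f ∧ Nat.Coprime f d := by
  simp [sieveF, and_assoc]

lemma sum_moebius_divisors (n : ℕ) (_hn : n ≠ 0) :
    ∑ e ∈ n.divisors, (ArithmeticFunction.moebius e : ℝ) = if n = 1 then 1 else 0 := by
  have h := congrArg (fun f : ArithmeticFunction ℝ => f n)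
    (ArithmeticFunction.coe_moebius_mul_coe_zeta (R := ℝ))
  simp only [ArithmeticFunction.coe_mul_zeta_apply, ArithmeticFunction.one_apply] at h
  simpa using h

lemma sum_moebius_between (g f : ℕ) (hf : Squarefree f) (hg : g ∣ f) :
    ∑ e ∈ f.divisors.filter (fun e => g ∣ e), (ArithmeticFunction.moebius e : ℝ)
      = if f = g then (ArithmeticFunction.moebius g : ℝ) else 0 := by
  obtain ⟨k, rfl⟩ := hg
  have hne : g * k ≠ 0 := hf.ne_zero
  have hg0 : g ≠ 0 := left_ne_zero_of_mul hne
  have hk0 : k ≠ 0 := right_ne_zero_of_mul hne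
  have hcop : Nat.Coprime g k := Nat.coprime_of_squarefree_mul hf
  have : (g * k).divisors.filter (fun e => g ∣ e) = k.divisors.image (fun e => g * e) := by
    ext e
    simp only [Finset.mem_filter, Nat.mem_divisors, Finset.mem_image]
    constructor
    · rintro ⟨⟨h1, _⟩, ⟨c, rfl⟩⟩
      exact ⟨c, ⟨Nat.dvd_of_mul_dvd_mul_left (Nat.pos_of_ne_zero hg0) h1, hk0⟩, rfl⟩
    · rintro ⟨c, ⟨h1, _⟩, rfl⟩
      exact ⟨⟨Nat.mul_dvd_mul_left g h1, hne⟩, Dvd.intro _ rfl⟩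
  rw [this, Finset.sum_image (by
    intro x _ y _ h
    exact Nat.eq_of_mul_eq_mul_left (Nat.pos_of_ne_zero hg0) h)]
  have h2 : ∀ e ∈ k.divisors, (ArithmeticFunction.moebius (g * e) : ℝ)
      = ArithmeticFunction.moebius g * ArithmeticFunction.moebius e := by
    intro e he
    rw [ArithmeticFunction.isMultiplicative_moebius.map_mul_of_coprime
      (hcop.coprime_dvd_right (Nat.dvd_of_mem_divisors he))]
    push_cast; rfl
  rw [Finset.sum_congr rfl h2, ← Finset.mul_sum, sum_moebius_divisors k hk0]
  by_cases hk : k = 1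
  · simp [hk]
  · rw [if_neg hk, if_neg]
    · simp
    · intro h
      exact hk (Nat.eq_of_mul_eq_mul_left (Nat.pos_of_ne_zero hg0) (by simpa using h))

lemma sieve_inner (d Y g : ℕ) (hg : g ∈ sieveF d Y) :
    ∑ e ∈ (sieveF d Y).filter (fun e => g ∣ e), sieveLam d Y e / e
      = (ArithmeticFunction.moebius g : ℝ) / g := by
  have h1 : ∀ e ∈ (sieveF d Y).filter (fun e => g ∣ e), sieveLam d Y e / e
      = ∑ f ∈ sieveF d Y, if e ∣ f then (ArithmeticFunction.moebius e : ℝ) * (1 / f) else 0 := by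
    intro e he
    have he0 : (e : ℝ) ≠ 0 := by
      have := (mem_sieveF.1 (Finset.mem_filter.1 he).1).1
      positivity
    rw [sieveLam, ← Finset.sum_filter, ← Finset.mul_sum]
    field_simp
  rw [Finset.sum_congr rfl h1, Finset.sum_comm]
  have h2 : ∀ f ∈ sieveF d Y, ∑ e ∈ (sieveF d Y).filter (fun e => g ∣ e),
      (if e ∣ f then (ArithmeticFunction.moebius e : ℝ) * (1 / f) else 0)
      = if f = g then (ArithmeticFunction.moebius g : ℝ) / g else 0 := by
    intro f hf
    have hf' := mem_sieveF.1 hf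
    by_cases hgf : g ∣ f
    · have : ((sieveF d Y).filter (fun e => g ∣ e)).filter (fun e => e ∣ f)
          = f.divisors.filter (fun e => g ∣ e) := by
        ext e
        simp only [Finset.mem_filter, Nat.mem_divisors, mem_sieveF]
        constructor
        · rintro ⟨⟨_, h2⟩, h3⟩
          exact ⟨⟨h3, hf'.2.2.1.ne_zero⟩, h2⟩
        · rintro ⟨⟨h3, h4⟩, h2⟩
          exact ⟨⟨⟨Nat.pos_of_dvd_of_pos h3 hf'.1, (Nat.le_of_dvd hf'.1 h3).trans hf'.2.1,
            hf'.2.2.1.squarefree_of_dvd h3, hf'.2.2.2.coprime_dvd_left h3⟩, h2⟩, h3⟩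
      rw [← Finset.sum_filter, this, ← Finset.sum_mul, sum_moebius_between g f hf'.2.2.1 hgf]
      split_ifs with h
      · subst h; ring
      · simp
    · rw [if_neg (by rintro rfl; exact hgf dvd_rfl)]
      apply Finset.sum_eq_zero
      intro e he
      rw [if_neg]
      intro h
      exact hgf ((Finset.mem_filter.1 he).2.trans h)
  rw [Finset.sum_congr rfl h2]
  simp [hg]

lemma sieve_gcd (d Y e₁ e₂ : ℕ) (h₁ : e₁ ∈ sieveF d Y) (_h₂ : e₂ ∈ sieveF d Y) :
    (1 : ℝ) / (Nat.lcm e₁ e₂) = ∑ g ∈ sieveF d Y,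
      (Nat.totient g : ℝ) * (if g ∣ e₁ then (1 : ℝ) / e₁ else 0) *
        (if g ∣ e₂ then (1 : ℝ) / e₂ else 0) := by
  have h1 := mem_sieveF.1 h₁
  have h2 := mem_sieveF.1 _h₂
  have e1 : (e₁ : ℝ) ≠ 0 := by have := h1.1; positivity
  have e2 : (e₂ : ℝ) ≠ 0 := by have := h2.1; positivity
  have hg0 : Nat.gcd e₁ e₂ ≠ 0 := (Nat.gcd_pos_of_pos_left _ h1.1).ne'
  have hset : (sieveF d Y).filter (fun g => g ∣ e₁ ∧ g ∣ e₂) = (Nat.gcd e₁ e₂).divisors := by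
    ext g
    simp only [Finset.mem_filter, Nat.mem_divisors, mem_sieveF, Nat.dvd_gcd_iff]
    constructor
    · rintro ⟨_, h⟩; exact ⟨h, hg0⟩
    · rintro ⟨⟨h3, h4⟩, _⟩
      exact ⟨⟨Nat.pos_of_dvd_of_pos h3 h1.1, (Nat.le_of_dvd h1.1 h3).trans h1.2.1,
            h1.2.2.1.squarefree_of_dvd h3, h1.2.2.2.coprime_dvd_left h3⟩, h3, h4⟩
  have : ∀ g ∈ sieveF d Y, (Nat.totient g : ℝ) * (if g ∣ e₁ then (1 : ℝ) / e₁ else 0) *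
        (if g ∣ e₂ then (1 : ℝ) / e₂ else 0) =
      if g ∣ e₁ ∧ g ∣ e₂ then (Nat.totient g : ℝ) * (1 / (e₁ * e₂)) else 0 := by
    intro g _
    by_cases ha : g ∣ e₁ <;> by_cases hb : g ∣ e₂ <;> simp [ha, hb]
    field_simp
  rw [Finset.sum_congr rfl this, ← Finset.sum_filter, hset, ← Finset.sum_mul]
  have ht : (∑ g ∈ (Nat.gcd e₁ e₂).divisors, (Nat.totient g : ℝ)) = Nat.gcd e₁ e₂ := by
    exact_mod_cast congrArg (Nat.cast (R := ℝ)) (Nat.sum_totient (Nat.gcd e₁ e₂))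
  rw [ht]
  have hm : (Nat.gcd e₁ e₂ : ℝ) * Nat.lcm e₁ e₂ = e₁ * e₂ := by
    exact_mod_cast Nat.gcd_mul_lcm e₁ e₂
  have hl : (Nat.lcm e₁ e₂ : ℝ) ≠ 0 := by
    exact_mod_cast Nat.lcm_ne_zero (by have := h1.1; omega) (by have := h2.1; omega)
  field_simp
  linarith [hm]

lemma sieve_quad (d Y : ℕ) :
    ∑ e₁ ∈ sieveF d Y, ∑ e₂ ∈ sieveF d Y,
      sieveLam d Y e₁ * sieveLam d Y e₂ * (1 / (Nat.lcm e₁ e₂ : ℝ)) ≤ sieveG d Y := by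
  have h1 : ∑ e₁ ∈ sieveF d Y, ∑ e₂ ∈ sieveF d Y,
      sieveLam d Y e₁ * sieveLam d Y e₂ * (1 / (Nat.lcm e₁ e₂ : ℝ))
      = ∑ g ∈ sieveF d Y, (Nat.totient g : ℝ) *
        (∑ e ∈ (sieveF d Y).filter (fun e => g ∣ e), sieveLam d Y e / e) ^ 2 := by
    have : ∀ e₁ ∈ sieveF d Y, ∀ e₂ ∈ sieveF d Y,
        sieveLam d Y e₁ * sieveLam d Y e₂ * (1 / (Nat.lcm e₁ e₂ : ℝ)) =
        ∑ g ∈ sieveF d Y, (Nat.totient g : ℝ) *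
          ((if g ∣ e₁ then sieveLam d Y e₁ / e₁ else 0) *
          (if g ∣ e₂ then sieveLam d Y e₂ / e₂ else 0)) := by
      intro e₁ h₁ e₂ h₂
      rw [sieve_gcd d Y e₁ e₂ h₁ h₂, Finset.mul_sum]
      apply Finset.sum_congr rfl
      intro g _
      split_ifs <;> ring
    rw [Finset.sum_congr rfl (fun e₁ h₁ => Finset.sum_congr rfl (this e₁ h₁))]
    rw [Finset.sum_congr rfl (fun e₁ h₁ => Finset.sum_comm), Finset.sum_comm]
    apply Finset.sum_congr rfl
    intro g _
    rw [sq, Finset.sum_filter, Finset.sum_mul_sum, Finset.mul_sum]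
    apply Finset.sum_congr rfl
    intro e _
    rw [Finset.mul_sum]
  rw [h1, sieveG]
  apply Finset.sum_le_sum
  intro g hg
  rw [sieve_inner d Y g hg]
  have hg1 := (mem_sieveF.1 hg).1
  have hgpos : (0 : ℝ) < g := by exact_mod_cast hg1
  have h2 : ((ArithmeticFunction.moebius g : ℝ)) ^ 2 ≤ 1 := by
    have := ArithmeticFunction.abs_moebius_le_one (n := g)
    have h' : |(ArithmeticFunction.moebius g : ℝ)| ≤ 1 := by exact_mod_cast this
    exact (sq_le_one_iff_abs_le_one _).2 h'
  have h3 : (Nat.totient g : ℝ) ≤ g := by exact_mod_cast Nat.totient_le g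
  rw [div_pow, ← mul_div_assoc, div_le_div_iff₀ (by positivity) hgpos]
  nlinarith [mul_le_mul h3 h2 (sq_nonneg _) hgpos.le]

lemma sieve_count (d e K : ℕ) (he : 0 < e) (hc : Nat.Coprime e d) :
    |(((Finset.Ioc 0 K).filter (fun k => e ∣ 1 + d * k)).card : ℝ) - K / e| ≤ 1 := by
  obtain ⟨v, hv⟩ : ∃ v : ℕ, ∀ k : ℕ, e ∣ 1 + d * k ↔ k ≡ v [MOD e] := by
    have hu : IsUnit (d : ZMod e) := (ZMod.isUnit_iff_coprime d e).2 hc.symm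
    obtain ⟨u, hu⟩ := hu
    have : NeZero e := ⟨he.ne'⟩
    refine ⟨(-(↑u⁻¹ : ZMod e)).val, fun k => ?_⟩
    rw [← ZMod.natCast_eq_zero_iff, ← ZMod.natCast_eq_natCast_iff, ZMod.natCast_zmod_val]
    push_cast
    rw [← hu]
    constructor
    · intro h
      have : (u : ZMod e) * k = -1 := by linear_combination h
      calc (k : ZMod e) = (↑u⁻¹ : ZMod e) * (u * k) := by rw [← mul_assoc]; simp
        _ = _ := by rw [this]; ring
    · intro h; rw [h]; simp
  simp only [hv]
  have h := Nat.Ioc_filter_modEq_card 0 K he v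
  have h2 : (((Finset.Ioc 0 K).filter (fun k => k ≡ v [MOD e])).card : ℤ) =
    max (⌊((K : ℚ) - v) / e⌋ - ⌊((0 : ℕ) - (v : ℚ)) / e⌋) 0 := by exact_mod_cast h
  have a1 := Int.floor_le (((K : ℚ) - v) / e)
  have a2 := Int.lt_floor_add_one (((K : ℚ) - v) / e)
  have b1 := Int.floor_le (((0 : ℕ) - (v : ℚ)) / e)
  have b2 := Int.lt_floor_add_one (((0 : ℕ) - (v : ℚ)) / e)
  have eq : ((K : ℚ) - v) / e - ((0 : ℕ) - (v : ℚ)) / e = K / e := by push_cast; ring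
  have hpos : (0 : ℚ) ≤ (K : ℚ) / e := by positivity
  have key : |(((Finset.Ioc 0 K).filter (fun k => k ≡ v [MOD e])).card : ℚ) - K / e| ≤ 1 := by
    have h3 : (((Finset.Ioc 0 K).filter (fun k => k ≡ v [MOD e])).card : ℚ) =
      max ((⌊((K : ℚ) - v) / e⌋ : ℚ) - ⌊((0 : ℕ) - (v : ℚ)) / e⌋) 0 := by
      exact_mod_cast congrArg (Int.cast (R := ℚ)) h2
    rw [h3, abs_le]
    constructor
    · linarith [le_max_left ((⌊((K : ℚ) - v) / e⌋ : ℚ) - ⌊((0 : ℕ) - (v : ℚ)) / e⌋) 0]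
    · have : max ((⌊((K : ℚ) - v) / e⌋ : ℚ) - ⌊((0 : ℕ) - (v : ℚ)) / e⌋) 0 ≤ K / e + 1 :=
        max_le (by linarith) (by linarith)
      linarith
  have key2 : ((|(((Finset.Ioc 0 K).filter (fun k => k ≡ v [MOD e])).card : ℚ) - K / e| : ℚ) : ℝ)
      ≤ ((1 : ℚ) : ℝ) := by exact_mod_cast key
  push_cast at key2
  exact key2

lemma sieveLam_abs (d Y e : ℕ) (he : e ∈ sieveF d Y) : |sieveLam d Y e| ≤ Y * sieveG d Y := by
  have h := mem_sieveF.1 he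
  rw [sieveLam, abs_mul, abs_mul]
  have h1 : |(ArithmeticFunction.moebius e : ℝ)| ≤ 1 := by
    exact_mod_cast ArithmeticFunction.abs_moebius_le_one (n := e)
  have h2 : |(e : ℝ)| ≤ Y := by rw [Nat.abs_cast]; exact_mod_cast h.2.1
  have h3 : |∑ f ∈ (sieveF d Y).filter (fun f => e ∣ f), (1 : ℝ) / f| ≤ sieveG d Y := by
    rw [abs_of_nonneg (Finset.sum_nonneg (fun _ _ => by positivity))]
    exact Finset.sum_le_sum_of_subset_of_nonneg (Finset.filter_subset _ _)
      (fun _ _ _ => by positivity)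
  calc _ ≤ 1 * (Y : ℝ) * sieveG d Y := by gcongr
    _ = _ := by ring

/-- Selberg upper bound sieve. -/
lemma sieve_main (d Y K : ℕ) (hY : 1 ≤ Y) :
    (((Finset.Ioc 0 K).filter (fun k => (1 + d * k).Prime ∧ Y < 1 + d * k)).card : ℝ)
      ≤ K / sieveG d Y + Y ^ 4 := by
  set G := sieveG d Y with hG
  have h1F : 1 ∈ sieveF d Y := mem_sieveF.2 ⟨le_rfl, hY, squarefree_one, Nat.coprime_one_left d⟩
  have hGpos : 0 < G := by
    have : (1 : ℝ) / (1 : ℕ) ≤ G :=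
      Finset.single_le_sum (f := fun f : ℕ => (1 : ℝ) / f) (fun _ _ => by positivity) h1F
    norm_num at this; linarith
  have hlam1 : sieveLam d Y 1 = G := by
    simp [sieveLam, hG, sieveG]
  set W : ℕ → ℝ := fun k => ∑ e ∈ sieveF d Y, if e ∣ 1 + d * k then sieveLam d Y e else 0 with hW
  have hlow : (((Finset.Ioc 0 K).filter (fun k => (1 + d * k).Prime ∧ Y < 1 + d * k)).card : ℝ)
      * G ^ 2 ≤ ∑ k ∈ Finset.Ioc 0 K, W k ^ 2 := by
    calc _ = ∑ k ∈ (Finset.Ioc 0 K).filter (fun k => (1 + d * k).Prime ∧ Y < 1 + d * k), G ^ 2 := by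
          rw [Finset.sum_const, nsmul_eq_mul]
      _ = ∑ k ∈ (Finset.Ioc 0 K).filter (fun k => (1 + d * k).Prime ∧ Y < 1 + d * k), W k ^ 2 := by
          apply Finset.sum_congr rfl
          intro k hk
          obtain ⟨_, hp, hlt⟩ := Finset.mem_filter.1 hk
          have : W k = G := by
            rw [hW]
            simp only
            rw [Finset.sum_eq_single 1]
            · simp [hlam1]
            · intro e he hne
              rw [if_neg]
              intro hdvd
              rcases (Nat.dvd_prime hp).1 hdvd with h | h
              · exact hne h
              · have := (mem_sieveF.1 he).2.1
                omega
            · intro h; exact absurd h1F h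
          rw [this]
      _ ≤ _ := Finset.sum_le_sum_of_subset_of_nonneg (Finset.filter_subset _ _)
          (fun _ _ _ => sq_nonneg _)
  have hup : ∑ k ∈ Finset.Ioc 0 K, W k ^ 2 ≤ K * G + Y ^ 4 * G ^ 2 := by
    have e1 : ∑ k ∈ Finset.Ioc 0 K, W k ^ 2 = ∑ e₁ ∈ sieveF d Y, ∑ e₂ ∈ sieveF d Y,
        sieveLam d Y e₁ * sieveLam d Y e₂ *
          (((Finset.Ioc 0 K).filter (fun k => Nat.lcm e₁ e₂ ∣ 1 + d * k)).card : ℝ) := by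
      have : ∀ k ∈ Finset.Ioc 0 K, W k ^ 2 = ∑ e₁ ∈ sieveF d Y, ∑ e₂ ∈ sieveF d Y,
          if Nat.lcm e₁ e₂ ∣ 1 + d * k then sieveLam d Y e₁ * sieveLam d Y e₂ else 0 := by
        intro k _
        rw [hW]
        simp only
        rw [sq, Finset.sum_mul_sum]
        refine Finset.sum_congr rfl fun e₁ _ => Finset.sum_congr rfl fun e₂ _ => ?_
        by_cases ha : e₁ ∣ 1 + d * k <;> by_cases hb : e₂ ∣ 1 + d * k <;>
          simp [Nat.lcm_dvd_iff, ha, hb]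
      rw [Finset.sum_congr rfl this, Finset.sum_comm]
      refine Finset.sum_congr rfl fun e₁ _ => ?_
      rw [Finset.sum_comm]
      refine Finset.sum_congr rfl fun e₂ _ => ?_
      rw [← Finset.sum_filter, Finset.sum_const, nsmul_eq_mul, mul_comm]
    rw [e1]
    have e2 : ∀ e₁ ∈ sieveF d Y, ∀ e₂ ∈ sieveF d Y, sieveLam d Y e₁ * sieveLam d Y e₂ *
          (((Finset.Ioc 0 K).filter (fun k => Nat.lcm e₁ e₂ ∣ 1 + d * k)).card : ℝ) ≤
        K * (sieveLam d Y e₁ * sieveLam d Y e₂ * (1 / (Nat.lcm e₁ e₂ : ℝ))) + Y ^ 2 * G ^ 2 := by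
      intro e₁ h₁ e₂ h₂
      have m1 := mem_sieveF.1 h₁
      have m2 := mem_sieveF.1 h₂
      have hlp : 0 < Nat.lcm e₁ e₂ := Nat.lcm_pos m1.1 m2.1
      have hcop : Nat.Coprime (Nat.lcm e₁ e₂) d :=
        Nat.Coprime.coprime_dvd_left (Nat.lcm_dvd_mul e₁ e₂)
          (Nat.Coprime.mul_left m1.2.2.2 m2.2.2.2)
      have hcount := sieve_count d (Nat.lcm e₁ e₂) K hlp hcop
      have hl : |sieveLam d Y e₁ * sieveLam d Y e₂| ≤ Y ^ 2 * G ^ 2 := by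
        rw [abs_mul]
        calc _ ≤ (Y * G) * (Y * G) := mul_le_mul (sieveLam_abs d Y e₁ h₁) (sieveLam_abs d Y e₂ h₂)
              (abs_nonneg _) (by positivity)
          _ = _ := by ring
      set c := (((Finset.Ioc 0 K).filter (fun k => Nat.lcm e₁ e₂ ∣ 1 + d * k)).card : ℝ)
      set l := sieveLam d Y e₁ * sieveLam d Y e₂
      have : l * (c - K / (Nat.lcm e₁ e₂ : ℝ)) ≤ Y ^ 2 * G ^ 2 := by
        calc _ ≤ |l * (c - K / (Nat.lcm e₁ e₂ : ℝ))| := le_abs_self _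
          _ = |l| * |c - K / (Nat.lcm e₁ e₂ : ℝ)| := abs_mul _ _
          _ ≤ (Y ^ 2 * G ^ 2) * 1 := mul_le_mul hl hcount (abs_nonneg _) (by positivity)
          _ = _ := by ring
      have e3 : l * (c - K / (Nat.lcm e₁ e₂ : ℝ)) = l * c - K * (l * (1 / (Nat.lcm e₁ e₂ : ℝ))) := by
        ring
      linarith
    have hcard : ((sieveF d Y).card : ℝ) ≤ Y := by
      have : (sieveF d Y).card ≤ (Finset.Icc 1 Y).card := Finset.card_filter_le _ _
      rw [Nat.card_Icc] at this
      exact_mod_cast this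
    calc _ ≤ ∑ e₁ ∈ sieveF d Y, ∑ e₂ ∈ sieveF d Y,
          (K * (sieveLam d Y e₁ * sieveLam d Y e₂ * (1 / (Nat.lcm e₁ e₂ : ℝ))) + Y ^ 2 * G ^ 2) :=
            Finset.sum_le_sum fun e₁ h₁ => Finset.sum_le_sum fun e₂ h₂ => e2 e₁ h₁ e₂ h₂
      _ = K * (∑ e₁ ∈ sieveF d Y, ∑ e₂ ∈ sieveF d Y,
          (sieveLam d Y e₁ * sieveLam d Y e₂ * (1 / (Nat.lcm e₁ e₂ : ℝ))))
          + ((sieveF d Y).card : ℝ) * ((sieveF d Y).card * (Y ^ 2 * G ^ 2)) := by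
            simp only [Finset.sum_add_distrib, Finset.sum_const, nsmul_eq_mul, Finset.mul_sum]
      _ ≤ K * G + Y * (Y * (Y ^ 2 * G ^ 2)) := by
            gcongr
            exact sieve_quad d Y
      _ = _ := by ring
  have : (((Finset.Ioc 0 K).filter (fun k => (1 + d * k).Prime ∧ Y < 1 + d * k)).card : ℝ)
      * G ^ 2 ≤ (K / G + Y ^ 4) * G ^ 2 := by
    calc _ ≤ K * G + Y ^ 4 * G ^ 2 := hlow.trans hup
      _ = _ := by field_simp
  exact le_of_mul_le_mul_right this (by positivity)


noncomputable def hfun (d : ℕ) : ℝ := ∏ q ∈ d.primeFactors, (1 + (1 : ℝ) / q)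

lemma one_le_hfun (d : ℕ) : 1 ≤ hfun d := by
  unfold hfun
  apply Finset.one_le_prod
  intro q _
  simp

lemma sum_inv_sq_le_two (Y : ℕ) : ∑ b ∈ Finset.Icc 1 Y, (1 : ℝ) / (b : ℝ) ^ 2 ≤ 2 := by
  rcases Nat.eq_zero_or_pos Y with h | h
  · subst h; simp
  · have : Finset.Icc 1 Y = insert 1 (Finset.Ioc 1 Y) := by
      ext x; simp only [Finset.mem_Icc, Finset.mem_insert, Finset.mem_Ioc]; omega
    rw [this, Finset.sum_insert (by simp)]
    have h2 := sum_Ioc_inv_sq_le_sub (α := ℝ) (k := 1) (n := Y) one_ne_zero h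
    have h3 : (0 : ℝ) ≤ (Y : ℝ)⁻¹ := by positivity
    simp only [one_div]
    norm_num at h2 ⊢
    linarith

lemma sieveG_lower (d Y : ℕ) (hd : d ≠ 0) :
    Real.log (Y + 1) ≤ 2 * hfun d * sieveG d Y := by
  have h0 : Real.log (Y + 1) ≤ ∑ m ∈ Finset.Icc 1 Y, (1 : ℝ) / m := by
    have := log_add_one_le_harmonic Y
    rw [harmonic_eq_sum_Icc] at this
    push_cast at this
    simpa using this
  refine h0.trans ?_
  have hdec : ∀ m ∈ Finset.Icc 1 Y, ∃ t : ℕ × Finset ℕ × ℕ,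
      t ∈ (Finset.Icc 1 Y) ×ˢ (d.primeFactors.powerset ×ˢ sieveF d Y) ∧
      m = t.1 ^ 2 * ((∏ q ∈ t.2.1, q) * t.2.2) := by
    intro m hm
    rw [Finset.mem_Icc] at hm
    obtain ⟨f, b, hf0, hb0, hm', hsq⟩ := Nat.sq_mul_squarefree_of_pos hm.1
    have hfm : f ≤ m := Nat.le_of_dvd hm.1 (Dvd.intro_left _ hm')
    have hbm : b ≤ m := by
      calc b ≤ b ^ 2 := Nat.le_self_pow two_ne_zero b
        _ ≤ m := Nat.le_of_dvd hm.1 (Dvd.intro _ hm')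
    set s := f.primeFactors.filter (fun q => q ∣ d)
    set s' := f.primeFactors.filter (fun q => ¬ q ∣ d)
    have hprod : (∏ q ∈ s, q) * (∏ q ∈ s', q) = f := by
      rw [Finset.prod_filter_mul_prod_filter_not]
      exact Nat.prod_primeFactors_of_squarefree hsq
    refine ⟨(b, s, ∏ q ∈ s', q), ?_, ?_⟩
    · simp only [Finset.mem_product, Finset.mem_Icc, Finset.mem_powerset, mem_sieveF]
      have hdvd : (∏ q ∈ s', q) ∣ f := Dvd.intro_left _ hprod
      refine ⟨⟨hb0, hbm.trans hm.2⟩, ?_, Nat.pos_of_dvd_of_pos hdvd hf0,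
        (Nat.le_of_dvd hf0 hdvd).trans (hfm.trans hm.2), hsq.squarefree_of_dvd hdvd, ?_⟩
      · intro q hq
        have := Finset.mem_filter.1 hq
        exact Nat.mem_primeFactors.2 ⟨Nat.prime_of_mem_primeFactors this.1, this.2, hd⟩
      · apply Nat.Coprime.prod_left
        intro q hq
        have := Finset.mem_filter.1 hq
        exact (Nat.Prime.coprime_iff_not_dvd (Nat.prime_of_mem_primeFactors this.1)).2 this.2
    · simp only
      rw [hprod, hm']
  choose! i hi1 hi2 using hdec
  have hinj : Set.InjOn i (Finset.Icc 1 Y : Finset ℕ) := by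
    intro x hx y hy hxy
    rw [hi2 x hx, hi2 y hy, hxy]
  set y : ℕ × Finset ℕ × ℕ → ℝ := fun t =>
    (1 : ℝ) / (t.1 : ℝ) ^ 2 * ((∏ q ∈ t.2.1, (1 : ℝ) / q) * (1 / t.2.2)) with hy
  have e1 : ∑ m ∈ Finset.Icc 1 Y, (1 : ℝ) / m = ∑ m ∈ Finset.Icc 1 Y, y (i m) := by
    apply Finset.sum_congr rfl
    intro m hm
    have h := hi2 m hm
    rw [hy]
    simp only
    have h' : (m : ℝ) = ((i m).1 : ℝ) ^ 2 * ((∏ q ∈ (i m).2.1, (q : ℝ)) * (i m).2.2) := by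
      have h2 := congrArg (Nat.cast (R := ℝ)) h
      push_cast at h2
      exact h2
    rw [h', Finset.prod_div_distrib, Finset.prod_const_one]
    simp only [one_div, mul_inv]
  rw [e1, ← Finset.sum_image hinj]
  have hsub : (Finset.Icc 1 Y).image i ⊆
      (Finset.Icc 1 Y) ×ˢ (d.primeFactors.powerset ×ˢ sieveF d Y) := by
    intro t ht
    obtain ⟨m, hm, rfl⟩ := Finset.mem_image.1 ht
    exact hi1 m hm
  have e2 : ∑ t ∈ (Finset.Icc 1 Y).image i, y t ≤
      ∑ t ∈ (Finset.Icc 1 Y) ×ˢ (d.primeFactors.powerset ×ˢ sieveF d Y), y t :=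
    Finset.sum_le_sum_of_subset_of_nonneg hsub (fun t _ _ => by rw [hy]; positivity)
  refine e2.trans ?_
  have e3 : ∑ t ∈ (Finset.Icc 1 Y) ×ˢ (d.primeFactors.powerset ×ˢ sieveF d Y), y t =
      (∑ b ∈ Finset.Icc 1 Y, (1 : ℝ) / (b : ℝ) ^ 2) * (hfun d * sieveG d Y) := by
    rw [hfun, Finset.prod_one_add, sieveG, Finset.sum_mul_sum, Finset.sum_mul_sum,
      Finset.sum_product]
    refine Finset.sum_congr rfl fun b _ => ?_
    rw [Finset.sum_product]
    refine Finset.sum_congr rfl fun s _ => ?_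
    rw [Finset.mul_sum]
  rw [e3, mul_assoc]
  have hG : 0 ≤ sieveG d Y := Finset.sum_nonneg (fun _ _ => by positivity)
  have := one_le_hfun d
  have := sum_inv_sq_le_two Y
  gcongr

/-- Brun-Titchmarsh for the progression 1 mod d. -/
lemma brun_titchmarsh (d K : ℕ) (hd : d ≠ 0) (hK : 2 ≤ K) :
    (((Finset.Ioc 0 K).filter (fun k => (1 + d * k).Prime)).card : ℝ)
      ≤ 20 * K * hfun d / Real.log K := by
  set Y := ⌊(K : ℝ) ^ ((1 : ℝ) / 8)⌋₊ with hYdef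
  have hK1 : (1 : ℝ) ≤ K := by exact_mod_cast (by omega : 1 ≤ K)
  have hKpos : (0 : ℝ) < K := by linarith
  have hlog : 0 < Real.log K := Real.log_pos (by exact_mod_cast (by omega : 1 < K))
  have hroot : 1 ≤ (K : ℝ) ^ ((1 : ℝ) / 8) := Real.one_le_rpow hK1 (by norm_num)
  have hY : 1 ≤ Y := Nat.le_floor (by simpa using hroot)
  have hYle : (Y : ℝ) ≤ (K : ℝ) ^ ((1 : ℝ) / 8) := Nat.floor_le (by linarith)
  have hh := one_le_hfun d
  have hG := sieveG_lower d Y hd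
  have hlogY : Real.log K / 8 ≤ Real.log (Y + 1) := by
    have : Real.log ((K : ℝ) ^ ((1 : ℝ) / 8)) = Real.log K / 8 := by
      rw [Real.log_rpow hKpos]; ring
    rw [← this]
    exact Real.log_le_log (by linarith) (Nat.lt_floor_add_one _).le
  have hY4 : (Y : ℝ) ^ 4 ≤ Real.sqrt K := by
    calc (Y : ℝ) ^ 4 ≤ ((K : ℝ) ^ ((1 : ℝ) / 8)) ^ 4 := by gcongr
      _ = Real.sqrt K := by
        rw [Real.sqrt_eq_rpow, ← Real.rpow_natCast, ← Real.rpow_mul hKpos.le]; norm_num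
  have hY1 : (Y : ℝ) ≤ (Y : ℝ) ^ 4 := le_self_pow₀ (by exact_mod_cast hY) (by norm_num)
  have hsqrt : Real.sqrt K * Real.log K ≤ 2 * K := by
    have h1 : Real.log K = 2 * Real.log (Real.sqrt K) := by
      rw [Real.log_sqrt hKpos.le]; ring
    have h2 : Real.log (Real.sqrt K) ≤ Real.sqrt K :=
      (Real.log_le_sub_one_of_pos (Real.sqrt_pos.2 hKpos)).trans (by linarith)
    have h3 := Real.mul_self_sqrt hKpos.le
    have h4 := Real.sqrt_nonneg (K : ℝ)
    nlinarith
  have hcard : (((Finset.Ioc 0 K).filter (fun k => (1 + d * k).Prime)).card : ℝ) ≤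
      (((Finset.Ioc 0 K).filter (fun k => (1 + d * k).Prime ∧ Y < 1 + d * k)).card : ℝ) + Y := by
    have hsub : (Finset.Ioc 0 K).filter (fun k => (1 + d * k).Prime) ⊆
        (Finset.Ioc 0 K).filter (fun k => (1 + d * k).Prime ∧ Y < 1 + d * k) ∪ Finset.Ioc 0 Y := by
      intro k hk
      obtain ⟨h1, h2⟩ := Finset.mem_filter.1 hk
      by_cases h3 : Y < 1 + d * k
      · exact Finset.mem_union_left _ (Finset.mem_filter.2 ⟨h1, h2, h3⟩)
      · apply Finset.mem_union_right
        rw [Finset.mem_Ioc] at h1 ⊢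
        have : k ≤ d * k := Nat.le_mul_of_pos_left k (Nat.pos_of_ne_zero hd)
        omega
    have := (Finset.card_le_card hsub).trans (Finset.card_union_le _ _)
    rw [Nat.card_Ioc] at this
    exact_mod_cast this
  have hmain := sieve_main d Y K hY
  have hGpos : 0 < sieveG d Y := by
    by_contra hneg
    push Not at hneg
    have : 2 * hfun d * sieveG d Y ≤ 0 := mul_nonpos_of_nonneg_of_nonpos (by linarith) hneg
    linarith
  have hKG : K / sieveG d Y ≤ 16 * K * hfun d / Real.log K := by
    rw [div_le_div_iff₀ hGpos hlog]
    have : Real.log K ≤ 16 * hfun d * sieveG d Y := by linarith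
    nlinarith
  have hs2 : Real.sqrt K ≤ 2 * K * hfun d / Real.log K := by
    rw [le_div_iff₀ hlog]
    nlinarith
  calc _ ≤ K / sieveG d Y + Y ^ 4 + Y := by linarith
    _ ≤ 16 * K * hfun d / Real.log K + 2 * K * hfun d / Real.log K
        + 2 * K * hfun d / Real.log K := by linarith
    _ = _ := by ring


lemma dyadic_sum (A : Finset ℕ) (x b : ℕ → ℝ) (J : Finset ℕ) (h : ∀ m ∈ A, Nat.log 2 m ∈ J)
    (hb : ∀ j ∈ J, ∑ m ∈ A.filter (fun m => Nat.log 2 m = j), x m ≤ b j) :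
    ∑ m ∈ A, x m ≤ ∑ j ∈ J, b j := by
  rw [← Finset.sum_fiberwise_of_maps_to h]
  exact Finset.sum_le_sum hb

lemma nat_log_bounds {m j : ℕ} (hm : m ≠ 0) (h : Nat.log 2 m = j) :
    (2 : ℝ) ^ j ≤ m ∧ (m : ℝ) < 2 ^ (j + 1) := by
  subst h
  constructor
  · exact_mod_cast Nat.pow_log_le_self 2 hm
  · exact_mod_cast Nat.lt_pow_succ_log_self (by norm_num) m

lemma half_lt_log_two : (1 : ℝ) / 2 < Real.log 2 := by
  have := Real.log_two_gt_d9; linarith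

lemma log_two_lt_one : Real.log 2 < 1 := by
  have := Real.log_two_lt_d9; linarith

lemma telescoping (J0 : ℕ) (hJ0 : 1 ≤ J0) (J : Finset ℕ) (hJ : ∀ j ∈ J, J0 ≤ j) :
    ∑ j ∈ J, (1 : ℝ) / (j * (j + 1)) ≤ 1 / J0 := by
  have hsub : J ⊆ Finset.Ico J0 (J0 + (J.sup id + 1)) := by
    intro j hj
    rw [Finset.mem_Ico]
    have h2 : j ≤ J.sup id := Finset.le_sup (f := id) hj
    have := hJ j hj
    omega
  have h1 : ∑ j ∈ J, (1 : ℝ) / (j * (j + 1)) ≤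
      ∑ j ∈ Finset.Ico J0 (J0 + (J.sup id + 1)), (1 : ℝ) / (j * (j + 1)) :=
    Finset.sum_le_sum_of_subset_of_nonneg hsub (fun _ _ _ => by positivity)
  have h2 : ∀ M : ℕ, ∑ j ∈ Finset.Ico J0 (J0 + M), (1 : ℝ) / (j * (j + 1))
      ≤ 1 / J0 - 1 / (J0 + M : ℕ) := by
    intro M
    induction M with
    | zero => simp
    | succ M ih =>
      rw [← add_assoc, Finset.sum_Ico_succ_top (by omega)]
      have hp : (0 : ℝ) < ((J0 + M : ℕ) : ℝ) := by exact_mod_cast (by omega : 0 < J0 + M)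
      have : (1 : ℝ) / ((J0 + M : ℕ) * ((J0 + M : ℕ) + 1)) = 1 / (J0 + M : ℕ) - 1 / (J0 + M + 1 : ℕ) := by
        push_cast at hp ⊢
        field_simp
        ring
      linarith
  have := h2 (J.sup id + 1)
  have h3 : (0 : ℝ) ≤ 1 / (J0 + (J.sup id + 1) : ℕ) := by positivity
  linarith

lemma tail_sum (A : Finset ℕ) (x : ℕ → ℝ) (w B : ℝ) (hw : 4 ≤ w) (hB : 0 ≤ B)
    (hA : ∀ m ∈ A, w ≤ m)
    (hb : ∀ j : ℕ, 1 ≤ j → ∑ m ∈ A.filter (fun m => Nat.log 2 m = j), x m ≤ B / (j * (j + 1))) :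
    ∑ m ∈ A, x m ≤ 2 * B / Real.log w := by
  set J0 := Nat.log 2 ⌊w⌋₊ with hJ0
  have hf : 4 ≤ ⌊w⌋₊ := Nat.le_floor (by exact_mod_cast hw)
  have hJ1 : 1 ≤ J0 := by
    have : Nat.log 2 2 ≤ J0 := Nat.log_mono_right (by omega)
    rwa [show Nat.log 2 2 = 1 from by norm_num] at this
  have hmem : ∀ m ∈ A, J0 ≤ Nat.log 2 m := by
    intro m hm
    apply Nat.log_mono_right
    exact Nat.floor_le_of_le (hA m hm)
  have h1 := dyadic_sum A x (fun j => B / (j * (j + 1))) (A.image (Nat.log 2))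
    (fun m hm => Finset.mem_image_of_mem _ hm) (by
      intro j hj
      obtain ⟨m, hm, rfl⟩ := Finset.mem_image.1 hj
      exact hb _ (hJ1.trans (hmem m hm)))
  have h2 := telescoping J0 hJ1 (A.image (Nat.log 2)) (by
      intro j hj
      obtain ⟨m, hm, rfl⟩ := Finset.mem_image.1 hj
      exact hmem m hm)
  have h3 : Real.log w ≤ 2 * J0 := by
    have h4 : w < 2 ^ (J0 + 1) := by
      have : ⌊w⌋₊ < 2 ^ (J0 + 1) := Nat.lt_pow_succ_log_self (by norm_num) _
      have h5 : (⌊w⌋₊ : ℝ) + 1 ≤ 2 ^ (J0 + 1) := by exact_mod_cast this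
      linarith [Nat.lt_floor_add_one w]
    have h6 : Real.log w ≤ Real.log (2 ^ (J0 + 1)) := Real.log_le_log (by linarith) h4.le
    rw [Real.log_pow] at h6
    have h7 : (1 : ℝ) ≤ J0 := by exact_mod_cast hJ1
    have := log_two_lt_one
    push_cast at h6
    nlinarith
  have hlw : 0 < Real.log w := Real.log_pos (by linarith)
  have hJp : (0 : ℝ) < J0 := by exact_mod_cast hJ1
  calc _ ≤ ∑ j ∈ A.image (Nat.log 2), B / ((j : ℝ) * (j + 1)) := h1
    _ = B * ∑ j ∈ A.image (Nat.log 2), 1 / ((j : ℝ) * (j + 1)) := by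
      rw [Finset.mul_sum]; refine Finset.sum_congr rfl fun j _ => by ring
    _ ≤ B * (1 / J0) := by gcongr
    _ ≤ 2 * B / Real.log w := by
      rw [mul_one_div, div_le_div_iff₀ hJp hlw]
      nlinarith

/-- primes ≡ 1 mod d up to N -/
lemma bt_count (d N : ℕ) (hd : d ≠ 0) (hK : 2 ≤ N / d) (A : Finset ℕ)
    (hA : ∀ p ∈ A, p.Prime ∧ d ∣ p - 1 ∧ p ≤ N) :
    (A.card : ℝ) ≤ 20 * ((N : ℝ) / d) * hfun d / Real.log (N / d : ℕ) := by
  have hsub : A ⊆ ((Finset.Ioc 0 (N / d)).filter (fun k => (1 + d * k).Prime)).image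
      (fun k => 1 + d * k) := by
    intro p hp
    obtain ⟨h1, ⟨k, h2⟩, h3⟩ := hA p hp
    have h4 := h1.two_le
    have h5 : p = 1 + d * k := by omega
    refine Finset.mem_image.2 ⟨k, Finset.mem_filter.2 ⟨Finset.mem_Ioc.2 ⟨?_, ?_⟩, ?_⟩, h5.symm⟩
    · rcases Nat.eq_zero_or_pos k with h | h
      · subst h; simp at h5; omega
      · exact h
    · rw [Nat.le_div_iff_mul_le (Nat.pos_of_ne_zero hd)]
      rw [mul_comm]; omega
    · rw [← h5]; exact h1
  have hc := (Finset.card_le_card hsub).trans Finset.card_image_le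
  have hbt := brun_titchmarsh d (N / d) hd hK
  have hlog : 0 < Real.log (N / d : ℕ) := Real.log_pos (by exact_mod_cast (by omega : 1 < N / d))
  have hh := one_le_hfun d
  calc (A.card : ℝ) ≤ _ := by exact_mod_cast hc
    _ ≤ _ := hbt
    _ ≤ _ := by
      gcongr
      exact Nat.cast_div_le

lemma prime_block (j : ℕ) (A : Finset ℕ) (hA : ∀ p ∈ A, p.Prime ∧ Nat.log 2 p = j) :
    (A.card : ℝ) ≤ 80 * 2 ^ j / (j + 1) := by
  have h := bt_count 1 (2 ^ (j + 1)) one_ne_zero (by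
    rw [Nat.div_one, pow_succ]; have := Nat.one_le_two_pow (n := j); omega) A (by
      intro p hp
      obtain ⟨h1, h2⟩ := hA p hp
      refine ⟨h1, one_dvd _, ?_⟩
      have := (nat_log_bounds h1.ne_zero h2).2
      exact_mod_cast this.le)
  have h1 : hfun 1 = 1 := by simp [hfun]
  rw [h1, Nat.div_one] at h
  push_cast at h
  rw [Real.log_pow] at h
  refine h.trans ?_
  have := half_lt_log_two
  push_cast
  rw [div_le_div_iff₀ (by positivity) (by positivity)]
  have h2 : (0 : ℝ) < 2 ^ j * (j + 1) := by positivity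
  rw [pow_succ]
  nlinarith

lemma sum_log_div (z : ℝ) (hz : 2 ≤ z) (A : Finset ℕ) (hA : ∀ q ∈ A, q.Prime ∧ (q : ℝ) ≤ z) :
    ∑ q ∈ A, Real.log q / q ≤ 320 * Real.log z := by
  have h1 := dyadic_sum A (fun q => Real.log q / q) (fun _ => 80)
    (Finset.range (Nat.log 2 ⌊z⌋₊ + 1)) (by
      intro m hm
      rw [Finset.mem_range, Nat.lt_succ_iff]
      exact Nat.log_mono_right (Nat.le_floor (hA m hm).2)) (by
      intro j _
      have hc := prime_block j (A.filter (fun m => Nat.log 2 m = j)) (by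
        intro p hp
        obtain ⟨h1, h2⟩ := Finset.mem_filter.1 hp
        exact ⟨(hA p h1).1, h2⟩)
      have hx : ∀ m ∈ A.filter (fun m => Nat.log 2 m = j), Real.log m / m ≤ (j + 1) / 2 ^ j := by
        intro m hm
        obtain ⟨h1, h2⟩ := Finset.mem_filter.1 hm
        have hm0 := (hA m h1).1.pos
        have hb := nat_log_bounds hm0.ne' h2
        have hm0' : (0 : ℝ) < m := by exact_mod_cast hm0
        have hl : Real.log m ≤ j + 1 := by
          calc Real.log m ≤ Real.log (2 ^ (j + 1)) := Real.log_le_log hm0' hb.2.le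
            _ = (j + 1) * Real.log 2 := by rw [Real.log_pow]; push_cast; ring
            _ ≤ (j + 1) * 1 := by gcongr; exact log_two_lt_one.le
            _ = _ := by ring
        exact div_le_div₀ (by positivity) hl (by positivity) hb.1
      calc _ ≤ ∑ m ∈ A.filter (fun m => Nat.log 2 m = j), ((j : ℝ) + 1) / 2 ^ j :=
            Finset.sum_le_sum hx
        _ = (A.filter (fun m => Nat.log 2 m = j)).card * (((j : ℝ) + 1) / 2 ^ j) := by
            rw [Finset.sum_const, nsmul_eq_mul]
        _ ≤ 80 * 2 ^ j / (j + 1) * (((j : ℝ) + 1) / 2 ^ j) := by gcongr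
        _ = 80 := by field_simp)
  refine h1.trans ?_
  rw [Finset.sum_const, Finset.card_range, nsmul_eq_mul]
  have hf : ⌊z⌋₊ ≠ 0 := by
    have : 2 ≤ ⌊z⌋₊ := Nat.le_floor (by exact_mod_cast hz)
    omega
  have h2 : (2 : ℝ) ^ (Nat.log 2 ⌊z⌋₊) ≤ z :=
    (nat_log_bounds hf rfl).1.trans (Nat.floor_le (by linarith))
  have h3 := Real.log_le_log (by positivity) h2
  rw [Real.log_pow] at h3
  have h4 := Real.log_le_log (by norm_num) hz
  have := half_lt_log_two
  have h5 : (0 : ℝ) ≤ Nat.log 2 ⌊z⌋₊ := by positivity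
  push_cast
  nlinarith

lemma sum_inv_mul_log (w : ℝ) (hw : 4 ≤ w) (A : Finset ℕ) (hA : ∀ q ∈ A, q.Prime ∧ w ≤ q) :
    ∑ q ∈ A, (1 : ℝ) / (q * Real.log q) ≤ 320 / Real.log w := by
  have := tail_sum A (fun q => (1 : ℝ) / (q * Real.log q)) w 160 hw (by norm_num)
    (fun m hm => (hA m hm).2) (by
      intro j hj
      have hj' : (1 : ℝ) ≤ j := by exact_mod_cast hj
      have hc := prime_block j (A.filter (fun m => Nat.log 2 m = j)) (by
        intro p hp
        obtain ⟨h1, h2⟩ := Finset.mem_filter.1 hp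
        exact ⟨(hA p h1).1, h2⟩)
      have hx : ∀ m ∈ A.filter (fun m => Nat.log 2 m = j),
          (1 : ℝ) / (m * Real.log m) ≤ 2 / (2 ^ j * j) := by
        intro m hm
        obtain ⟨h1, h2⟩ := Finset.mem_filter.1 hm
        have hm0 := (hA m h1).1.pos
        have hb := nat_log_bounds hm0.ne' h2
        have hl : (j : ℝ) / 2 ≤ Real.log m := by
          calc (j : ℝ) / 2 ≤ j * Real.log 2 := by have := half_lt_log_two; nlinarith
            _ = Real.log (2 ^ j) := by rw [Real.log_pow]
            _ ≤ _ := Real.log_le_log (by positivity) hb.1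
        calc (1 : ℝ) / (m * Real.log m) ≤ 1 / (2 ^ j * (j / 2)) := by
              apply one_div_le_one_div_of_le (by positivity)
              exact mul_le_mul hb.1 hl (by positivity) (by positivity)
          _ = _ := by field_simp
      calc _ ≤ ∑ m ∈ A.filter (fun m => Nat.log 2 m = j), (2 : ℝ) / (2 ^ j * j) :=
            Finset.sum_le_sum hx
        _ = (A.filter (fun m => Nat.log 2 m = j)).card * ((2 : ℝ) / (2 ^ j * j)) := by
            rw [Finset.sum_const, nsmul_eq_mul]
        _ ≤ 80 * 2 ^ j / (j + 1) * ((2 : ℝ) / (2 ^ j * j)) := by gcongr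
        _ = 160 / (j * (j + 1)) := by field_simp; norm_num)
  refine this.trans (le_of_eq (by ring))

lemma large_facts : ∃ w₀ : ℝ, 16 ≤ w₀ ∧ ∀ x : ℝ, w₀ ≤ x →
    (Real.log x) ^ 4 ≤ x ∧ (Real.log x) ^ 2 * (Real.sqrt x + 1) ≤ x ∧ 3 ≤ Real.log x := by
  have h := (Real.isLittleO_pow_log_id_atTop (n := 8)).bound (c := 1 / 16) (by norm_num)
  have h2 := Real.tendsto_log_atTop.eventually_ge_atTop 3
  obtain ⟨w, hw⟩ := Filter.eventually_atTop.1 (h.and h2)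
  refine ⟨max w 16, le_max_right _ _, fun x hx => ?_⟩
  have hx16 : (16 : ℝ) ≤ x := (le_max_right _ _).trans hx
  obtain ⟨h3, h4⟩ := hw x ((le_max_left _ _).trans hx)
  simp only [id, Real.norm_eq_abs] at h3
  rw [abs_of_nonneg (by positivity), abs_of_nonneg (by linarith)] at h3
  have hs := Real.mul_self_sqrt (by linarith : (0 : ℝ) ≤ x)
  have hs1 : 1 ≤ Real.sqrt x := Real.one_le_sqrt.2 (by linarith)
  set l := Real.log x
  set s := Real.sqrt x
  have h5 : l ^ 4 ≤ s / 4 := by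
    apply (sq_le_sq₀ (by positivity) (by positivity)).1
    calc (l ^ 4) ^ 2 = l ^ 8 := by ring
      _ ≤ 1 / 16 * x := h3
      _ = (s / 4) ^ 2 := by rw [← hs]; ring
  have h6 : l ^ 2 ≤ l ^ 4 := pow_le_pow_right₀ (by linarith) (by norm_num)
  refine ⟨by nlinarith, ?_, h4⟩
  calc l ^ 2 * (s + 1) ≤ (s / 4) * (s + s) := by gcongr; linarith
    _ ≤ x := by nlinarith

lemma middle_inner {w₀ : ℝ} (hw₀ : 16 ≤ w₀) (hw : ∀ x : ℝ, w₀ ≤ x →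
    (Real.log x) ^ 4 ≤ x ∧ (Real.log x) ^ 2 * (Real.sqrt x + 1) ≤ x ∧ 3 ≤ Real.log x)
    (q : ℕ) (hq : q.Prime) (hqw : w₀ ≤ q) (A : Finset ℕ)
    (hA : ∀ r ∈ A, r.Prime ∧ q ∣ r - 1 ∧ (q : ℝ) ^ 2 ≤ r * Real.log q ^ 2 ∧
      (r : ℝ) ≤ (q : ℝ) ^ 2 * Real.log q ^ 4) :
    ∑ r ∈ A, (1 : ℝ) / r ≤ 2240 * Real.log (Real.log q) / (q * Real.log q) := by
  obtain ⟨f1, f2, f3⟩ := hw q hqw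
  have hq16 : (16 : ℝ) ≤ q := hw₀.trans hqw
  set l := Real.log q with hl
  have hll : 1 ≤ Real.log l := by
    rw [Real.le_log_iff_exp_le (by linarith)]
    have := Real.exp_one_lt_d9; linarith
  rcases A.eq_empty_or_nonempty with hemp | hne
  · subst hemp; simp only [Finset.sum_empty]; positivity
  have hpos : ∀ r ∈ A, (0 : ℝ) < r := fun r hr => by exact_mod_cast (hA r hr).1.pos
  have h1 := dyadic_sum A (fun r => (1 : ℝ) / r) (fun _ => 160 / (q * l)) (A.image (Nat.log 2))
    (fun m hm => Finset.mem_image_of_mem _ hm) (by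
      intro j hj
      obtain ⟨r₀, hr₀, hr₀j⟩ := Finset.mem_image.1 hj
      have hr₀b := nat_log_bounds (hA r₀ hr₀).1.ne_zero hr₀j
      have hlow : Real.sqrt q ≤ (2 ^ (j + 1) / q : ℕ) := by
        have g1 : (q : ℝ) * (Real.sqrt q + 1) ≤ r₀ := by
          have := (hA r₀ hr₀).2.2.1
          have hl2 : (0 : ℝ) < l ^ 2 := by positivity
          refine le_of_mul_le_mul_right ?_ hl2
          calc (q : ℝ) * (Real.sqrt q + 1) * l ^ 2 = (q : ℝ) * (l ^ 2 * (Real.sqrt q + 1)) := by ring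
            _ ≤ (q : ℝ) * q := by gcongr
            _ = (q : ℝ) ^ 2 := by ring
            _ ≤ _ := this
        have g2 : Real.sqrt q + 1 ≤ (2 ^ (j + 1) : ℕ) / (q : ℝ) := by
          rw [le_div_iff₀ (by linarith)]
          push_cast
          linarith
        have g3 : ((2 ^ (j + 1) : ℕ) : ℝ) / (q : ℝ) < (2 ^ (j + 1) / q : ℕ) + 1 := by
          rw [← Nat.floor_div_eq_div (K := ℝ)]
          exact Nat.lt_floor_add_one _
        linarith
      have hs4 : (4 : ℝ) ≤ Real.sqrt q := by
        apply Real.le_sqrt_of_sq_le; linarith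
      have hK2 : 2 ≤ 2 ^ (j + 1) / q := by
        have : (2 : ℝ) ≤ (2 ^ (j + 1) / q : ℕ) := by linarith
        exact_mod_cast this
      have hc := bt_count q (2 ^ (j + 1)) hq.ne_zero hK2 (A.filter (fun m => Nat.log 2 m = j)) (by
        intro r hr
        obtain ⟨h1, h2⟩ := Finset.mem_filter.1 hr
        refine ⟨(hA r h1).1, (hA r h1).2.1, ?_⟩
        have := (nat_log_bounds (hA r h1).1.ne_zero h2).2
        exact_mod_cast this.le)
      have hh : hfun q ≤ 2 := by
        rw [hfun, hq.primeFactors, Finset.prod_singleton]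
        have : (1 : ℝ) / q ≤ 1 := by rw [div_le_one (by linarith)]; linarith
        linarith
      have hlg : l / 2 ≤ Real.log (2 ^ (j + 1) / q : ℕ) := by
        calc l / 2 = Real.log (Real.sqrt q) := by rw [Real.log_sqrt (by linarith)]
          _ ≤ _ := Real.log_le_log (by linarith) hlow
      have hx : ∀ m ∈ A.filter (fun m => Nat.log 2 m = j), (1 : ℝ) / m ≤ 1 / 2 ^ j := by
        intro m hm
        obtain ⟨h1, h2⟩ := Finset.mem_filter.1 hm
        exact one_div_le_one_div_of_le (by positivity)
          (nat_log_bounds (hA m h1).1.ne_zero h2).1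
      have hqp : (0 : ℝ) < q := by linarith
      calc _ ≤ ∑ m ∈ A.filter (fun m => Nat.log 2 m = j), (1 : ℝ) / 2 ^ j :=
            Finset.sum_le_sum hx
        _ = (A.filter (fun m => Nat.log 2 m = j)).card * ((1 : ℝ) / 2 ^ j) := by
            rw [Finset.sum_const, nsmul_eq_mul]
        _ ≤ (20 * (((2 ^ (j + 1) : ℕ) : ℝ) / q) * hfun q / Real.log (2 ^ (j + 1) / q : ℕ))
              * ((1 : ℝ) / 2 ^ j) := by gcongr
        _ ≤ (20 * (((2 ^ (j + 1) : ℕ) : ℝ) / q) * 2 / (l / 2)) * ((1 : ℝ) / 2 ^ j) := by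
            gcongr
        _ = 160 / (q * l) := by
            push_cast
            rw [pow_succ]
            field_simp
            norm_num)
  refine h1.trans ?_
  rw [Finset.sum_const, nsmul_eq_mul]
  have hcard : ((A.image (Nat.log 2)).card : ℝ) ≤ 14 * Real.log l := by
    have hJne : (A.image (Nat.log 2)).Nonempty := hne.image _
    set J := A.image (Nat.log 2)
    have hsub : J ⊆ Finset.Icc (J.min' hJne) (J.max' hJne) := fun j hj =>
      Finset.mem_Icc.2 ⟨J.min'_le j hj, J.le_max' j hj⟩
    have hc := Finset.card_le_card hsub
    rw [Nat.card_Icc] at hc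
    obtain ⟨r₁, hr₁, h1⟩ := Finset.mem_image.1 (J.min'_mem hJne)
    obtain ⟨r₂, hr₂, h2⟩ := Finset.mem_image.1 (J.max'_mem hJne)
    have hle : J.min' hJne ≤ J.max' hJne := J.min'_le _ (J.max'_mem hJne)
    set j1 := J.min' hJne
    set j2 := J.max' hJne
    have b1 := nat_log_bounds (hA r₁ hr₁).1.ne_zero h1
    have b2 := nat_log_bounds (hA r₂ hr₂).1.ne_zero h2
    have hr : (2 : ℝ) ^ j2 ≤ 2 ^ (j1 + 1) * l ^ 6 := by
      have c1 := (hA r₁ hr₁).2.2.1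
      have c2 := (hA r₂ hr₂).2.2.2
      calc (2 : ℝ) ^ j2 ≤ r₂ := b2.1
        _ ≤ (q : ℝ) ^ 2 * l ^ 4 := c2
        _ ≤ (r₁ * l ^ 2) * l ^ 4 := by gcongr
        _ = r₁ * l ^ 6 := by ring
        _ ≤ _ := by gcongr; exact b1.2.le
    have hlg := Real.log_le_log (by positivity) hr
    rw [Real.log_mul (by positivity) (by positivity), Real.log_pow, Real.log_pow, Real.log_pow]
      at hlg
    push_cast at hlg
    have hh := half_lt_log_two
    have hcc : (J.card : ℝ) ≤ j2 - j1 + 1 := by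
      have : J.card + j1 ≤ j2 + 1 := by omega
      have : (J.card : ℝ) + j1 ≤ j2 + 1 := by exact_mod_cast this
      linarith
    have hd : ((j2 : ℝ) - j1 - 1) * Real.log 2 ≤ 6 * Real.log l := by linarith
    have : (j2 : ℝ) - j1 - 1 ≤ 12 * Real.log l := by
      by_contra hcon
      push Not at hcon
      nlinarith
    linarith
  have hqp : (0 : ℝ) < q := by linarith
  calc _ ≤ (14 * Real.log l) * (160 / (q * l)) := by gcongr
    _ = _ := by ring

/-- S3: sum over middle primes. -/
lemma middle_sum {w₀ : ℝ} (hw₀ : 16 ≤ w₀) (hw : ∀ x : ℝ, w₀ ≤ x →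
    (Real.log x) ^ 4 ≤ x ∧ (Real.log x) ^ 2 * (Real.sqrt x + 1) ≤ x ∧ 3 ≤ Real.log x)
    (w X : ℝ) (hww : w₀ ≤ w) (hX : w₀ ≤ X) (A : Finset ℕ)
    (hA : ∀ r ∈ A, r.Prime ∧ (r : ℝ) ≤ X ∧ ∃ q : ℕ, q.Prime ∧ w ≤ q ∧ q ∣ r - 1 ∧
      (q : ℝ) ^ 2 ≤ r * Real.log q ^ 2 ∧ (r : ℝ) ≤ (q : ℝ) ^ 2 * Real.log q ^ 4) :
    ∑ r ∈ A, (1 : ℝ) / r ≤ 716800 * Real.log (Real.log X) / Real.log w := by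
  choose! hp hrX qf hqp hqw hqd hq1 hq2 using hA
  have hlX := (hw X hX).2.2
  have hllX : 0 ≤ Real.log (Real.log X) := Real.log_nonneg (by linarith)
  rw [← Finset.sum_fiberwise_of_maps_to (fun r hr => Finset.mem_image_of_mem qf hr)]
  have h1 : ∀ q ∈ A.image qf, ∑ r ∈ A.filter (fun r => qf r = q), (1 : ℝ) / r ≤
      2240 * Real.log (Real.log X) * (1 / (q * Real.log q)) := by
    intro q hq
    obtain ⟨r₀, hr₀, rfl⟩ := Finset.mem_image.1 hq
    have hqw0 : w₀ ≤ qf r₀ := hww.trans (hqw r₀ hr₀)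
    have hlq := (hw _ hqw0).2.2
    have hqpos : (0 : ℝ) < qf r₀ := by linarith
    have h2 := middle_inner hw₀ hw (qf r₀) (hqp r₀ hr₀) hqw0
      (A.filter (fun r => qf r = qf r₀)) (by
        intro r hr
        obtain ⟨h3, h4⟩ := Finset.mem_filter.1 hr
        rw [← h4]
        exact ⟨hp r h3, hqd r h3, hq1 r h3, hq2 r h3⟩)
    refine h2.trans ?_
    have hqX : (qf r₀ : ℝ) ≤ X := by
      have h5 := Nat.le_of_dvd (by have := (hp r₀ hr₀).two_le; omega) (hqd r₀ hr₀)
      have h6 : (qf r₀ : ℝ) ≤ r₀ := by exact_mod_cast (by omega : qf r₀ ≤ r₀)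
      linarith [hrX r₀ hr₀]
    have h7 : Real.log (Real.log (qf r₀)) ≤ Real.log (Real.log X) :=
      Real.log_le_log (by linarith) (Real.log_le_log hqpos hqX)
    rw [← mul_one_div]
    gcongr
  refine (Finset.sum_le_sum h1).trans ?_
  rw [← Finset.mul_sum]
  have h3 := sum_inv_mul_log w (by linarith) (A.image qf) (by
    intro q hq
    obtain ⟨r₀, hr₀, rfl⟩ := Finset.mem_image.1 hq
    exact ⟨hqp r₀ hr₀, hqw r₀ hr₀⟩)
  calc _ ≤ 2240 * Real.log (Real.log X) * (320 / Real.log w) := by gcongr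
    _ = _ := by ring

lemma card_primeFactors_pow_sub (a m : ℕ) (ha : 1 < a) (hm : 1 ≤ m) :
    (a ^ m - 1).primeFactors.card ≤ a * m := by
  have h0 : a ^ m - 1 ≠ 0 := by
    have : 1 < a ^ m := Nat.one_lt_pow (by omega) ha
    omega
  have h1 : 2 ^ (a ^ m - 1).primeFactors.card ≤ a ^ m - 1 := by
    calc 2 ^ (a ^ m - 1).primeFactors.card = ∏ _q ∈ (a ^ m - 1).primeFactors, 2 := by
          rw [Finset.prod_const]
      _ ≤ ∏ q ∈ (a ^ m - 1).primeFactors, q :=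
          Finset.prod_le_prod' (fun q hq => (Nat.prime_of_mem_primeFactors hq).two_le)
      _ ≤ _ := Nat.le_of_dvd (Nat.pos_of_ne_zero h0) (Nat.prod_primeFactors_dvd _)
  have h2 : a ^ m ≤ 2 ^ (a * m) := by
    rw [pow_mul]
    exact Nat.pow_le_pow_left (Nat.lt_two_pow_self).le m
  exact (Nat.pow_le_pow_iff_right (by norm_num : 1 < 2)).1 (h1.trans ((Nat.sub_le _ _).trans h2))

/-- S4: sum over primes for which `a` has small order. -/
lemma small_order_sum (a : ℕ) (ha : 1 < a) (w : ℝ) (hw : 4 ≤ w) (A : Finset ℕ)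
    (hA : ∀ r ∈ A, r.Prime ∧ w ≤ r ∧ 0 < orderOf (a : ZMod r) ∧
      (orderOf (a : ZMod r) : ℝ) * Real.log r ≤ 2 * Real.sqrt r) :
    ∑ r ∈ A, (1 : ℝ) / r ≤ 128 * a / Real.log w := by
  have := tail_sum A (fun r => (1 : ℝ) / r) w (64 * a) hw (by positivity)
    (fun m hm => (hA m hm).2.1) (by
      intro j hj
      have hj' : (1 : ℝ) ≤ j := by exact_mod_cast hj
      set M : ℝ := 4 * Real.sqrt (2 ^ (j + 1)) / j with hM
      have hM0 : 0 ≤ M := by positivity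
      have hsub : A.filter (fun m => Nat.log 2 m = j) ⊆
          (Finset.Icc 1 ⌊M⌋₊).biUnion (fun m => (a ^ m - 1).primeFactors) := by
        intro r hr
        obtain ⟨h1, h2⟩ := Finset.mem_filter.1 hr
        obtain ⟨hp, _, ho, hs⟩ := hA r h1
        have hb := nat_log_bounds hp.ne_zero h2
        rw [Finset.mem_biUnion]
        refine ⟨orderOf (a : ZMod r), Finset.mem_Icc.2 ⟨ho, Nat.le_floor ?_⟩, ?_⟩
        · have hl : (j : ℝ) / 2 ≤ Real.log r := by
            calc (j : ℝ) / 2 ≤ j * Real.log 2 := by have := half_lt_log_two; nlinarith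
              _ = Real.log (2 ^ j) := by rw [Real.log_pow]
              _ ≤ _ := Real.log_le_log (by positivity) hb.1
          have hsq : Real.sqrt r ≤ Real.sqrt (2 ^ (j + 1)) := Real.sqrt_le_sqrt hb.2.le
          rw [hM, le_div_iff₀ (by linarith)]
          have : (orderOf (a : ZMod r) : ℝ) * (j / 2) ≤ orderOf (a : ZMod r) * Real.log r := by
            gcongr
          linarith
        · have h3 : ((a ^ orderOf (a : ZMod r) - 1 : ℕ) : ZMod r) = 0 := by
            rw [Nat.cast_sub (Nat.one_le_pow _ _ (by omega))]
            push_cast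
            rw [pow_orderOf_eq_one]; simp
          rw [ZMod.natCast_eq_zero_iff] at h3
          refine Nat.mem_primeFactors.2 ⟨hp, h3, ?_⟩
          have : 1 < a ^ orderOf (a : ZMod r) := Nat.one_lt_pow (by omega) ha
          omega
      have hcard : ((A.filter (fun m => Nat.log 2 m = j)).card : ℝ) ≤ M * (a * M) := by
        have h1 := (Finset.card_le_card hsub).trans Finset.card_biUnion_le
        have h2 : ∀ m ∈ Finset.Icc 1 ⌊M⌋₊, ((a ^ m - 1).primeFactors.card : ℝ) ≤ a * M := by
          intro m hm
          rw [Finset.mem_Icc] at hm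
          have h3 := card_primeFactors_pow_sub a m ha hm.1
          have h4 : (m : ℝ) ≤ M := (Nat.le_floor_iff hM0).1 hm.2
          calc ((a ^ m - 1).primeFactors.card : ℝ) ≤ ((a * m : ℕ) : ℝ) := by exact_mod_cast h3
            _ = a * m := by push_cast; ring
            _ ≤ a * M := by gcongr
        calc ((A.filter (fun m => Nat.log 2 m = j)).card : ℝ)
            ≤ ∑ m ∈ Finset.Icc 1 ⌊M⌋₊, ((a ^ m - 1).primeFactors.card : ℝ) := by exact_mod_cast h1
          _ ≤ ∑ m ∈ Finset.Icc 1 ⌊M⌋₊, (a * M) := Finset.sum_le_sum h2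
          _ = ⌊M⌋₊ * (a * M) := by
              rw [Finset.sum_const, Nat.card_Icc, nsmul_eq_mul]; simp
          _ ≤ _ := by gcongr; exact Nat.floor_le hM0
      have hx : ∀ m ∈ A.filter (fun m => Nat.log 2 m = j), (1 : ℝ) / m ≤ 1 / 2 ^ j := by
        intro m hm
        obtain ⟨h1, h2⟩ := Finset.mem_filter.1 hm
        exact one_div_le_one_div_of_le (by positivity)
          (nat_log_bounds (hA m h1).1.ne_zero h2).1
      have hMM : M * M = 32 * 2 ^ j / j ^ 2 := by
        rw [hM]
        have := Real.mul_self_sqrt (by positivity : (0 : ℝ) ≤ 2 ^ (j + 1))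
        calc 4 * Real.sqrt (2 ^ (j + 1)) / (j : ℝ) * (4 * Real.sqrt (2 ^ (j + 1)) / j)
            = 16 * (Real.sqrt (2 ^ (j + 1)) * Real.sqrt (2 ^ (j + 1))) / j ^ 2 := by ring
          _ = _ := by rw [this, pow_succ]; ring
      calc _ ≤ ∑ m ∈ A.filter (fun m => Nat.log 2 m = j), (1 : ℝ) / 2 ^ j :=
            Finset.sum_le_sum hx
        _ = (A.filter (fun m => Nat.log 2 m = j)).card * ((1 : ℝ) / 2 ^ j) := by
            rw [Finset.sum_const, nsmul_eq_mul]
        _ ≤ M * (a * M) * ((1 : ℝ) / 2 ^ j) := by gcongr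
        _ = a * (M * M) * ((1 : ℝ) / 2 ^ j) := by ring
        _ = 32 * a / j ^ 2 := by rw [hMM]; field_simp
        _ ≤ 64 * a / (j * (j + 1)) := by
            rw [div_le_div_iff₀ (by positivity) (by positivity)]
            have : (j : ℝ) * (j + 1) ≤ 2 * j ^ 2 := by nlinarith
            nlinarith [mul_le_mul_of_nonneg_left this (by positivity : (0 : ℝ) ≤ 32 * a)])
  refine this.trans (le_of_eq (by ring))


noncomputable def smallPrimes (z : ℝ) (p : ℕ) : Finset ℕ :=
  (p - 1).primeFactors.filter (fun q => (q : ℝ) ≤ z)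

noncomputable def sfun (z : ℝ) (p : ℕ) : ℕ := ∏ q ∈ smallPrimes z p, q

lemma subset_weight (z σ U : ℝ) (hz : 1 ≤ z) (hσ : 0 ≤ σ) (hzσ : z ^ σ ≤ Real.exp 1) (hU : 1 ≤ U)
    (S : Finset ℕ) (hS : ∀ q ∈ S, 1 ≤ q ∧ (q : ℝ) ≤ z) (hSU : ((∏ q ∈ S, q : ℕ) : ℝ) ≤ U ^ 4) :
    ((∏ q ∈ S, q : ℕ) : ℝ) ^ σ ≤ Real.exp 4 *
      ∑ e ∈ S.powerset.filter (fun e => ((∏ q ∈ e, q : ℕ) : ℝ) ≤ U),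
        ∏ q ∈ e, ((q : ℝ) ^ (4 * σ) - 1) := by
  classical
  have hne : (S.powerset.filter (fun e => ((∏ q ∈ e, q : ℕ) : ℝ) ≤ U)).Nonempty :=
    ⟨∅, by simp [hU]⟩
  obtain ⟨e, he, hmax⟩ := Finset.exists_max_image _ (fun e : Finset ℕ => e.card) hne
  rw [Finset.mem_filter, Finset.mem_powerset] at he
  obtain ⟨heS, heU⟩ := he
  have hpos : ∀ e' : Finset ℕ, e' ⊆ S → (1 : ℝ) ≤ ((∏ q ∈ e', q : ℕ) : ℝ) := by
    intro e' h'
    exact_mod_cast Nat.one_le_iff_ne_zero.2 (Finset.prod_ne_zero_iff.2 fun q hq => by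
      have := (hS q (h' hq)).1; omega)
  have hg : ∀ q ∈ S, 0 ≤ (q : ℝ) ^ (4 * σ) - 1 := by
    intro q hq
    have h1 : (1 : ℝ) ≤ q := by exact_mod_cast (hS q hq).1
    have := Real.one_le_rpow h1 (by positivity : 0 ≤ 4 * σ)
    linarith
  have hE : (1 : ℝ) ≤ Real.exp 4 := Real.one_le_exp (by norm_num)
  -- step 1
  have h1 : ((∏ q ∈ S, q : ℕ) : ℝ) ^ σ ≤ Real.exp 4 * ((∏ q ∈ e, q : ℕ) : ℝ) ^ (4 * σ) := by
    by_cases hh : e = S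
    · subst hh
      have h2 : ((∏ q ∈ e, q : ℕ) : ℝ) ^ σ ≤ ((∏ q ∈ e, q : ℕ) : ℝ) ^ (4 * σ) :=
        Real.rpow_le_rpow_of_exponent_le (hpos _ heS) (by linarith)
      have h3 : 0 ≤ ((∏ q ∈ e, q : ℕ) : ℝ) ^ (4 * σ) := by positivity
      nlinarith
    · obtain ⟨q, hqS, hqe⟩ := Finset.exists_of_ssubset (heS.ssubset_of_ne hh)
      have h2 : U < (q : ℝ) * ((∏ q ∈ e, q : ℕ) : ℝ) := by
        by_contra hcon
        push Not at hcon
        have := hmax (insert q e) (by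
          rw [Finset.mem_filter, Finset.mem_powerset]
          refine ⟨Finset.insert_subset hqS heS, ?_⟩
          rw [Finset.prod_insert hqe]
          push_cast at hcon ⊢
          exact hcon)
        rw [Finset.card_insert_of_notMem hqe] at this
        omega
      have h3 : U ≤ z * ((∏ q ∈ e, q : ℕ) : ℝ) := by
        refine h2.le.trans ?_
        gcongr
        exact (hS q hqS).2
      calc ((∏ q ∈ S, q : ℕ) : ℝ) ^ σ ≤ (U ^ 4) ^ σ := by gcongr
        _ = U ^ (4 * σ) := by
          rw [Real.rpow_mul (by linarith)]; norm_cast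
        _ ≤ (z * ((∏ q ∈ e, q : ℕ) : ℝ)) ^ (4 * σ) := by gcongr
        _ = (z ^ σ) ^ 4 * ((∏ q ∈ e, q : ℕ) : ℝ) ^ (4 * σ) := by
          rw [Real.mul_rpow (by linarith) (by positivity)]
          congr 1
          rw [mul_comm 4 σ, Real.rpow_mul (by linarith)]; norm_cast
        _ ≤ (Real.exp 1) ^ 4 * ((∏ q ∈ e, q : ℕ) : ℝ) ^ (4 * σ) := by gcongr
        _ = _ := by rw [← Real.exp_nat_mul]; norm_num
  refine h1.trans (mul_le_mul_of_nonneg_left ?_ (by positivity))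
  have h4 : ((∏ q ∈ e, q : ℕ) : ℝ) ^ (4 * σ) = ∏ q ∈ e, (1 + ((q : ℝ) ^ (4 * σ) - 1)) := by
    push_cast
    rw [← Real.finsetProd_rpow _ _ (fun i _ => by positivity)]
    exact Finset.prod_congr rfl fun q _ => by ring
  rw [h4, Finset.prod_one_add]
  apply Finset.sum_le_sum_of_subset_of_nonneg
  · intro e' he'
    rw [Finset.mem_powerset] at he'
    rw [Finset.mem_filter, Finset.mem_powerset]
    refine ⟨he'.trans heS, le_trans ?_ heU⟩
    exact_mod_cast Finset.prod_le_prod_of_subset_of_one_le' he' (fun q hq _ => (hS q (heS hq)).1)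
  · intro e' he' _
    rw [Finset.mem_filter, Finset.mem_powerset] at he'
    exact Finset.prod_nonneg fun q hq => hg q (he'.1 hq)

lemma block_count (j d : ℕ) (hj : 1 ≤ j) (hd : 1 ≤ d) (hdU : d ^ 4 ≤ 2 ^ (j + 1)) (A : Finset ℕ)
    (hA : ∀ p ∈ A, p.Prime ∧ d ∣ p - 1 ∧ p ≤ 2 ^ (j + 1)) :
    (A.card : ℝ) ≤ 240 * 2 ^ j / (j + 1) * (hfun d / d) := by
  have hN : 4 ≤ 2 ^ (j + 1) := by
    calc 4 = 2 ^ 2 := by norm_num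
      _ ≤ _ := Nat.pow_le_pow_right (by norm_num) (by omega)
  set N := 2 ^ (j + 1) with hNdef
  have hK : 2 ≤ N / d := by
    rw [Nat.le_div_iff_mul_le hd]
    rcases Nat.lt_or_ge d 2 with h | h
    · have : d = 1 := by omega
      subst this; omega
    · have : 2 ^ 3 ≤ d ^ 3 := Nat.pow_le_pow_left h 3
      have h2 : d ^ 4 = d ^ 3 * d := by ring
      nlinarith
  have hdK : d ≤ N / d := by
    rw [Nat.le_div_iff_mul_le hd]
    have : d * d ≤ d ^ 4 := by
      calc d * d = d ^ 2 := by ring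
        _ ≤ d ^ 4 := Nat.pow_le_pow_right hd (by norm_num)
    omega
  have hlt : N < d * (N / d + 1) := Nat.lt_mul_div_succ N hd
  have h3 : N ≤ (N / d) ^ 3 := by
    set K := N / d
    have h4 : d * (K + 1) ≤ K * (K + 1) := Nat.mul_le_mul_right _ hdK
    have h5 : K * (K + 1) ≤ K ^ 3 := by nlinarith
    omega
  have hlog : ((j : ℝ) + 1) / 6 ≤ Real.log (N / d : ℕ) := by
    have h6 : Real.log N ≤ Real.log (((N / d : ℕ) : ℝ) ^ 3) :=
      Real.log_le_log (by positivity) (by exact_mod_cast h3)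
    rw [hNdef, Real.log_pow] at h6
    push_cast at h6
    rw [Real.log_pow] at h6
    push_cast at h6
    have := half_lt_log_two
    have hj0 : (0 : ℝ) ≤ j := by positivity
    rw [hNdef]
    nlinarith
  have h := bt_count d N (by omega) hK A hA
  refine h.trans ?_
  have hh := one_le_hfun d
  have hd0 : (0 : ℝ) < d := by exact_mod_cast hd
  calc 20 * ((N : ℝ) / d) * hfun d / Real.log (N / d : ℕ)
      ≤ 20 * ((N : ℝ) / d) * hfun d / (((j : ℝ) + 1) / 6) := by gcongr
    _ = _ := by
      rw [hNdef]; push_cast; rw [pow_succ]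
      field_simp; ring

lemma euler_bound (z σ : ℝ) (hz : 2 ≤ z) (hσ : σ = 1 / Real.log z) (P : Finset ℕ)
    (hP : ∀ q ∈ P, q.Prime ∧ (q : ℝ) ≤ z) :
    ∑ e ∈ P.powerset, ∏ q ∈ e, (((q : ℝ) ^ (4 * σ) - 1) * ((1 + 1 / q) / q)) ≤
      Real.exp (2560 * Real.exp 4) := by
  have hlz : 0 < Real.log z := Real.log_pos (by linarith)
  rw [← Finset.prod_one_add]
  have hs := sum_log_div z hz P hP
  have key : ∀ q ∈ P, 0 ≤ ((q : ℝ) ^ (4 * σ) - 1) * ((1 + 1 / q) / q) ∧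
      ((q : ℝ) ^ (4 * σ) - 1) * ((1 + 1 / q) / q) ≤
      8 * Real.exp 4 * σ * (Real.log q / q) := by
    intro q hq
    obtain ⟨hq1, hq2⟩ := hP q hq
    have h2 : (2 : ℝ) ≤ q := by exact_mod_cast hq1.two_le
    have hlq : 0 ≤ Real.log q := Real.log_nonneg (by linarith)
    have hσ0 : 0 ≤ σ := by rw [hσ]; positivity
    have h3 : (q : ℝ) ^ (4 * σ) = Real.exp (4 * σ * Real.log q) := by
      rw [Real.rpow_def_of_pos (by linarith), mul_comm]
    set x := 4 * σ * Real.log q with hx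
    have hx0 : 0 ≤ x := by positivity
    have hx4 : x ≤ 4 := by
      have : Real.log q ≤ Real.log z := Real.log_le_log (by linarith) hq2
      rw [hx, hσ]
      rw [show 4 * (1 / Real.log z) * Real.log q = 4 * Real.log q / Real.log z by ring]
      rw [div_le_iff₀ hlz]; linarith
    have h4 : Real.exp x - 1 ≤ x * Real.exp 4 := by
      have h5 := Real.add_one_le_exp (-x)
      have h6 : Real.exp x * Real.exp (-x) = 1 := by rw [← Real.exp_add]; simp
      have h7 : Real.exp x ≤ Real.exp 4 := Real.exp_le_exp.2 hx4
      have h8 := Real.exp_pos x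
      nlinarith
    have h9 : 0 ≤ Real.exp x - 1 := by linarith [Real.add_one_le_exp x]
    rw [h3]
    refine ⟨by positivity, ?_⟩
    have h10 : (1 + 1 / (q : ℝ)) ≤ 2 := by
      have : 1 / (q : ℝ) ≤ 1 := by rw [div_le_one (by linarith)]; linarith
      linarith
    calc (Real.exp x - 1) * ((1 + 1 / (q : ℝ)) / q) ≤ (x * Real.exp 4) * (2 / q) := by gcongr
      _ = _ := by rw [hx]; ring
  calc ∏ q ∈ P, (1 + ((q : ℝ) ^ (4 * σ) - 1) * ((1 + 1 / q) / q))
      ≤ ∏ q ∈ P, Real.exp (((q : ℝ) ^ (4 * σ) - 1) * ((1 + 1 / q) / q)) := by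
        apply Finset.prod_le_prod
        · intro q hq; have := (key q hq).1; linarith
        · intro q hq; rw [add_comm]; exact Real.add_one_le_exp _
    _ = Real.exp (∑ q ∈ P, ((q : ℝ) ^ (4 * σ) - 1) * ((1 + 1 / q) / q)) := by
        rw [Real.exp_sum]
    _ ≤ _ := by
        apply Real.exp_le_exp.2
        calc _ ≤ ∑ q ∈ P, 8 * Real.exp 4 * σ * (Real.log q / q) :=
              Finset.sum_le_sum fun q hq => (key q hq).2
          _ = 8 * Real.exp 4 * σ * ∑ q ∈ P, (Real.log q / q) := by rw [Finset.mul_sum]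
          _ ≤ 8 * Real.exp 4 * σ * (320 * Real.log z) := by
              have hσ0 : 0 ≤ σ := by rw [hσ]; positivity
              gcongr
          _ = _ := by rw [hσ]; field_simp; norm_num

lemma block_weight (z σ : ℝ) (hz : 2 ≤ z) (hσ : σ = 1 / Real.log z) (j : ℕ) (A : Finset ℕ)
    (hA : ∀ p ∈ A, p.Prime ∧ Nat.log 2 p = j) :
    ∑ p ∈ A, (sfun z p : ℝ) ^ σ ≤
      Real.exp 4 * Real.exp (2560 * Real.exp 4) * 240 * (2 ^ j / (j + 1)) := by
  classical
  have hlz : 0 < Real.log z := Real.log_pos (by linarith)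
  have hσ0 : 0 ≤ σ := by rw [hσ]; positivity
  have hzσ : z ^ σ ≤ Real.exp 1 := by
    rw [Real.rpow_def_of_pos (by linarith), hσ, mul_one_div_cancel hlz.ne']
  rcases A.eq_empty_or_nonempty with hemp | ⟨p0, hp0⟩
  · subst hemp; simp only [Finset.sum_empty]; positivity
  have hj : 1 ≤ j := by
    obtain ⟨h1, h2⟩ := hA p0 hp0
    rw [← h2]
    exact Nat.log_pos (by norm_num) h1.two_le
  set U : ℝ := (2 : ℝ) ^ (((j : ℝ) + 1) / 4) with hU
  have hU1 : 1 ≤ U := Real.one_le_rpow (by norm_num) (by positivity)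
  have hU4 : U ^ 4 = 2 ^ (j + 1) := by
    rw [hU, ← Real.rpow_natCast, ← Real.rpow_mul (by norm_num), ← Real.rpow_natCast]
    congr 1; push_cast; ring
  set P : Finset ℕ := (Finset.range (⌊z⌋₊ + 1)).filter Nat.Prime with hPdef
  have hP : ∀ q, q ∈ P ↔ q.Prime ∧ (q : ℝ) ≤ z := by
    intro q
    rw [hPdef, Finset.mem_filter, Finset.mem_range, Nat.lt_succ_iff,
      Nat.le_floor_iff (by linarith)]
    tauto
  set g : Finset ℕ → ℝ := fun e => ∏ q ∈ e, ((q : ℝ) ^ (4 * σ) - 1) with hgdef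
  have hSP : ∀ p, smallPrimes z p ⊆ P := by
    intro p q hq
    rw [smallPrimes, Finset.mem_filter] at hq
    exact (hP q).2 ⟨Nat.prime_of_mem_primeFactors hq.1, hq.2⟩
  set Q := P.powerset.filter (fun e => ((∏ q ∈ e, q : ℕ) : ℝ) ≤ U) with hQ
  have hg0 : ∀ e ∈ P.powerset, 0 ≤ g e := by
    intro e he
    rw [Finset.mem_powerset] at he
    refine Finset.prod_nonneg fun q hq => ?_
    have h1 : (1 : ℝ) ≤ q := by exact_mod_cast ((hP q).1 (he hq)).1.one_lt.le
    have := Real.one_le_rpow h1 (by positivity : 0 ≤ 4 * σ)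
    linarith
  have h1 : ∀ p ∈ A, (sfun z p : ℝ) ^ σ ≤ Real.exp 4 *
      ∑ e ∈ Q, if e ⊆ smallPrimes z p then g e else 0 := by
    intro p hp
    obtain ⟨hpp, hpj⟩ := hA p hp
    have h2 := subset_weight z σ U (by linarith) hσ0 hzσ hU1 (smallPrimes z p) (by
      intro q hq
      have := (hP q).1 (hSP p hq)
      exact ⟨this.1.one_lt.le, this.2⟩) (by
      rw [hU4]
      have h3 := (nat_log_bounds hpp.ne_zero hpj).2
      refine le_trans ?_ h3.le
      have h4 : (∏ q ∈ smallPrimes z p, q) ∣ p - 1 :=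
        Finset.prod_primes_dvd _ (fun q hq => ((hP q).1 (hSP p hq)).1.prime) (fun q hq => by
          rw [smallPrimes, Finset.mem_filter] at hq
          exact Nat.dvd_of_mem_primeFactors hq.1)
      have h5 := Nat.le_of_dvd (by have := hpp.two_le; omega) h4
      exact_mod_cast h5.trans (Nat.sub_le _ _))
    refine h2.trans (le_of_eq ?_)
    congr 1
    rw [← Finset.sum_filter]
    apply Finset.sum_congr _ (fun _ _ => rfl)
    ext e
    simp only [hQ, Finset.mem_filter, Finset.mem_powerset]
    constructor
    · rintro ⟨h, h'⟩; exact ⟨⟨h.trans (hSP p), h'⟩, h⟩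
    · rintro ⟨⟨_, h'⟩, h⟩; exact ⟨h, h'⟩
  have h2 : ∀ e ∈ Q, (∑ p ∈ A, if e ⊆ smallPrimes z p then g e else 0) ≤
      240 * (2 ^ j / (j + 1)) * ∏ q ∈ e, (((q : ℝ) ^ (4 * σ) - 1) * ((1 + 1 / q) / q)) := by
    intro e he
    rw [hQ, Finset.mem_filter] at he
    obtain ⟨he1, he2⟩ := he
    have he1' := Finset.mem_powerset.1 he1
    have hpr : ∀ q ∈ e, q.Prime := fun q hq => ((hP q).1 (he1' hq)).1
    rw [← Finset.sum_filter, Finset.sum_const, nsmul_eq_mul]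
    have h3 := block_count j (∏ q ∈ e, q) hj
      (Nat.one_le_iff_ne_zero.2 (Finset.prod_ne_zero_iff.2 fun q hq => (hpr q hq).ne_zero)) (by
        have : (((∏ q ∈ e, q : ℕ) : ℝ)) ^ 4 ≤ 2 ^ (j + 1) := by
          rw [← hU4]; gcongr
        exact_mod_cast this) (A.filter (fun p => e ⊆ smallPrimes z p)) (by
        intro p hp
        rw [Finset.mem_filter] at hp
        obtain ⟨hpp, hpj⟩ := hA p hp.1
        refine ⟨hpp, Finset.prod_primes_dvd _ (fun q hq => (hpr q hq).prime) (fun q hq => ?_), ?_⟩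
        · have := hp.2 hq
          rw [smallPrimes, Finset.mem_filter] at this
          exact Nat.dvd_of_mem_primeFactors this.1
        · have := (nat_log_bounds hpp.ne_zero hpj).2
          exact_mod_cast this.le)
    have h4 : hfun (∏ q ∈ e, q) / ((∏ q ∈ e, q : ℕ) : ℝ) = ∏ q ∈ e, ((1 + 1 / (q : ℝ)) / q) := by
      rw [hfun, Nat.primeFactors_prod hpr]
      push_cast
      rw [← Finset.prod_div_distrib]
    rw [h4] at h3
    calc _ ≤ 240 * 2 ^ j / ((j : ℝ) + 1) * (∏ q ∈ e, ((1 + 1 / (q : ℝ)) / q)) * g e := by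
          apply mul_le_mul_of_nonneg_right h3 (hg0 e he1)
      _ = _ := by
          rw [Finset.prod_mul_distrib, hgdef]; ring
  have h3 := euler_bound z σ hz hσ P (fun q hq => (hP q).1 hq)
  calc ∑ p ∈ A, (sfun z p : ℝ) ^ σ
      ≤ ∑ p ∈ A, Real.exp 4 * ∑ e ∈ Q, (if e ⊆ smallPrimes z p then g e else 0) :=
        Finset.sum_le_sum h1
    _ = Real.exp 4 * ∑ e ∈ Q, ∑ p ∈ A, (if e ⊆ smallPrimes z p then g e else 0) := by
        rw [← Finset.mul_sum, Finset.sum_comm]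
    _ ≤ Real.exp 4 * ∑ e ∈ Q, 240 * (2 ^ j / ((j : ℝ) + 1)) *
          ∏ q ∈ e, (((q : ℝ) ^ (4 * σ) - 1) * ((1 + 1 / q) / q)) := by
        gcongr with e he; exact h2 e he
    _ ≤ Real.exp 4 * ∑ e ∈ P.powerset, 240 * (2 ^ j / ((j : ℝ) + 1)) *
          ∏ q ∈ e, (((q : ℝ) ^ (4 * σ) - 1) * ((1 + 1 / q) / q)) := by
        apply mul_le_mul_of_nonneg_left _ (by positivity)
        apply Finset.sum_le_sum_of_subset_of_nonneg (Finset.filter_subset _ _)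
        intro e he _
        rw [Finset.prod_mul_distrib]
        have := hg0 e he
        have h5 : 0 ≤ ∏ q ∈ e, ((1 + 1 / (q : ℝ)) / q) := Finset.prod_nonneg fun q _ => by positivity
        positivity
    _ = Real.exp 4 * (240 * (2 ^ j / ((j : ℝ) + 1))) * ∑ e ∈ P.powerset,
          ∏ q ∈ e, (((q : ℝ) ^ (4 * σ) - 1) * ((1 + 1 / q) / q)) := by
        rw [← Finset.mul_sum]; ring
    _ ≤ Real.exp 4 * (240 * (2 ^ j / ((j : ℝ) + 1))) * Real.exp (2560 * Real.exp 4) := by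
        gcongr
    _ = _ := by ring

noncomputable def cS5 : ℝ := 4 * (Real.exp 4 * Real.exp (2560 * Real.exp 4) * 240)

lemma cS5_pos : 0 < cS5 := by unfold cS5; positivity

lemma weighted_sum (z σ X : ℝ) (hz : 2 ≤ z) (hσ : σ = 1 / Real.log z)
    (hX : 1 ≤ Real.log (Real.log X)) (hX1 : 1 < X) (A : Finset ℕ)
    (hA : ∀ p ∈ A, p.Prime ∧ (p : ℝ) ≤ X) :
    ∑ p ∈ A, (sfun z p : ℝ) ^ σ / p ≤ cS5 * Real.log (Real.log X) := by
  set D := Real.exp 4 * Real.exp (2560 * Real.exp 4) * 240 with hD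
  have hD0 : 0 < D := by positivity
  have hlX : 0 < Real.log X := Real.log_pos hX1
  have hlX1 : 1 ≤ Real.log X := by
    by_contra h
    push Not at h
    have := Real.log_neg hlX h
    linarith
  set M := Nat.log 2 ⌊X⌋₊ + 1 with hM
  have h1 := dyadic_sum A (fun p => (sfun z p : ℝ) ^ σ / p) (fun j => D * ((j + 1 : ℝ))⁻¹)
    (Finset.range M) (by
      intro p hp
      rw [Finset.mem_range, hM, Nat.lt_succ_iff]
      exact Nat.log_mono_right (Nat.le_floor (hA p hp).2)) (by
      intro j _
      have hB : ∀ p ∈ A.filter (fun m => Nat.log 2 m = j), p.Prime ∧ Nat.log 2 p = j := by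
        intro p hp
        rw [Finset.mem_filter] at hp
        exact ⟨(hA p hp.1).1, hp.2⟩
      have h2 := block_weight z σ hz hσ j _ hB
      calc ∑ p ∈ A.filter (fun m => Nat.log 2 m = j), (sfun z p : ℝ) ^ σ / p
          ≤ ∑ p ∈ A.filter (fun m => Nat.log 2 m = j), (sfun z p : ℝ) ^ σ / 2 ^ j := by
            apply Finset.sum_le_sum
            intro p hp
            obtain ⟨h3, h4⟩ := hB p hp
            have := (nat_log_bounds h3.ne_zero h4).1
            gcongr
        _ = (∑ p ∈ A.filter (fun m => Nat.log 2 m = j), (sfun z p : ℝ) ^ σ) / 2 ^ j := by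
            rw [Finset.sum_div]
        _ ≤ (D * (2 ^ j / (j + 1))) / 2 ^ j := by gcongr
        _ = _ := by field_simp)
  have h2 := harmonic_le_one_add_log M
  have h3 : ∑ j ∈ Finset.range M, D * ((j + 1 : ℝ))⁻¹ = D * (harmonic M : ℝ) := by
    rw [harmonic, ← Finset.mul_sum]; push_cast; rfl
  have h4 : Real.log M ≤ 2 + Real.log (Real.log X) := by
    have h5 : (M : ℝ) ≤ 4 * Real.log X := by
      have h6 : ⌊X⌋₊ ≠ 0 := by
        have : 1 ≤ ⌊X⌋₊ := Nat.le_floor (by push_cast; linarith)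
        omega
      have h7 := (nat_log_bounds h6 rfl).1
      have h8 : (2 : ℝ) ^ (Nat.log 2 ⌊X⌋₊) ≤ X := h7.trans (Nat.floor_le (by linarith))
      have h9 := Real.log_le_log (by positivity) h8
      rw [Real.log_pow] at h9
      have := half_lt_log_two
      have h10 : (0 : ℝ) ≤ (Nat.log 2 ⌊X⌋₊ : ℝ) := by positivity
      rw [hM]; push_cast
      nlinarith
    have h6 : Real.log M ≤ Real.log (4 * Real.log X) := Real.log_le_log (by positivity) h5
    rw [Real.log_mul (by norm_num) hlX.ne', show (4 : ℝ) = 2 ^ 2 by norm_num, Real.log_pow] at h6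
    have := log_two_lt_one
    push_cast at h6
    linarith
  rw [h3] at h1
  refine h1.trans ?_
  calc D * (harmonic M : ℝ) ≤ D * (4 * Real.log (Real.log X)) := by gcongr; linarith
    _ = _ := by rw [cS5]; ring


lemma mult_count (X : ℝ) (hX : 0 ≤ X) (m : ℕ) (E : Finset ℕ)
    (hE : ∀ n ∈ E, 0 < n ∧ (n : ℝ) ≤ X ∧ m ∣ n) : (E.card : ℝ) ≤ X / m := by
  have hsub : E ⊆ (Finset.Ioc 0 ⌊X⌋₊).filter (fun n => m ∣ n) := by
    intro n hn
    obtain ⟨h1, h2, h3⟩ := hE n hn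
    exact Finset.mem_filter.2 ⟨Finset.mem_Ioc.2 ⟨h1, Nat.le_floor h2⟩, h3⟩
  have h := Finset.card_le_card hsub
  rw [Nat.Ioc_filter_dvd_card_eq_div] at h
  calc (E.card : ℝ) ≤ ((⌊X⌋₊ / m : ℕ) : ℝ) := by exact_mod_cast h
    _ ≤ (⌊X⌋₊ : ℝ) / m := Nat.cast_div_le
    _ ≤ X / m := by gcongr; exact Nat.floor_le hX

lemma cover_count {ι : Type*} (I : Finset ι) (E : Finset ℕ) (P : ι → ℕ → Prop) (b : ι → ℝ)
    (hE : ∀ n ∈ E, ∃ i ∈ I, P i n)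
    (hb : ∀ i ∈ I, ∀ F : Finset ℕ, F ⊆ E → (∀ n ∈ F, P i n) → (F.card : ℝ) ≤ b i) :
    (E.card : ℝ) ≤ ∑ i ∈ I, b i := by
  classical
  have hsub : E ⊆ I.biUnion (fun i => E.filter (P i)) := by
    intro n hn
    obtain ⟨i, hi, h⟩ := hE n hn
    exact Finset.mem_biUnion.2 ⟨i, hi, Finset.mem_filter.2 ⟨hn, h⟩⟩
  have h := (Finset.card_le_card hsub).trans Finset.card_biUnion_le
  calc (E.card : ℝ) ≤ ((∑ i ∈ I, (E.filter (P i)).card : ℕ) : ℝ) := by exact_mod_cast h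
    _ = ∑ i ∈ I, ((E.filter (P i)).card : ℝ) := by push_cast; rfl
    _ ≤ _ := Finset.sum_le_sum fun i hi => hb i hi _ (Finset.filter_subset _ _)
        (fun n hn => (Finset.mem_filter.1 hn).2)

lemma union_count (X : ℝ) (hX : 0 ≤ X) (A : Finset ℕ) (E : Finset ℕ)
    (hE : ∀ n ∈ E, 0 < n ∧ (n : ℝ) ≤ X ∧ ∃ m ∈ A, m ∣ n) :
    (E.card : ℝ) ≤ X * ∑ m ∈ A, (1 : ℝ) / m := by
  have h := cover_count A E (fun m n => m ∣ n) (fun m => X / m) (fun n hn => (hE n hn).2.2)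
    (fun m _ F hF hd => mult_count X hX m F fun n hn =>
      ⟨(hE n (hF hn)).1, (hE n (hF hn)).2.1, hd n hn⟩)
  refine h.trans (le_of_eq ?_)
  rw [Finset.mul_sum]
  exact Finset.sum_congr rfl fun m _ => by ring

lemma pair_count (X : ℝ) (hX : 0 ≤ X) (A : Finset ℕ) (hA : ∀ p ∈ A, p.Prime) (E : Finset ℕ)
    (hE : ∀ n ∈ E, 0 < n ∧ (n : ℝ) ≤ X ∧ ∃ p ∈ A, ∃ q ∈ A, p ≠ q ∧ p ∣ n ∧ q ∣ n) :
    (E.card : ℝ) ≤ X * (∑ m ∈ A, (1 : ℝ) / m) ^ 2 := by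
  classical
  have h := cover_count (A ×ˢ A) E (fun m n => m.1 * m.2 ∣ n) (fun m => X / (m.1 * m.2 : ℕ)) (by
      intro n hn
      obtain ⟨_, _, p, hp, q, hq, hpq, h1, h2⟩ := hE n hn
      exact ⟨(p, q), Finset.mem_product.2 ⟨hp, hq⟩, Nat.Coprime.mul_dvd_of_dvd_of_dvd
        ((Nat.coprime_primes (hA p hp) (hA q hq)).2 hpq) h1 h2⟩)
    (fun m _ F hF hd => mult_count X hX _ F fun n hn =>
      ⟨(hE n (hF hn)).1, (hE n (hF hn)).2.1, hd n hn⟩)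
  refine h.trans (le_of_eq ?_)
  rw [sq, Finset.sum_mul_sum, ← Finset.sum_product', Finset.mul_sum]
  exact Finset.sum_congr rfl fun m _ => by push_cast; rw [div_mul_div_comm, mul_div]; simp

lemma ap_sum (X : ℝ) (hX : 1 ≤ X) (q : ℕ) (hq : 1 ≤ q) (A : Finset ℕ)
    (hA : ∀ p ∈ A, 2 ≤ p ∧ (p : ℝ) ≤ X ∧ q ∣ p - 1) :
    ∑ p ∈ A, (1 : ℝ) / p ≤ (1 + Real.log X) / q := by
  have hq0 : (0 : ℝ) < q := by exact_mod_cast hq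
  have hk : ∀ p ∈ A, p = 1 + q * ((p - 1) / q) ∧ 1 ≤ (p - 1) / q ∧ (p - 1) / q ≤ ⌊X⌋₊ := by
    intro p hp
    obtain ⟨h1, h2, h3⟩ := hA p hp
    have h4 := Nat.mul_div_cancel' h3
    refine ⟨by omega, Nat.div_pos (Nat.le_of_dvd (by omega) h3) hq, ?_⟩
    have h5 : p ≤ ⌊X⌋₊ := Nat.le_floor h2
    have h6 := Nat.div_le_self (p - 1) q
    omega
  have hinj : Set.InjOn (fun p => (p - 1) / q) (A : Set ℕ) := by
    intro p hp p' hp' h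
    rw [(hk p hp).1, (hk p' hp').1]
    simp only at h
    rw [h]
  calc ∑ p ∈ A, (1 : ℝ) / p ≤ ∑ p ∈ A, (1 / q : ℝ) * (1 / ((p - 1) / q : ℕ)) := by
        apply Finset.sum_le_sum
        intro p hp
        obtain ⟨h1, h2, _⟩ := hk p hp
        rw [div_mul_div_comm, one_mul]
        have h3 : (1 : ℝ) ≤ ((p - 1) / q : ℕ) := by exact_mod_cast h2
        apply one_div_le_one_div_of_le (by positivity)
        have h4 : q * ((p - 1) / q) ≤ p := by omega
        exact_mod_cast h4
    _ = (1 / q : ℝ) * ∑ k ∈ A.image (fun p => (p - 1) / q), (1 : ℝ) / k := by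
        rw [Finset.sum_image hinj, Finset.mul_sum]
    _ ≤ (1 / q : ℝ) * ∑ k ∈ Finset.Icc 1 ⌊X⌋₊, (1 : ℝ) / k := by
        apply mul_le_mul_of_nonneg_left _ (by positivity)
        apply Finset.sum_le_sum_of_subset_of_nonneg
        · intro k hk'
          obtain ⟨p, hp, rfl⟩ := Finset.mem_image.1 hk'
          exact Finset.mem_Icc.2 (hk p hp).2
        · intro k _ _; positivity
    _ ≤ (1 / q : ℝ) * (1 + Real.log X) := by
        apply mul_le_mul_of_nonneg_left _ (by positivity)
        have h1 := harmonic_floor_le_one_add_log X hX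
        rw [harmonic_eq_sum_Icc] at h1
        push_cast at h1
        simpa [one_div] using h1
    _ = _ := by ring

lemma sq_tail (B : ℝ) (hB : 1 ≤ B) (A : Finset ℕ) (hA : ∀ b ∈ A, B < b) :
    ∑ b ∈ A, (1 : ℝ) / (b : ℝ) ^ 2 ≤ 2 / B := by
  have hk : 1 ≤ ⌊B⌋₊ := Nat.le_floor (by exact_mod_cast hB)
  set n := max ⌊B⌋₊ (A.sup id) with hn
  have h := sum_Ioc_inv_sq_le_sub (α := ℝ) (k := ⌊B⌋₊) (n := n) (by omega) (le_max_left _ _)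
  have h1 : ∑ b ∈ A, (1 : ℝ) / (b : ℝ) ^ 2 ≤ ∑ b ∈ Finset.Ioc ⌊B⌋₊ n, ((b : ℝ) ^ 2)⁻¹ := by
    simp only [one_div]
    apply Finset.sum_le_sum_of_subset_of_nonneg
    · intro b hb
      rw [Finset.mem_Ioc]
      exact ⟨(Nat.floor_lt (by linarith)).2 (hA b hb),
        (Finset.le_sup (f := id) hb).trans (le_max_right _ _)⟩
    · intro _ _ _; positivity
  have h2 : (0 : ℝ) ≤ (n : ℝ)⁻¹ := by positivity
  have h3 : ((⌊B⌋₊ : ℝ))⁻¹ ≤ 2 / B := by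
    have h4 : (1 : ℝ) ≤ ⌊B⌋₊ := by exact_mod_cast hk
    have h5 := Nat.lt_floor_add_one B
    rw [inv_eq_one_div, div_le_div_iff₀ (by linarith) (by linarith)]
    linarith
  linarith

lemma rankin_sum (X : ℝ) (hX : 0 ≤ X) (w : ℕ → ℝ) (hw : ∀ p, 0 ≤ w p) :
    ∑ n ∈ Finset.Ioc 0 ⌊X⌋₊, ∏ p ∈ n.primeFactors, w p ≤
      X * Real.exp (∑ p ∈ (Finset.Ioc 0 ⌊X⌋₊).filter Nat.Prime, w p / p) := by
  classical
  set P := (Finset.Ioc 0 ⌊X⌋₊).filter Nat.Prime with hP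
  have hsub : ∀ n ∈ Finset.Ioc 0 ⌊X⌋₊, n.primeFactors ⊆ P := by
    intro n hn p hp
    rw [Finset.mem_Ioc] at hn
    have h1 := Nat.prime_of_mem_primeFactors hp
    have h2 := Nat.le_of_dvd hn.1 (Nat.dvd_of_mem_primeFactors hp)
    exact Finset.mem_filter.2 ⟨Finset.mem_Ioc.2 ⟨h1.pos, h2.trans hn.2⟩, h1⟩
  calc ∑ n ∈ Finset.Ioc 0 ⌊X⌋₊, ∏ p ∈ n.primeFactors, w p
      ≤ ∑ n ∈ Finset.Ioc 0 ⌊X⌋₊, ∑ e ∈ P.powerset,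
          (if e ⊆ n.primeFactors then ∏ p ∈ e, w p else 0) := by
        apply Finset.sum_le_sum
        intro n hn
        rw [← Finset.sum_filter]
        exact Finset.single_le_sum (f := fun e => ∏ p ∈ e, w p)
          (fun e _ => Finset.prod_nonneg fun p _ => hw p)
          (Finset.mem_filter.2 ⟨Finset.mem_powerset.2 (hsub n hn), subset_rfl⟩)
    _ = ∑ e ∈ P.powerset, ∑ n ∈ Finset.Ioc 0 ⌊X⌋₊,
          (if e ⊆ n.primeFactors then ∏ p ∈ e, w p else 0) := Finset.sum_comm
    _ ≤ ∑ e ∈ P.powerset, X * ∏ p ∈ e, (w p / p) := by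
        apply Finset.sum_le_sum
        intro e he
        rw [Finset.mem_powerset] at he
        rw [← Finset.sum_filter, Finset.sum_const, nsmul_eq_mul]
        have h1 := mult_count X hX (∏ p ∈ e, p)
          ((Finset.Ioc 0 ⌊X⌋₊).filter (fun n => e ⊆ n.primeFactors)) (by
          intro n hn
          rw [Finset.mem_filter, Finset.mem_Ioc] at hn
          refine ⟨hn.1.1, (Nat.le_floor_iff hX).1 hn.1.2, ?_⟩
          exact Finset.prod_primes_dvd _ (fun p hp => (Finset.mem_filter.1 (he hp)).2.prime)
            (fun p hp => Nat.dvd_of_mem_primeFactors (hn.2 hp)))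
        calc _ ≤ X / ((∏ p ∈ e, p : ℕ) : ℝ) * ∏ p ∈ e, w p :=
              mul_le_mul_of_nonneg_right h1 (Finset.prod_nonneg fun p _ => hw p)
          _ = _ := by rw [Finset.prod_div_distrib]; push_cast; ring
    _ = X * ∏ p ∈ P, (1 + w p / p) := by
        rw [← Finset.mul_sum, Finset.prod_one_add]
    _ ≤ _ := by
        apply mul_le_mul_of_nonneg_left _ hX
        rw [Real.exp_sum]
        apply Finset.prod_le_prod
        · intro p _; have := hw p; positivity
        · intro p _; rw [add_comm]; exact Real.add_one_le_exp _

/-- exceptional set of `n` whose primes have too large smooth part of `p - 1`. -/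
lemma rankin_count (X Z K V : ℝ) (hX1 : 1 < X) (hZ : 1 ≤ Z) (hK : 1 ≤ K) (hKZ : K ≤ Real.exp Z)
    (hl : 1 ≤ Real.log (Real.log X)) (E : Finset ℕ)
    (hE : ∀ n ∈ E, 0 < n ∧ (n : ℝ) ≤ X ∧
      Real.exp V < ∏ p ∈ n.primeFactors, (K * sfun (Real.exp Z) p)) :
    (E.card : ℝ) ≤ X * Real.exp (Real.exp 1 * cS5 * Real.log (Real.log X) - V / Z) := by
  set σ := 1 / Z with hσ
  have hσ0 : 0 < σ := by positivity
  set w : ℕ → ℝ := fun p => (K * sfun (Real.exp Z) p) ^ σ with hw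
  have hw0 : ∀ p, 0 ≤ w p := fun p => by rw [hw]; positivity
  have h1 := rankin_sum X (by linarith) w hw0
  have hwle : ∀ p, w p ≤ Real.exp 1 * (sfun (Real.exp Z) p : ℝ) ^ σ := by
    intro p
    simp only [hw]
    rw [Real.mul_rpow (by linarith) (by positivity)]
    gcongr
    calc K ^ σ ≤ (Real.exp Z) ^ σ := by gcongr
      _ = Real.exp 1 := by
        rw [← Real.exp_mul, hσ, mul_one_div_cancel (by linarith)]
  have h2 : ∑ p ∈ (Finset.Ioc 0 ⌊X⌋₊).filter Nat.Prime, w p / p ≤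
      Real.exp 1 * cS5 * Real.log (Real.log X) := by
    have h3 := weighted_sum (Real.exp Z) σ X (by have := Real.add_one_le_exp Z; linarith)
      (by rw [Real.log_exp]) hl hX1 ((Finset.Ioc 0 ⌊X⌋₊).filter Nat.Prime) (by
        intro p hp
        rw [Finset.mem_filter, Finset.mem_Ioc] at hp
        exact ⟨hp.2, (Nat.le_floor_iff (by linarith)).1 hp.1.2⟩)
    calc _ ≤ ∑ p ∈ (Finset.Ioc 0 ⌊X⌋₊).filter Nat.Prime,
          Real.exp 1 * ((sfun (Real.exp Z) p : ℝ) ^ σ / p) := by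
          apply Finset.sum_le_sum
          intro p _
          rw [← mul_div_assoc]
          gcongr
          exact hwle p
      _ = Real.exp 1 * ∑ p ∈ (Finset.Ioc 0 ⌊X⌋₊).filter Nat.Prime,
          ((sfun (Real.exp Z) p : ℝ) ^ σ / p) := by rw [Finset.mul_sum]
      _ ≤ Real.exp 1 * (cS5 * Real.log (Real.log X)) := by gcongr
      _ = _ := by ring
  have h4 : (E.card : ℝ) * Real.exp (V / Z) ≤
      ∑ n ∈ Finset.Ioc 0 ⌊X⌋₊, ∏ p ∈ n.primeFactors, w p := by
    calc (E.card : ℝ) * Real.exp (V / Z) = ∑ n ∈ E, Real.exp (V / Z) := by simp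
      _ ≤ ∑ n ∈ E, ∏ p ∈ n.primeFactors, w p := by
        apply Finset.sum_le_sum
        intro n hn
        obtain ⟨_, _, h5⟩ := hE n hn
        simp only [hw]
        rw [Real.finsetProd_rpow _ _ (fun p _ => by positivity)]
        calc Real.exp (V / Z) = (Real.exp V) ^ σ := by rw [← Real.exp_mul, hσ]; ring_nf
          _ ≤ _ := by gcongr
      _ ≤ _ := by
        apply Finset.sum_le_sum_of_subset_of_nonneg
        · intro n hn
          obtain ⟨h5, h6, _⟩ := hE n hn
          exact Finset.mem_Ioc.2 ⟨h5, Nat.le_floor h6⟩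
        · intro n _ _; exact Finset.prod_nonneg fun p _ => hw0 p
  have h5 : (E.card : ℝ) * Real.exp (V / Z) ≤
      X * Real.exp (Real.exp 1 * cS5 * Real.log (Real.log X)) := by
    refine h4.trans (h1.trans ?_)
    gcongr
  rw [Real.exp_sub, ← mul_div_assoc, le_div_iff₀ (Real.exp_pos _)]
  exact h5

/-- two primes `≡ 1` modulo a common large prime -/
lemma common_count (X z : ℝ) (hX1 : 1 < X) (hz : 1 ≤ z) (E : Finset ℕ)
    (hE : ∀ n ∈ E, 0 < n ∧ (n : ℝ) ≤ X ∧ ∃ q : ℕ, z < q ∧ ∃ p₁ p₂ : ℕ, p₁.Prime ∧ p₂.Prime ∧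
      p₁ ≠ p₂ ∧ p₁ ∣ n ∧ p₂ ∣ n ∧ q ∣ p₁ - 1 ∧ q ∣ p₂ - 1) :
    (E.card : ℝ) ≤ X * (1 + Real.log X) ^ 2 * (2 / z) := by
  classical
  set I := (Finset.Ioc 0 ⌊X⌋₊).filter (fun q : ℕ => z < q) with hI
  have hle : ∀ n ∈ E, ∀ p : ℕ, p ∣ n → (p : ℝ) ≤ X := by
    intro n hn p hp
    obtain ⟨h1, h2, _⟩ := hE n hn
    refine le_trans ?_ h2
    exact_mod_cast Nat.le_of_dvd h1 hp
  have h := cover_count I E (fun q n => ∃ p₁ p₂ : ℕ, p₁.Prime ∧ p₂.Prime ∧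
      p₁ ≠ p₂ ∧ p₁ ∣ n ∧ p₂ ∣ n ∧ q ∣ p₁ - 1 ∧ q ∣ p₂ - 1)
    (fun q => X * ((1 + Real.log X) / q) ^ 2) (by
      intro n hn
      obtain ⟨h1, h2, q, hq, p₁, p₂, h3⟩ := hE n hn
      refine ⟨q, ?_, p₁, p₂, h3⟩
      have h4 := hle n hn p₁ h3.2.2.2.1
      have h5 := Nat.le_of_dvd (by have := h3.1.two_le; omega) h3.2.2.2.2.2.1
      have h6 : p₁ ≤ ⌊X⌋₊ := Nat.le_floor h4
      have h7 : 0 < q := by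
        have : (0 : ℝ) < q := by linarith
        exact_mod_cast this
      exact Finset.mem_filter.2 ⟨Finset.mem_Ioc.2 ⟨h7, by omega⟩, hq⟩) (by
      intro q hq F hF hFP
      rw [hI, Finset.mem_filter, Finset.mem_Ioc] at hq
      set A := (Finset.Ioc 0 ⌊X⌋₊).filter (fun p => p.Prime ∧ q ∣ p - 1) with hA
      have h1 := pair_count X (by linarith) A (fun p hp => (Finset.mem_filter.1 hp).2.1) F (by
        intro n hn
        obtain ⟨p₁, p₂, a1, a2, a3, a4, a5, a6, a7⟩ := hFP n hn
        refine ⟨(hE n (hF hn)).1, (hE n (hF hn)).2.1, p₁, ?_, p₂, ?_, a3, a4, a5⟩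
        · exact Finset.mem_filter.2 ⟨Finset.mem_Ioc.2
            ⟨a1.pos, Nat.le_floor (hle n (hF hn) _ a4)⟩, a1, a6⟩
        · exact Finset.mem_filter.2 ⟨Finset.mem_Ioc.2
            ⟨a2.pos, Nat.le_floor (hle n (hF hn) _ a5)⟩, a2, a7⟩)
      have h2 := ap_sum X hX1.le q hq.1.1 A (by
        intro p hp
        rw [hA, Finset.mem_filter, Finset.mem_Ioc] at hp
        exact ⟨hp.2.1.two_le, (Nat.le_floor_iff (by linarith)).1 hp.1.2, hp.2.2⟩)
      refine h1.trans ?_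
      have h3 : 0 ≤ ∑ m ∈ A, (1 : ℝ) / m := Finset.sum_nonneg fun _ _ => by positivity
      gcongr)
  have h2 := sq_tail z hz I (fun b hb => (Finset.mem_filter.1 hb).2)
  refine h.trans ?_
  calc ∑ q ∈ I, X * ((1 + Real.log X) / q) ^ 2
      = X * (1 + Real.log X) ^ 2 * ∑ q ∈ I, (1 : ℝ) / (q : ℝ) ^ 2 := by
        rw [Finset.mul_sum]; exact Finset.sum_congr rfl fun q _ => by ring
    _ ≤ _ := by gcongr

lemma square_count (X B : ℝ) (hX1 : 1 < X) (hB : 1 ≤ B) (E : Finset ℕ)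
    (hE : ∀ n ∈ E, 0 < n ∧ (n : ℝ) ≤ X ∧ ∃ b : ℕ, B < b ∧ b ^ 2 ∣ n) :
    (E.card : ℝ) ≤ X * (2 / B) := by
  classical
  set I := (Finset.Ioc 0 ⌊X⌋₊).filter (fun q : ℕ => B < q) with hI
  have h := cover_count I E (fun b n => b ^ 2 ∣ n) (fun b => X / (b ^ 2 : ℕ)) (by
      intro n hn
      obtain ⟨h1, h2, b, hb, h3⟩ := hE n hn
      refine ⟨b, ?_, h3⟩
      have h4 := Nat.le_of_dvd h1 h3
      have h5 : n ≤ ⌊X⌋₊ := Nat.le_floor h2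
      have h7 : 0 < b := by
        have : (0 : ℝ) < b := by linarith
        exact_mod_cast this
      exact Finset.mem_filter.2 ⟨Finset.mem_Ioc.2 ⟨h7, by nlinarith⟩, hb⟩)
    (fun m _ F hF hd => mult_count X (by linarith) _ F fun n hn =>
      ⟨(hE n (hF hn)).1, (hE n (hF hn)).2.1, hd n hn⟩)
  have h2 := sq_tail B hB I (fun b hb => (Finset.mem_filter.1 hb).2)
  refine h.trans ?_
  calc ∑ b ∈ I, X / (b ^ 2 : ℕ) = X * ∑ q ∈ I, (1 : ℝ) / (q : ℝ) ^ 2 := by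
        rw [Finset.mul_sum]; exact Finset.sum_congr rfl fun q _ => by push_cast; ring
    _ ≤ _ := by gcongr

lemma square_shift_count (X B : ℝ) (hX1 : 1 < X) (hB : 1 ≤ B) (E : Finset ℕ)
    (hE : ∀ n ∈ E, 0 < n ∧ (n : ℝ) ≤ X ∧ ∃ p : ℕ, p.Prime ∧ p ∣ n ∧ ∃ b : ℕ, B < b ∧
      b ^ 2 ∣ p - 1) :
    (E.card : ℝ) ≤ X * (1 + Real.log X) * (2 / B) := by
  classical
  set I := (Finset.Ioc 0 ⌊X⌋₊).filter (fun q : ℕ => B < q) with hI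
  have h := cover_count I E (fun b n => ∃ p : ℕ, p.Prime ∧ p ∣ n ∧ b ^ 2 ∣ p - 1)
    (fun b => X * ((1 + Real.log X) / (b ^ 2 : ℕ))) (by
      intro n hn
      obtain ⟨h1, h2, p, hp, hpn, b, hb, h3⟩ := hE n hn
      refine ⟨b, ?_, p, hp, hpn, h3⟩
      have h4 := Nat.le_of_dvd h1 hpn
      have h6 := Nat.le_of_dvd (by have := hp.two_le; omega) h3
      have h5 : n ≤ ⌊X⌋₊ := Nat.le_floor h2
      have h7 : 0 < b := by
        have : (0 : ℝ) < b := by linarith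
        exact_mod_cast this
      have h8 : b ^ 2 ≤ ⌊X⌋₊ := by omega
      exact Finset.mem_filter.2 ⟨Finset.mem_Ioc.2 ⟨h7, by nlinarith⟩, hb⟩) (by
      intro b hb F hF hFP
      rw [hI, Finset.mem_filter, Finset.mem_Ioc] at hb
      set A := (Finset.Ioc 0 ⌊X⌋₊).filter (fun p => p.Prime ∧ b ^ 2 ∣ p - 1) with hA
      have h1 := union_count X (by linarith) A F (by
        intro n hn
        obtain ⟨p, a1, a2, a3⟩ := hFP n hn
        obtain ⟨h1, h2, _⟩ := hE n (hF hn)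
        refine ⟨h1, h2, p, Finset.mem_filter.2 ⟨Finset.mem_Ioc.2 ⟨a1.pos, ?_⟩, a1, a3⟩, a2⟩
        exact (Nat.le_of_dvd h1 a2).trans (Nat.le_floor h2))
      have h2 := ap_sum X hX1.le (b ^ 2) (Nat.one_le_pow _ _ hb.1.1) A (by
        intro p hp
        rw [hA, Finset.mem_filter, Finset.mem_Ioc] at hp
        exact ⟨hp.2.1.two_le, (Nat.le_floor_iff (by linarith)).1 hp.1.2, hp.2.2⟩)
      refine h1.trans ?_
      gcongr)
  have h2 := sq_tail B hB I (fun b hb => (Finset.mem_filter.1 hb).2)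
  have h3 : 0 ≤ Real.log X := Real.log_nonneg hX1.le
  refine h.trans ?_
  calc ∑ b ∈ I, X * ((1 + Real.log X) / (b ^ 2 : ℕ))
      = X * (1 + Real.log X) * ∑ q ∈ I, (1 : ℝ) / (q : ℝ) ^ 2 := by
        rw [Finset.mul_sum]; exact Finset.sum_congr rfl fun q _ => by push_cast; ring
    _ ≤ _ := by gcongr


def isMid (z : ℝ) (r : ℕ) : Prop :=
  ∃ q : ℕ, q.Prime ∧ z < q ∧ q ∣ r - 1 ∧ (q : ℝ) ^ 2 ≤ r * Real.log q ^ 2 ∧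
    (r : ℝ) ≤ (q : ℝ) ^ 2 * Real.log q ^ 4

lemma rad_bound (m : ℕ) (hm : 0 < m) (B : ℝ) (hB : ∀ b : ℕ, b ^ 2 ∣ m → (b : ℝ) ≤ B) :
    (m : ℝ) ≤ B ^ 2 * ((∏ p ∈ m.primeFactors, p : ℕ) : ℝ) := by
  obtain ⟨f, b, hf, hb, h, hsq⟩ := Nat.sq_mul_squarefree_of_pos hm
  have h1 := hB b ⟨f, h.symm⟩
  have h2 : f ≤ ∏ p ∈ m.primeFactors, p := by
    rw [← Nat.prod_primeFactors_of_squarefree hsq]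
    apply Finset.prod_le_prod_of_subset_of_one_le'
    · exact Nat.primeFactors_mono ⟨b ^ 2, by rw [← h, mul_comm]⟩ hm.ne'
    · intro p hp _; exact (Nat.prime_of_mem_primeFactors hp).one_lt.le
  calc (m : ℝ) = (b : ℝ) ^ 2 * f := by rw [← h]; push_cast; ring
    _ ≤ _ := by gcongr

lemma coprimePart_spec (a n : ℕ) (hn : 0 < n) :
    0 < coprimePart a n ∧ coprimePart a n ∣ n ∧ Nat.Coprime (coprimePart a n) a ∧
    ∀ d, d ∣ n → Nat.Coprime d a → d ≤ coprimePart a n := by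
  have h1 : 1 ∈ n.divisors.filter fun d => Nat.Coprime d a := by simp [hn.ne']
  obtain ⟨c, hc, hce⟩ := Finset.exists_mem_eq_sup _ ⟨1, h1⟩ (id : ℕ → ℕ)
  have hle : ∀ d, d ∣ n → Nat.Coprime d a → d ≤ coprimePart a n := by
    intro d hd hda
    exact Finset.le_sup (f := id) (Finset.mem_filter.2 ⟨Nat.mem_divisors.2 ⟨hd, hn.ne'⟩, hda⟩)
  have hcc : coprimePart a n = c := hce
  rw [Finset.mem_filter, Nat.mem_divisors] at hc
  refine ⟨hle 1 (one_dvd _) (Nat.coprime_one_left a), ?_, ?_, hle⟩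
  · rw [hcc]; exact hc.1.1
  · rw [hcc]; exact hc.2

lemma order_dvd_lstar (a n p : ℕ) (hn : 0 < n) (hp : p.Prime) (hpn : p ∣ n) (hpa : ¬ p ∣ a) :
    orderOf (a : ZMod p) ∣ lstar a n := by
  obtain ⟨h1, h2, h3, h4⟩ := coprimePart_spec a n hn
  have hpc : p ∣ coprimePart a n := by
    have hco : Nat.Coprime (Nat.lcm (coprimePart a n) p) a :=
      Nat.Coprime.coprime_dvd_left (Nat.lcm_dvd_mul _ _)
        (Nat.Coprime.mul_left h3 ((Nat.Prime.coprime_iff_not_dvd hp).2 hpa))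
    have h5 := h4 _ (Nat.lcm_dvd h2 hpn) hco
    have h6 : Nat.lcm (coprimePart a n) p = coprimePart a n :=
      le_antisymm h5 (Nat.le_of_dvd (Nat.lcm_pos h1 hp.pos) (Nat.dvd_lcm_left _ _))
    rw [← h6]; exact Nat.dvd_lcm_right _ _
  have h := orderOf_map_dvd (ZMod.castHom hpc (ZMod p)).toMonoidHom
    (a : ZMod (coprimePart a n))
  simpa [lstar] using h

lemma lstar_pos (a n : ℕ) (hn : 0 < n) : 0 < lstar a n := by
  obtain ⟨h1, h2, h3, h4⟩ := coprimePart_spec a n hn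
  have : NeZero (coprimePart a n) := ⟨h1.ne'⟩
  have := orderOf_pos (ZMod.unitOfCoprime a h3.symm)
  rw [← orderOf_units, ZMod.coe_unitOfCoprime] at this
  exact this

noncomputable def bigPrimes (z : ℝ) (p : ℕ) : Finset ℕ :=
  (p - 1).primeFactors.filter (fun q => ¬ (q : ℝ) ≤ z)

lemma big_dvd_order (a p q : ℕ) (z : ℝ) (hz : 3 ≤ z) (hp : p.Prime) (hpa : ¬ p ∣ a)
    (hq : q.Prime) (hzq : z < q) (hqp : q ∣ p - 1) (hmid : ¬ isMid z p)
    (H1 : ¬ (p % q = 1 ∧ (a : ZMod p) ^ ((p - 1) / q) = 1 ∧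
          (q : ℝ) ^ 2 * (Real.log q) ^ 4 ≤ (p : ℝ)))
    (H3 : ¬ (z ≤ p ∧ 0 < orderOf (a : ZMod p) ∧
          (orderOf (a : ZMod p) : ℝ) * Real.log p ≤ 2 * Real.sqrt p)) :
    q ∣ orderOf (a : ZMod p) := by
  by_contra hcon
  have : Fact p.Prime := ⟨hp⟩
  have h2 := hp.two_le
  have ha0 : (a : ZMod p) ≠ 0 := by
    rw [Ne, ZMod.natCast_eq_zero_iff]; exact hpa
  have hfer : (a : ZMod p) ^ (p - 1) = 1 := ZMod.pow_card_sub_one_eq_one ha0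
  have hord : orderOf (a : ZMod p) ∣ p - 1 := orderOf_dvd_of_pow_eq_one hfer
  have hcop : Nat.Coprime (orderOf (a : ZMod p)) q :=
    ((Nat.Prime.coprime_iff_not_dvd hq).2 hcon).symm
  have hord2 : orderOf (a : ZMod p) ∣ (p - 1) / q := by
    rw [← Nat.mul_div_cancel' hqp] at hord
    exact hcop.dvd_of_dvd_mul_left hord
  have hpow : (a : ZMod p) ^ ((p - 1) / q) = 1 := orderOf_dvd_iff_pow_eq_one.1 hord2
  have hqp1 : q ≤ p - 1 := Nat.le_of_dvd (by omega) hqp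
  have hmod : p % q = 1 := by
    obtain ⟨k, hk⟩ := hqp
    have : p = 1 + q * k := by omega
    rw [this, Nat.add_mul_mod_self_left]
    exact Nat.mod_eq_of_lt hq.one_lt
  have hq3 : (3 : ℝ) < q := by linarith
  have hlogq : 1 ≤ Real.log q := by
    rw [Real.le_log_iff_exp_le (by linarith)]
    have := Real.exp_one_lt_d9; linarith
  have hp0 : (0 : ℝ) < p := by exact_mod_cast hp.pos
  by_cases hc1 : (q : ℝ) ^ 2 * (Real.log q) ^ 4 ≤ (p : ℝ)
  · exact H1 ⟨hmod, hpow, hc1⟩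
  by_cases hc2 : (q : ℝ) ^ 2 ≤ p * Real.log q ^ 2
  · exact hmid ⟨q, hq, hzq, hqp, hc2, (not_le.1 hc1).le⟩
  push Not at hc2
  apply H3
  have hord0 : 0 < orderOf (a : ZMod p) := Nat.pos_of_dvd_of_pos hord (by omega)
  have hqp' : (q : ℝ) ≤ p := by exact_mod_cast (by omega : q ≤ p)
  refine ⟨by linarith, hord0, ?_⟩
  have h5 : orderOf (a : ZMod p) * q ≤ p := by
    have h6 := Nat.le_of_dvd (Nat.div_pos hqp1 hq.pos) hord2
    have h7 := Nat.mul_le_mul_right q h6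
    rw [Nat.div_mul_cancel hqp] at h7
    omega
  have h5' : (orderOf (a : ZMod p) : ℝ) * q ≤ p := by exact_mod_cast h5
  have hs := Real.mul_self_sqrt hp0.le
  have hs0 := Real.sqrt_pos.2 hp0
  set s := Real.sqrt p
  set l := Real.log q with hl
  set o : ℝ := (orderOf (a : ZMod p) : ℝ)
  have ho0 : 0 ≤ o := by positivity
  have h8 : s * l ≤ q := by
    have : (s * l) ^ 2 < (q : ℝ) ^ 2 := by rw [mul_pow, sq s, hs]; exact hc2
    exact (pow_lt_pow_iff_left₀ (by positivity) (by positivity) (by norm_num)).1 this |>.le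
  have h9 : Real.log p ≤ 2 * l := by
    have : Real.log p ≤ Real.log ((q : ℝ) ^ 2) := by
      apply Real.log_le_log hp0
      have : 1 ≤ l ^ 2 := one_le_pow₀ hlogq
      nlinarith
    rw [Real.log_pow] at this
    push_cast at this; exact this
  have h10 : o * l ≤ s := by
    have : s * (o * l) ≤ s * s := by
      calc s * (o * l) = o * (s * l) := by ring
        _ ≤ o * q := by gcongr
        _ ≤ s * s := by rw [hs]; exact h5'
    exact le_of_mul_le_mul_left this hs0
  calc o * Real.log p ≤ o * (2 * l) := by gcongr
    _ = 2 * (o * l) := by ring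
    _ ≤ _ := by linarith

lemma good_ineq (a n : ℕ) (ha : 1 < a) (hn : 0 < n) (z B₁ B₂ M V : ℝ) (hz : 3 ≤ z)
    (hB₂ : 1 ≤ B₂) (hM : 0 ≤ M)
    (H1 : ∀ q : ℕ, q.Prime → z < q → ∀ r : ℕ, r.Prime → r ∣ n → ¬ (r % q = 1 ∧
      (a : ZMod r) ^ ((r - 1) / q) = 1 ∧ (q : ℝ) ^ 2 * (Real.log q) ^ 4 ≤ (r : ℝ)))
    (H2 : ∀ r : ℕ, r.Prime → r ∣ n → isMid z r → (r : ℝ) ≤ Real.exp M)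
    (H3 : ∀ r : ℕ, r.Prime → r ∣ n → ¬ (z ≤ r ∧ 0 < orderOf (a : ZMod r) ∧
          (orderOf (a : ZMod r) : ℝ) * Real.log r ≤ 2 * Real.sqrt r))
    (H4 : ∀ r₁ r₂ : ℕ, r₁.Prime → r₂.Prime → r₁ ∣ n → r₂ ∣ n → isMid z r₁ → isMid z r₂ → r₁ = r₂)
    (H5 : ∀ q : ℕ, z < q → ∀ p₁ p₂ : ℕ, p₁.Prime → p₂.Prime → p₁ ∣ n → p₂ ∣ n →
      q ∣ p₁ - 1 → q ∣ p₂ - 1 → p₁ = p₂)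
    (H6 : ∏ p ∈ n.primeFactors, (2 * B₂ ^ 2 * sfun z p) ≤ Real.exp V)
    (H8 : ∀ b : ℕ, b ^ 2 ∣ n → (b : ℝ) ≤ B₁)
    (H10 : ∀ p : ℕ, p.Prime → p ∣ n → ∀ b : ℕ, b ^ 2 ∣ p - 1 → (b : ℝ) ≤ B₂) :
    (n : ℝ) ≤ B₁ ^ 2 * (a * (Real.exp M * (Real.exp V * lstar a n))) := by
  classical
  have hrad := rad_bound n hn B₁ H8
  refine hrad.trans ?_
  apply mul_le_mul_of_nonneg_left _ (by positivity)
  have hpf : ∀ p ∈ n.primeFactors, p.Prime ∧ p ∣ n := fun p hp =>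
    ⟨Nat.prime_of_mem_primeFactors hp, Nat.dvd_of_mem_primeFactors hp⟩
  -- splitting
  set Q := n.primeFactors.filter (fun p => ¬ p ∣ a) with hQ
  set G := Q.filter (fun p => ¬ isMid z p) with hG
  have hsplit : ∏ p ∈ n.primeFactors, p = (∏ p ∈ n.primeFactors.filter (fun p => p ∣ a), p) *
      ((∏ p ∈ Q.filter (isMid z), p) * ∏ p ∈ G, p) := by
    rw [hG, Finset.prod_filter_mul_prod_filter_not, hQ, Finset.prod_filter_mul_prod_filter_not]
  have hGn : ∀ p ∈ G, p ∈ n.primeFactors := fun p hp =>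
    (Finset.mem_filter.1 (Finset.mem_filter.1 hp).1).1
  have hb1 : ∏ p ∈ n.primeFactors.filter (fun p => p ∣ a), p ≤ a := by
    apply Nat.le_of_dvd (by omega)
    exact Finset.prod_primes_dvd _ (fun p hp => (hpf p (Finset.mem_filter.1 hp).1).1.prime)
      (fun p hp => (Finset.mem_filter.1 hp).2)
  have hb2 : ((∏ p ∈ Q.filter (isMid z), p : ℕ) : ℝ) ≤ Real.exp M := by
    have hcard : (Q.filter (isMid z)).card ≤ 1 := by
      rw [Finset.card_le_one]
      intro r₁ h₁ r₂ h₂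
      rw [Finset.mem_filter, hQ, Finset.mem_filter] at h₁ h₂
      exact H4 r₁ r₂ (hpf _ h₁.1.1).1 (hpf _ h₂.1.1).1 (hpf _ h₁.1.1).2 (hpf _ h₂.1.1).2 h₁.2 h₂.2
    rcases Finset.card_le_one_iff_subset_singleton.1 hcard with ⟨r, hr⟩
    rcases Finset.subset_singleton_iff.1 hr with h | h
    · rw [h]; simp [hM]
    · rw [h, Finset.prod_singleton]
      have h₁ : r ∈ Q.filter (isMid z) := by rw [h]; simp
      rw [Finset.mem_filter, hQ, Finset.mem_filter] at h₁
      exact H2 r (hpf _ h₁.1.1).1 (hpf _ h₁.1.1).2 h₁.2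
  -- big primes
  have hbig : (∏ p ∈ G, ∏ q ∈ bigPrimes z p, q) ≤ lstar a n := by
    apply Nat.le_of_dvd (lstar_pos a n hn)
    rw [← Finset.prod_biUnion]
    · apply Finset.prod_primes_dvd
      · intro q hq
        obtain ⟨p, _, hq⟩ := Finset.mem_biUnion.1 hq
        exact (Nat.prime_of_mem_primeFactors (Finset.mem_filter.1 hq).1).prime
      · intro q hq
        obtain ⟨p, hp, hq⟩ := Finset.mem_biUnion.1 hq
        have hp1 := hpf p (hGn p hp)
        have hp2 := Finset.mem_filter.1 hp
        have hp3 := (Finset.mem_filter.1 hp2.1).2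
        rw [bigPrimes, Finset.mem_filter] at hq
        have hqpr := Nat.prime_of_mem_primeFactors hq.1
        have hqd := Nat.dvd_of_mem_primeFactors hq.1
        have hzq := not_le.1 hq.2
        exact (big_dvd_order a p q z hz hp1.1 hp3 hqpr hzq hqd hp2.2
          (H1 q hqpr hzq p hp1.1 hp1.2) (H3 p hp1.1 hp1.2)).trans
          (order_dvd_lstar a n p hn hp1.1 hp1.2 hp3)
    · intro p hp p' hp' hne
      rw [Function.onFun, Finset.disjoint_left]
      intro q hq hq'
      rw [bigPrimes, Finset.mem_filter] at hq hq'
      apply hne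
      have hp1 := hpf p (hGn p hp)
      have hp1' := hpf p' (hGn p' hp')
      exact H5 q (not_le.1 hq.2) p p' hp1.1 hp1'.1 hp1.2 hp1'.2
        (Nat.dvd_of_mem_primeFactors hq.1) (Nat.dvd_of_mem_primeFactors hq'.1)
  have hs1 : ∀ p, 1 ≤ sfun z p := by
    intro p
    rw [sfun]
    exact Nat.one_le_iff_ne_zero.2 (Finset.prod_ne_zero_iff.2 fun q hq =>
      (Nat.prime_of_mem_primeFactors (Finset.mem_filter.1 hq).1).ne_zero)
  have hp_le : ∀ p ∈ n.primeFactors, (p : ℝ) ≤ (2 * B₂ ^ 2 * sfun z p) *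
      ((∏ q ∈ bigPrimes z p, q : ℕ) : ℝ) := by
    intro p hp
    obtain ⟨h1, h2⟩ := hpf p hp
    have h3 := h1.two_le
    have h4 := rad_bound (p - 1) (by omega) B₂ (H10 p h1 h2)
    have h5 : (∏ q ∈ (p - 1).primeFactors, q) = sfun z p * ∏ q ∈ bigPrimes z p, q := by
      rw [sfun, smallPrimes, bigPrimes, Finset.prod_filter_mul_prod_filter_not]
    rw [h5] at h4
    have h6 : (p : ℝ) ≤ 2 * ((p - 1 : ℕ) : ℝ) := by exact_mod_cast (by omega : p ≤ 2 * (p - 1))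
    push_cast at h4 ⊢
    calc (p : ℝ) ≤ _ := h6
      _ ≤ 2 * (B₂ ^ 2 * (↑(sfun z p) * ∏ x ∈ bigPrimes z p, (x : ℝ))) := by linarith
      _ = _ := by ring
  have hone : ∀ p : ℕ, (1 : ℝ) ≤ 2 * B₂ ^ 2 * sfun z p := by
    intro p
    have h1 : (1 : ℝ) ≤ sfun z p := by exact_mod_cast hs1 p
    have h2 : 1 ≤ B₂ ^ 2 := one_le_pow₀ hB₂
    nlinarith
  have hb3 : ((∏ p ∈ G, p : ℕ) : ℝ) ≤ Real.exp V * lstar a n := by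
    calc ((∏ p ∈ G, p : ℕ) : ℝ) = ∏ p ∈ G, (p : ℝ) := by push_cast; rfl
      _ ≤ ∏ p ∈ G, ((2 * B₂ ^ 2 * sfun z p) * ((∏ q ∈ bigPrimes z p, q : ℕ) : ℝ)) :=
          Finset.prod_le_prod (fun p _ => by positivity) (fun p hp => hp_le p (hGn p hp))
      _ = (∏ p ∈ G, (2 * B₂ ^ 2 * sfun z p)) *
            ((∏ p ∈ G, ∏ q ∈ bigPrimes z p, q : ℕ) : ℝ) := by
          rw [Finset.prod_mul_distrib]; push_cast; rfl
      _ ≤ Real.exp V * lstar a n := by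
          apply mul_le_mul _ (by exact_mod_cast hbig) (by positivity) (by positivity)
          refine le_trans ?_ H6
          apply Finset.prod_le_prod_of_subset_of_one_le (fun p hp => hGn p hp)
          · intro p _; exact zero_le_one.trans (hone p)
          · intro p _ _; exact hone p
  rw [hsplit]
  push_cast at hb2 hb3 ⊢
  have hb1r : ((∏ p ∈ n.primeFactors.filter (fun p => p ∣ a), p : ℕ) : ℝ) ≤ a :=
    Nat.cast_le.2 hb1
  push_cast at hb1r
  apply mul_le_mul hb1r _ (by positivity) (by positivity)
  exact mul_le_mul hb2 hb3 (by positivity) (by positivity)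


lemma lp_count (a : ℕ) (ha : 1 < a) (C : ℝ)
    (hC : ∀ q : ℕ, q.Prime → Odd q → (¬ ∃ b : ℕ, b ^ q = a) →
      ∀ X : ℝ, 3 ≤ X →
      (Nat.card {n : ℕ | 0 < n ∧ (n : ℝ) ≤ X ∧ ∃ r : ℕ, r.Prime ∧ r ∣ n ∧
          r % q = 1 ∧ (a : ZMod r) ^ ((r - 1) / q) = 1 ∧
          (q : ℝ) ^ 2 * (Real.log q) ^ 4 ≤ (r : ℝ)} : ℝ) ≤
        C * (X / (q * Real.log q) + X * Real.log (Real.log X) / (q : ℝ) ^ 2))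
    (X z : ℝ) (hX : 3 ≤ X) (hl : 0 ≤ Real.log (Real.log X)) (hz : 4 ≤ z) (haz : (a : ℝ) ≤ z)
    (E : Finset ℕ)
    (hE : ∀ n ∈ E, 0 < n ∧ (n : ℝ) ≤ X ∧ ∃ q : ℕ, q.Prime ∧ z < q ∧ ∃ r : ℕ, r.Prime ∧ r ∣ n ∧
          r % q = 1 ∧ (a : ZMod r) ^ ((r - 1) / q) = 1 ∧
          (q : ℝ) ^ 2 * (Real.log q) ^ 4 ≤ (r : ℝ)) :
    (E.card : ℝ) ≤ |C| * X * (320 / Real.log z + Real.log (Real.log X) * (2 / z)) := by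
  classical
  set l := Real.log (Real.log X)
  set I := (Finset.Ioc 0 ⌊X⌋₊).filter (fun q : ℕ => q.Prime ∧ z < q) with hI
  have h := cover_count I E (fun q n => ∃ r : ℕ, r.Prime ∧ r ∣ n ∧
          r % q = 1 ∧ (a : ZMod r) ^ ((r - 1) / q) = 1 ∧
          (q : ℝ) ^ 2 * (Real.log q) ^ 4 ≤ (r : ℝ))
    (fun q => |C| * X * (1 / (q * Real.log q) + l * (1 / (q : ℝ) ^ 2))) (by
      intro n hn
      obtain ⟨h1, h2, q, hq, hzq, r, h3⟩ := hE n hn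
      refine ⟨q, Finset.mem_filter.2 ⟨Finset.mem_Ioc.2 ⟨hq.pos, ?_⟩, hq, hzq⟩, r, h3⟩
      have h4 : q ≤ r := by
        by_contra hlt
        have := Nat.mod_eq_of_lt (not_le.1 hlt)
        have h5 := h3.1.two_le
        omega
      exact (h4.trans (Nat.le_of_dvd h1 h3.2.1)).trans (Nat.le_floor h2)) (by
      intro q hq F hF hFP
      rw [hI, Finset.mem_filter] at hq
      obtain ⟨_, hqp, hzq⟩ := hq
      have hq4 : (4 : ℝ) < q := by linarith
      have hlq : 0 < Real.log q := Real.log_pos (by linarith)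
      have hqa : a < q := by
        have : (a : ℝ) < q := by linarith
        exact_mod_cast this
      have hq4' : 4 < q := by exact_mod_cast hq4
      have h1 := hC q hqp (hqp.odd_of_ne_two (by omega)) (by
        rintro ⟨b, hb⟩
        have hb2 : 2 ≤ b := by
          by_contra hlt
          have : b = 0 ∨ b = 1 := by omega
          rcases this with rfl | rfl
          · rw [zero_pow hqp.ne_zero] at hb; omega
          · rw [one_pow] at hb; omega
        have h2 : 2 ^ q ≤ b ^ q := Nat.pow_le_pow_left hb2 q
        have h3 := Nat.lt_two_pow_self (n := q)
        omega) X hX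
      have h2 : (F.card : ℝ) ≤ (Nat.card {n : ℕ | 0 < n ∧ (n : ℝ) ≤ X ∧ ∃ r : ℕ, r.Prime ∧ r ∣ n ∧
          r % q = 1 ∧ (a : ZMod r) ^ ((r - 1) / q) = 1 ∧
          (q : ℝ) ^ 2 * (Real.log q) ^ 4 ≤ (r : ℝ)} : ℝ) := by
        rw [Nat.card_coe_set_eq, ← Set.ncard_coe_finset F]
        apply Nat.cast_le.2
        apply Set.ncard_le_ncard
        · intro n hn
          have hn' : n ∈ F := by exact_mod_cast hn
          exact ⟨(hE n (hF hn')).1, (hE n (hF hn')).2.1, hFP n hn'⟩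
        · apply (Set.finite_Iic ⌊X⌋₊).subset
          intro n hn
          exact Nat.le_floor hn.2.1
      refine h2.trans (h1.trans ?_)
      calc C * (X / (q * Real.log q) + X * l / (q : ℝ) ^ 2)
          ≤ |C| * (X / (q * Real.log q) + X * l / (q : ℝ) ^ 2) := by
            apply mul_le_mul_of_nonneg_right (le_abs_self C)
            have : 0 ≤ X := by linarith
            positivity
        _ = _ := by ring)
  have h2 := sq_tail z (by linarith) I (fun b hb => (Finset.mem_filter.1 hb).2.2)
  have h3 := sum_inv_mul_log z hz I (fun b hb =>
    ⟨(Finset.mem_filter.1 hb).2.1, (Finset.mem_filter.1 hb).2.2.le⟩)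
  refine h.trans ?_
  rw [← Finset.mul_sum, Finset.sum_add_distrib, ← Finset.mul_sum]
  have : 0 ≤ X := by linarith
  gcongr

lemma order_count (a : ℕ) (ha : 1 < a) (X z : ℝ) (hX : 0 ≤ X) (hz : 4 ≤ z) (E : Finset ℕ)
    (hE : ∀ n ∈ E, 0 < n ∧ (n : ℝ) ≤ X ∧ ∃ r : ℕ, r.Prime ∧ r ∣ n ∧ z ≤ r ∧
      0 < orderOf (a : ZMod r) ∧ (orderOf (a : ZMod r) : ℝ) * Real.log r ≤ 2 * Real.sqrt r) :
    (E.card : ℝ) ≤ X * (128 * a / Real.log z) := by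
  classical
  set A := (Finset.Ioc 0 ⌊X⌋₊).filter (fun r : ℕ => r.Prime ∧ z ≤ r ∧
      0 < orderOf (a : ZMod r) ∧ (orderOf (a : ZMod r) : ℝ) * Real.log r ≤ 2 * Real.sqrt r) with hA
  have h := union_count X hX A E (by
    intro n hn
    obtain ⟨h1, h2, r, hr, hrn, h3⟩ := hE n hn
    exact ⟨h1, h2, r, Finset.mem_filter.2 ⟨Finset.mem_Ioc.2 ⟨hr.pos,
      (Nat.le_of_dvd h1 hrn).trans (Nat.le_floor h2)⟩, hr, h3⟩, hrn⟩)
  have h2 := small_order_sum a ha z hz A (fun r hr => (Finset.mem_filter.1 hr).2)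
  refine h.trans ?_
  gcongr

lemma mid_pair_count {w₀ : ℝ} (hw₀ : 16 ≤ w₀) (hw : ∀ x : ℝ, w₀ ≤ x →
    (Real.log x) ^ 4 ≤ x ∧ (Real.log x) ^ 2 * (Real.sqrt x + 1) ≤ x ∧ 3 ≤ Real.log x)
    (X z : ℝ) (hz : w₀ ≤ z) (hX : w₀ ≤ X) (E : Finset ℕ)
    (hE : ∀ n ∈ E, 0 < n ∧ (n : ℝ) ≤ X ∧ ∃ r₁ r₂ : ℕ, r₁.Prime ∧ r₂.Prime ∧ r₁ ≠ r₂ ∧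
      r₁ ∣ n ∧ r₂ ∣ n ∧ isMid z r₁ ∧ isMid z r₂) :
    (E.card : ℝ) ≤ X * (716800 * Real.log (Real.log X) / Real.log z) ^ 2 := by
  classical
  set A := (Finset.Ioc 0 ⌊X⌋₊).filter (fun r : ℕ => r.Prime ∧ isMid z r) with hA
  have h := pair_count X (by linarith) A (fun p hp => (Finset.mem_filter.1 hp).2.1) E (by
    intro n hn
    obtain ⟨h1, h2, r, r', hr, hr', hne, hrn, hrn', h3, h3'⟩ := hE n hn
    exact ⟨h1, h2, r, Finset.mem_filter.2 ⟨Finset.mem_Ioc.2 ⟨hr.pos,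
      (Nat.le_of_dvd h1 hrn).trans (Nat.le_floor h2)⟩, hr, h3⟩,
      r', Finset.mem_filter.2 ⟨Finset.mem_Ioc.2 ⟨hr'.pos,
      (Nat.le_of_dvd h1 hrn').trans (Nat.le_floor h2)⟩, hr', h3'⟩, hne, hrn, hrn'⟩)
  have h2 := middle_sum hw₀ hw z X hz hX A (by
    intro r hr
    rw [hA, Finset.mem_filter, Finset.mem_Ioc] at hr
    obtain ⟨q, hq, hzq, hd⟩ := hr.2.2
    exact ⟨hr.2.1, (Nat.le_floor_iff (by linarith)).1 hr.1.2, q, hq, hzq.le, hd⟩)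
  refine h.trans ?_
  have h3 : 0 ≤ ∑ m ∈ A, (1 : ℝ) / m := Finset.sum_nonneg fun _ _ => by positivity
  have : 0 ≤ X := by linarith
  gcongr

lemma mid_large_count {w₀ : ℝ} (hw₀ : 16 ≤ w₀) (hw : ∀ x : ℝ, w₀ ≤ x →
    (Real.log x) ^ 4 ≤ x ∧ (Real.log x) ^ 2 * (Real.sqrt x + 1) ≤ x ∧ 3 ≤ Real.log x)
    (X z M : ℝ) (hz : w₀ ≤ z) (hX : w₀ ≤ X) (hM : w₀ ≤ Real.exp (M / 3)) (E : Finset ℕ)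
    (hE : ∀ n ∈ E, 0 < n ∧ (n : ℝ) ≤ X ∧ ∃ r : ℕ, r.Prime ∧ r ∣ n ∧ isMid z r ∧
      Real.exp M < r) :
    (E.card : ℝ) ≤ X * (716800 * Real.log (Real.log X) / (M / 3)) := by
  classical
  set A := (Finset.Ioc 0 ⌊X⌋₊).filter (fun r : ℕ => r.Prime ∧ isMid z r ∧ Real.exp M < r) with hA
  have h := union_count X (by linarith) A E (by
    intro n hn
    obtain ⟨h1, h2, r, hr, hrn, h3⟩ := hE n hn
    exact ⟨h1, h2, r, Finset.mem_filter.2 ⟨Finset.mem_Ioc.2 ⟨hr.pos,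
      (Nat.le_of_dvd h1 hrn).trans (Nat.le_floor h2)⟩, hr, h3⟩, hrn⟩)
  have h2 := middle_sum hw₀ hw (Real.exp (M / 3)) X hM hX A (by
    intro r hr
    rw [hA, Finset.mem_filter, Finset.mem_Ioc] at hr
    obtain ⟨hr1, hr2, ⟨q, hq, hzq, hd, hd2, hd3⟩, hr4⟩ := hr
    refine ⟨hr2, (Nat.le_floor_iff (by linarith)).1 hr1.2, q, hq, ?_, hd, hd2, hd3⟩
    have h5 := (hw q (by linarith)).1
    have h6 : Real.exp M < (q : ℝ) ^ 3 := by
      calc Real.exp M < r := hr4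
        _ ≤ _ := hd3
        _ ≤ (q : ℝ) ^ 2 * q := by gcongr
        _ = _ := by ring
    have h7 : Real.exp M = (Real.exp (M / 3)) ^ 3 := by
      rw [← Real.exp_nat_mul]; congr 1; push_cast; ring
    rw [h7] at h6
    exact ((pow_lt_pow_iff_left₀ (by positivity) (by positivity) (by norm_num)).1 h6).le)
  rw [Real.log_exp] at h2
  refine h.trans ?_
  have : 0 ≤ X := by linarith
  gcongr

lemma core (a : ℕ) (ha : 1 < a) (C : ℝ)
    (hC : ∀ q : ℕ, q.Prime → Odd q → (¬ ∃ b : ℕ, b ^ q = a) →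
      ∀ X : ℝ, 3 ≤ X →
      (Nat.card {n : ℕ | 0 < n ∧ (n : ℝ) ≤ X ∧ ∃ r : ℕ, r.Prime ∧ r ∣ n ∧
          r % q = 1 ∧ (a : ZMod r) ^ ((r - 1) / q) = 1 ∧
          (q : ℝ) ^ 2 * (Real.log q) ^ 4 ≤ (r : ℝ)} : ℝ) ≤
        C * (X / (q * Real.log q) + X * Real.log (Real.log X) / (q : ℝ) ^ 2))
    {w₀ : ℝ} (hw₀ : 16 ≤ w₀) (hw : ∀ x : ℝ, w₀ ≤ x →
    (Real.log x) ^ 4 ≤ x ∧ (Real.log x) ^ 2 * (Real.sqrt x + 1) ≤ x ∧ 3 ≤ Real.log x)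
    (c : ℝ) (hc : c = 70 / (Real.exp 1 * cS5 + 1))
    (X L l T : ℝ) (hL : L = Real.log X) (hl : l = Real.log L) (hX : w₀ ≤ X) (hl1 : 1 ≤ l)
    (hTl : l ≤ T) (hTL : T * l ≤ L) (hT7 : 7 ≤ c * T) (hTw : Real.log w₀ ≤ c * T)
    (hTw' : Real.log w₀ ≤ T) (hTa : Real.log a ≤ c * T) (hTa' : Real.log a ≤ T)
    (E : Finset ℕ) (hE : ∀ n ∈ E, 0 < n ∧ (n : ℝ) ≤ X ∧
      (lstar a n : ℝ) ≤ X / (Real.exp (110 * T * l ^ 2) * Real.exp T)) :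
    (E.card : ℝ) ≤ (|C| * (320 / c + 1) + 71680 + 128 * a / c + 716800 ^ 2 / c ^ 2 + 12) * X /
      (T * l) := by
  classical
  have hc0 : 0 < c := by rw [hc]; have := cS5_pos; positivity
  have hT1 : 1 ≤ T := hl1.trans hTl
  have hTl0 : 1 ≤ T * l := by nlinarith
  have hL1 : 1 ≤ L := by linarith
  have hX0 : 0 < X := by linarith
  have hX1 : 1 < X := by linarith
  have hLl : L = Real.exp l := by rw [hl, Real.exp_log (by linarith)]
  set Z := c * (T * l) with hZ
  have hZT : c * T ≤ Z := by rw [hZ, ← mul_assoc]; nlinarith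
  have hZ7 : 7 * l ≤ Z := by rw [hZ, ← mul_assoc]; nlinarith
  set z := Real.exp Z with hz
  have hlogz : Real.log z = Z := by rw [hz, Real.log_exp]
  have hz8 : 8 ≤ z := by have := Real.add_one_le_exp Z; linarith
  have hwz : w₀ ≤ z := by
    rw [hz, ← Real.log_le_iff_le_exp (by linarith)]; linarith
  have haz : (a : ℝ) ≤ z := by
    rw [hz, ← Real.log_le_iff_le_exp (by positivity)]; linarith
  have hL6 : 2 * (L ^ 3) ^ 2 ≤ z := by
    have h1 : (L ^ 3) ^ 2 = Real.exp (6 * l) := by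
      rw [hLl, ← Real.exp_nat_mul, ← Real.exp_nat_mul]; congr 1; push_cast; ring
    have h2 : (2 : ℝ) ≤ Real.exp l := by have := Real.add_one_le_exp l; linarith
    calc 2 * (L ^ 3) ^ 2 ≤ Real.exp l * Real.exp (6 * l) := by rw [h1]; gcongr
      _ = Real.exp (7 * l) := by rw [← Real.exp_add]; ring_nf
      _ ≤ z := Real.exp_le_exp.2 hZ7
  have hlL : l ≤ L := by nlinarith
  set M := 30 * T * l ^ 2 with hM
  set V := 70 * T * l ^ 2 with hV
  have hM0 : 0 ≤ M := by positivity
  have hMw : w₀ ≤ Real.exp (M / 3) := by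
    rw [← Real.log_le_iff_le_exp (by linarith)]
    have : T ≤ M / 3 := by rw [hM]; nlinarith
    linarith
  -- exceptional sets
  set E1 := E.filter (fun n => ∃ q : ℕ, q.Prime ∧ z < q ∧ ∃ r : ℕ, r.Prime ∧ r ∣ n ∧
          r % q = 1 ∧ (a : ZMod r) ^ ((r - 1) / q) = 1 ∧
          (q : ℝ) ^ 2 * (Real.log q) ^ 4 ≤ (r : ℝ)) with hE1
  set E2 := E.filter (fun n => ∃ r : ℕ, r.Prime ∧ r ∣ n ∧ isMid z r ∧ Real.exp M < r) with hE2
  set E3 := E.filter (fun n => ∃ r : ℕ, r.Prime ∧ r ∣ n ∧ z ≤ r ∧ 0 < orderOf (a : ZMod r) ∧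
          (orderOf (a : ZMod r) : ℝ) * Real.log r ≤ 2 * Real.sqrt r) with hE3
  set E4 := E.filter (fun n => ∃ r₁ r₂ : ℕ, r₁.Prime ∧ r₂.Prime ∧ r₁ ≠ r₂ ∧
      r₁ ∣ n ∧ r₂ ∣ n ∧ isMid z r₁ ∧ isMid z r₂) with hE4
  set E5 := E.filter (fun n => ∃ q : ℕ, z < q ∧ ∃ p₁ p₂ : ℕ, p₁.Prime ∧ p₂.Prime ∧
      p₁ ≠ p₂ ∧ p₁ ∣ n ∧ p₂ ∣ n ∧ q ∣ p₁ - 1 ∧ q ∣ p₂ - 1) with hE5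
  set E6 := E.filter (fun n => Real.exp V <
      ∏ p ∈ n.primeFactors, (2 * (L ^ 3) ^ 2 * sfun z p)) with hE6
  set E7 := E.filter (fun n : ℕ => (n : ℝ) ≤ X / L) with hE7
  set E8 := E.filter (fun n => ∃ b : ℕ, L ^ 2 < b ∧ b ^ 2 ∣ n) with hE8
  set E9 := E.filter (fun n => ∃ p : ℕ, p.Prime ∧ p ∣ n ∧ ∃ b : ℕ, L ^ 3 < b ∧
      b ^ 2 ∣ p - 1) with hE9
  have hmem : ∀ (P : ℕ → Prop), ∀ n ∈ E.filter P, 0 < n ∧ (n : ℝ) ≤ X ∧ P n := by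
    intro P n hn
    rw [Finset.mem_filter] at hn
    exact ⟨(hE n hn.1).1, (hE n hn.1).2.1, hn.2⟩
  have hcover : E ⊆ E1 ∪ (E2 ∪ (E3 ∪ (E4 ∪ (E5 ∪ (E6 ∪ (E7 ∪ (E8 ∪ E9))))))) := by
    intro n hn
    by_contra hnot
    simp only [Finset.mem_union, not_or] at hnot
    obtain ⟨n1, n2, n3, n4, n5, n6, n7, n8, n9⟩ := hnot
    rw [hE1, Finset.mem_filter] at n1
    rw [hE2, Finset.mem_filter] at n2
    rw [hE3, Finset.mem_filter] at n3
    rw [hE4, Finset.mem_filter] at n4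
    rw [hE5, Finset.mem_filter] at n5
    rw [hE6, Finset.mem_filter] at n6
    rw [hE7, Finset.mem_filter] at n7
    rw [hE8, Finset.mem_filter] at n8
    rw [hE9, Finset.mem_filter] at n9
    obtain ⟨hn0, hnX, hnl⟩ := hE n hn
    have key := good_ineq a n ha hn0 z (L ^ 2) (L ^ 3) M V (by linarith)
      (one_le_pow₀ hL1) hM0
      (fun q hq hzq r hr hrn h => n1 ⟨hn, q, hq, hzq, r, hr, hrn, h⟩)
      (fun r hr hrn hm => by
        by_contra h
        exact n2 ⟨hn, r, hr, hrn, hm, not_le.1 h⟩)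
      (fun r hr hrn h => n3 ⟨hn, r, hr, hrn, h⟩)
      (fun r₁ r₂ h1 h2 h3 h4 h5 h6 => by
        by_contra h
        exact n4 ⟨hn, r₁, r₂, h1, h2, h, h3, h4, h5, h6⟩)
      (fun q hq p₁ p₂ h1 h2 h3 h4 h5 h6 => by
        by_contra h
        exact n5 ⟨hn, q, hq, p₁, p₂, h1, h2, h, h3, h4, h5, h6⟩)
      (by
        by_contra h
        exact n6 ⟨hn, not_le.1 h⟩)
      (fun b hb => by
        by_contra h
        exact n8 ⟨hn, b, not_le.1 h, hb⟩)
      (fun p hp hpn b hb => by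
        by_contra h
        exact n9 ⟨hn, p, hp, hpn, b, not_le.1 h, hb⟩)
    have hn7 : X / L < n := by
      by_contra h
      exact n7 ⟨hn, not_lt.1 h⟩
    have ha' : (a : ℝ) ≤ Real.exp T := by
      rw [← Real.log_le_iff_le_exp (by positivity)]; exact hTa'
    have hlow : X < L * ((L ^ 2) ^ 2 * (Real.exp T * (Real.exp M * (Real.exp V *
        (X / (Real.exp (110 * T * l ^ 2) * Real.exp T)))))) := by
      have h1 : X < L * n := by
        rw [div_lt_iff₀ (by linarith)] at hn7; linarith
      refine h1.trans_le (mul_le_mul_of_nonneg_left (key.trans ?_) (by linarith))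
      gcongr
    have h2 : L * ((L ^ 2) ^ 2 * (Real.exp T * (Real.exp M * (Real.exp V *
        (X / (Real.exp (110 * T * l ^ 2) * Real.exp T)))))) =
        X * (Real.exp (5 * l + M + V) / Real.exp (110 * T * l ^ 2)) := by
      have h3 : L * (L ^ 2) ^ 2 = Real.exp (5 * l) := by
        rw [hLl, ← Real.exp_nat_mul, ← Real.exp_nat_mul, ← Real.exp_add]
        congr 1; push_cast; ring
      rw [Real.exp_add, Real.exp_add, ← h3]
      have := Real.exp_pos T
      have := Real.exp_pos (110 * T * l ^ 2)
      field_simp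
    rw [h2] at hlow
    have h4 : Real.exp (5 * l + M + V) / Real.exp (110 * T * l ^ 2) ≤ 1 := by
      rw [div_le_one (Real.exp_pos _)]
      apply Real.exp_le_exp.2
      rw [hM, hV]
      have : l ≤ T * l ^ 2 := by
        calc l = 1 * l := by ring
          _ ≤ (T * l) * l := by gcongr
          _ = _ := by ring
      linarith
    have : X * (Real.exp (5 * l + M + V) / Real.exp (110 * T * l ^ 2)) ≤ X * 1 := by gcongr
    linarith
  -- counts
  have hll : Real.log (Real.log X) = l := by rw [← hL, hl]
  have k1 := lp_count a ha C hC X z (by linarith) (by rw [hll]; linarith) (by linarith) haz E1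
    (hmem _)
  have k2 := mid_large_count hw₀ hw X z M hwz hX hMw E2 (hmem _)
  have k3 := order_count a ha X z hX0.le (by linarith) E3 (hmem _)
  have k4 := mid_pair_count hw₀ hw X z hwz hX E4 (hmem _)
  have k5 := common_count X z hX1 (by linarith) E5 (hmem _)
  have hL61 : 1 ≤ 2 * (L ^ 3) ^ 2 := by
    have : 1 ≤ (L ^ 3) ^ 2 := one_le_pow₀ (one_le_pow₀ hL1)
    linarith
  have k6 := rankin_count X Z (2 * (L ^ 3) ^ 2) V hX1 (by linarith) hL61 hL6
    (by rw [hll]; exact hl1) E6 (hmem _)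
  have k7 : (E7.card : ℝ) ≤ X / L := by
    have := mult_count (X / L) (by positivity) 1 E7 (fun n hn =>
      ⟨(hmem _ n hn).1, (hmem _ n hn).2.2, one_dvd _⟩)
    simpa using this
  have k8 := square_count X (L ^ 2) hX1 (one_le_pow₀ hL1) E8 (hmem _)
  have k9 := square_shift_count X (L ^ 3) hX1 (one_le_pow₀ hL1) E9 (hmem _)
  rw [hll, hlogz] at k1 k4
  rw [hlogz] at k3
  rw [hll] at k2 k6
  rw [← hL] at k5 k9
  set S := X / (T * l) with hS
  have hS0 : 0 ≤ S := by positivity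
  have hXL : X / L ≤ S := by rw [hS]; gcongr
  have hzL : L ^ 6 ≤ z := by
    have h1 : (L ^ 3) ^ 2 = L ^ 6 := by ring
    have h2 : 0 ≤ L ^ 6 := by positivity
    rw [h1] at hL6; linarith
  have hinv : ∀ y : ℝ, L ≤ y → X / y ≤ S := by
    intro y hy
    refine le_trans ?_ hXL
    gcongr
  have m1 : |C| * X * (320 / Z + l * (2 / z)) ≤ |C| * (320 / c + 1) * S := by
    have h1 : X * (320 / Z) = 320 / c * S := by rw [hZ, hS]; field_simp
    have h2 : X * (l * (2 / z)) ≤ S := by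
      calc X * (l * (2 / z)) ≤ X * (L * (2 / (2 * (L ^ 3) ^ 2))) := by gcongr
        _ = X / L ^ 5 := by field_simp
        _ ≤ S := hinv _ (le_self_pow₀ hL1 (by norm_num))
    calc |C| * X * (320 / Z + l * (2 / z)) = |C| * (X * (320 / Z) + X * (l * (2 / z))) := by ring
      _ ≤ |C| * (320 / c * S + S) := by rw [h1]; gcongr
      _ = _ := by ring
  have m2 : X * (716800 * l / (M / 3)) = 71680 * S := by
    rw [hM, hS]; field_simp; norm_num
  have m3 : X * (128 * a / Z) = 128 * a / c * S := by rw [hZ, hS]; field_simp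
  have m4 : X * (716800 * l / Z) ^ 2 ≤ 716800 ^ 2 / c ^ 2 * S := by
    have h1 : X * (716800 * l / Z) ^ 2 = 716800 ^ 2 / c ^ 2 * (X / (T * T)) := by
      rw [hZ]; field_simp
    rw [h1]
    gcongr
    rw [hS]; gcongr
  have m5 : X * (1 + L) ^ 2 * (2 / z) ≤ 4 * S := by
    calc X * (1 + L) ^ 2 * (2 / z) ≤ X * (L + L) ^ 2 * (2 / (2 * (L ^ 3) ^ 2)) := by gcongr
      _ = 4 * (X / L ^ 4) := by field_simp; ring
      _ ≤ 4 * S := by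
        have := hinv _ (le_self_pow₀ hL1 (by norm_num : (4 : ℕ) ≠ 0)); linarith
  have m6 : X * Real.exp (Real.exp 1 * cS5 * l - V / Z) ≤ S := by
    have h1 : V / Z = (Real.exp 1 * cS5 + 1) * l := by
      have := cS5_pos
      have hpos : 0 < Real.exp 1 * cS5 + 1 := by positivity
      rw [hV, hZ, hc]; field_simp
    rw [h1, show Real.exp 1 * cS5 * l - (Real.exp 1 * cS5 + 1) * l = -l by ring, Real.exp_neg,
      ← hLl, ← div_eq_mul_inv]
    exact hXL
  have m8 : X * (2 / L ^ 2) ≤ 2 * S := by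
    have := hinv _ (le_self_pow₀ hL1 (by norm_num : (2 : ℕ) ≠ 0))
    calc X * (2 / L ^ 2) = 2 * (X / L ^ 2) := by ring
      _ ≤ _ := by linarith
  have m9 : X * (1 + L) * (2 / L ^ 3) ≤ 4 * S := by
    have := hinv _ (le_self_pow₀ hL1 (by norm_num : (2 : ℕ) ≠ 0))
    calc X * (1 + L) * (2 / L ^ 3) ≤ X * (L + L) * (2 / L ^ 3) := by gcongr
      _ = 4 * (X / L ^ 2) := by field_simp; ring
      _ ≤ _ := by linarith
  have hcard : E.card ≤ E1.card + (E2.card + (E3.card + (E4.card + (E5.card + (E6.card +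
      (E7.card + (E8.card + E9.card))))))) := by
    refine (Finset.card_le_card hcover).trans ?_
    refine (Finset.card_union_le _ _).trans (Nat.add_le_add_left ?_ _)
    refine (Finset.card_union_le _ _).trans (Nat.add_le_add_left ?_ _)
    refine (Finset.card_union_le _ _).trans (Nat.add_le_add_left ?_ _)
    refine (Finset.card_union_le _ _).trans (Nat.add_le_add_left ?_ _)
    refine (Finset.card_union_le _ _).trans (Nat.add_le_add_left ?_ _)
    refine (Finset.card_union_le _ _).trans (Nat.add_le_add_left ?_ _)
    refine (Finset.card_union_le _ _).trans (Nat.add_le_add_left ?_ _)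
    exact Finset.card_union_le _ _
  have hcard' : (E.card : ℝ) ≤ E1.card + (E2.card + (E3.card + (E4.card + (E5.card + (E6.card +
      (E7.card + (E8.card + E9.card))))))) := by exact_mod_cast hcard
  have hfin : (|C| * (320 / c + 1) + 71680 + 128 * a / c + 716800 ^ 2 / c ^ 2 + 12) * X /
      (T * l) = |C| * (320 / c + 1) * S + 71680 * S + 128 * a / c * S +
      716800 ^ 2 / c ^ 2 * S + 12 * S := by rw [hS]; ring
  rw [hfin]
  linarith

theorem stmt6 (a : ℕ) (ha : 1 < a)
    (hLP : ∃ C : ℝ, ∀ q : ℕ, q.Prime → Odd q → (¬ ∃ b : ℕ, b ^ q = a) →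
      ∀ X : ℝ, 3 ≤ X →
      (Nat.card {n : ℕ | 0 < n ∧ (n : ℝ) ≤ X ∧ ∃ r : ℕ, r.Prime ∧ r ∣ n ∧
          r % q = 1 ∧ (a : ZMod r) ^ ((r - 1) / q) = 1 ∧
          (q : ℝ) ^ 2 * (Real.log q) ^ 4 ≤ (r : ℝ)} : ℝ) ≤
        C * (X / (q * Real.log q) + X * Real.log (Real.log X) / (q : ℝ) ^ 2)) :
    ∃ C' X₀ : ℝ, ∀ X : ℝ, X₀ ≤ X → ∀ θ : ℝ, 1 / 10 ≤ θ → θ ≤ 9 / 10 →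
      (Nat.card {n : ℕ | 0 < n ∧ (n : ℝ) ≤ X ∧ (lstar a n : ℝ) ≤
          X / (Real.exp (110 * Real.log X ^ θ * Real.log (Real.log X) ^ 2) *
            Real.exp (Real.log X ^ θ))} : ℝ) ≤
        C' * X / (Real.log X ^ θ * Real.log (Real.log X)) := by
  classical
  obtain ⟨C, hC⟩ := hLP
  obtain ⟨w₀, hw₀, hw⟩ := large_facts
  set c : ℝ := 70 / (Real.exp 1 * cS5 + 1) with hc
  have hc0 : 0 < c := by rw [hc]; have := cS5_pos; positivity
  -- thresholds in terms of L = log X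
  have ev1 : ∀ᶠ L : ℝ in Filter.atTop, Real.log L ≤ L ^ ((1 : ℝ) / 10) := by
    have h := (isLittleO_log_rpow_atTop (r := 1 / 10) (by norm_num)).bound (c := 1) (by norm_num)
    filter_upwards [h, Filter.eventually_ge_atTop 1] with L hL hL1
    rw [Real.norm_eq_abs, Real.norm_eq_abs, one_mul] at hL
    rw [abs_of_nonneg (by positivity : (0 : ℝ) ≤ L ^ ((1 : ℝ) / 10))] at hL
    exact (le_abs_self _).trans hL
  have ev2 : ∀ᶠ L : ℝ in Filter.atTop,
      max (7 / c) (max (Real.log w₀ / c) (max (Real.log w₀) (max (Real.log a / c) (Real.log a)))) ≤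
        L ^ ((1 : ℝ) / 10) :=
    (tendsto_rpow_atTop (by norm_num)).eventually_ge_atTop _
  have ev3 : ∀ᶠ L : ℝ in Filter.atTop, 1 ≤ Real.log L :=
    Real.tendsto_log_atTop.eventually_ge_atTop 1
  have ev := Real.tendsto_log_atTop.eventually
    (ev1.and (ev2.and (ev3.and (Filter.eventually_ge_atTop (1 : ℝ)))))
  obtain ⟨X₀, hX₀⟩ := Filter.eventually_atTop.1 (ev.and (Filter.eventually_ge_atTop w₀))
  refine ⟨|C| * (320 / c + 1) + 71680 + 128 * a / c + 716800 ^ 2 / c ^ 2 + 12, X₀, ?_⟩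
  intro X hX θ hθ1 hθ2
  obtain ⟨⟨e1, e2, e3, e4⟩, hXw⟩ := hX₀ X hX
  set L := Real.log X with hL
  set l := Real.log L with hl
  set T := L ^ θ with hT
  simp only [max_le_iff] at e2
  obtain ⟨f1, f2, f3, f4, f5⟩ := e2
  have hT1 : L ^ ((1 : ℝ) / 10) ≤ T := Real.rpow_le_rpow_of_exponent_le e4 hθ1
  have hT9 : T ≤ L ^ ((9 : ℝ) / 10) := Real.rpow_le_rpow_of_exponent_le e4 hθ2
  have hLpos : 0 < L := by linarith
  have hTL : T * l ≤ L := by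
    calc T * l ≤ L ^ ((9 : ℝ) / 10) * L ^ ((1 : ℝ) / 10) := by gcongr
      _ = L := by rw [← Real.rpow_add hLpos]; norm_num
  set E := (Finset.Ioc 0 ⌊X⌋₊).filter (fun n => (lstar a n : ℝ) ≤
      X / (Real.exp (110 * T * l ^ 2) * Real.exp T)) with hE
  have hX0 : 0 ≤ X := by linarith
  have hset : {n : ℕ | 0 < n ∧ (n : ℝ) ≤ X ∧ (lstar a n : ℝ) ≤
      X / (Real.exp (110 * T * l ^ 2) * Real.exp T)} = (E : Set ℕ) := by
    ext n
    rw [Finset.mem_coe, hE, Finset.mem_filter, Finset.mem_Ioc, Set.mem_ofPred_eq,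
      Nat.le_floor_iff hX0, and_assoc]
  rw [hset, Nat.card_coe_set_eq, Set.ncard_coe_finset]
  have hcT : ∀ y : ℝ, y / c ≤ L ^ ((1 : ℝ) / 10) → y ≤ c * T := by
    intro y hy
    have := hy.trans hT1
    rw [div_le_iff₀ hc0] at this
    linarith
  exact core a ha C hC hw₀ hw c hc X L l T hL hl hXw e3 (e1.trans hT1) hTL (hcT _ f1) (hcT _ f2)
    (f3.trans hT1) (hcT _ f4) (f5.trans hT1) E (by
      intro n hn
      have : n ∈ (E : Set ℕ) := hn
      rw [← hset] at this
      exact this)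
end

section
/- For all sufficiently large real X, for every real Δ with Δ ≥ (log log X)³, the number of positive integers n ≤ X with λ(n) ≤ n·exp(−Δ) is at most X·exp(−0.69·(Δ·log Δ)^(1/3)). -/
open Filter

/-- Carmichael's function: the exponent of the multiplicative group `(ℤ/nℤ)ˣ`. -/
noncomputable def carmichael (n : ℕ) : ℕ :=
  Monoid.exponent (ZMod n)ˣ

lemma aux_harm (Y : ℕ) : ∑ m ∈ Finset.Icc 1 Y, (1:ℝ) / m ≤ 1 + Real.log Y := by
  have h := harmonic_le_one_add_log Y
  rw [harmonic_eq_sum_Icc] at h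
  push_cast at h
  simpa [one_div] using h

lemma aux_two_pow (n : ℕ) (hn : n ≠ 0) : 2 ^ n.primeFactors.card ≤ n.divisors.card := by
  rw [← Finset.card_powerset]
  apply Finset.card_le_card_of_injOn (fun s => ∏ p ∈ s, p)
  · intro s hs
    simp only [Finset.coe_powerset, Set.mem_preimage, Set.mem_powerset_iff, Finset.coe_subset] at hs
    simp only [Finset.mem_coe, Nat.mem_divisors]
    exact ⟨(Finset.prod_dvd_prod_of_subset _ _ _ hs).trans (Nat.prod_primeFactors_dvd n), hn⟩
  · intro s hs t ht hst
    simp only [Finset.coe_powerset, Set.mem_preimage, Set.mem_powerset_iff, Finset.coe_subset] at hs ht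
    have h1 := Nat.primeFactors_prod (s := s) (fun p hp => Nat.prime_of_mem_primeFactors (hs hp))
    have h2 := Nat.primeFactors_prod (s := t) (fun p hp => Nat.prime_of_mem_primeFactors (ht hp))
    rw [← h1, ← h2]
    exact congrArg Nat.primeFactors hst

lemma aux_tau (Y : ℕ) :
    ∑ n ∈ Finset.Icc 1 Y, (n.divisors.card : ℝ) / n ≤ (1 + Real.log Y) ^ 2 := by
  have h0 : (0:ℝ) ≤ ∑ m ∈ Finset.Icc 1 Y, (1:ℝ) / m := Finset.sum_nonneg (fun _ _ => by positivity)
  refine le_trans ?_ (pow_le_pow_left₀ h0 (aux_harm Y) 2)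
  rw [sq, Finset.sum_mul_sum, ← Finset.sum_product']
  have h1 : ∀ n ∈ Finset.Icc 1 Y, (n.divisors.card : ℝ) / n =
      ∑ x ∈ n.divisorsAntidiagonal, (1:ℝ) / x.1 * (1 / x.2) := by
    intro n hn
    rw [Nat.sum_divisorsAntidiagonal (fun a b : ℕ => (1:ℝ) / a * (1 / b)),
      Finset.sum_congr rfl (g := fun _ => (1:ℝ)/n)]
    · simp [div_eq_mul_inv]
    · intro d hd
      have hd' := Nat.mem_divisors.1 hd
      rw [one_div_mul_one_div, ← Nat.cast_mul, Nat.mul_div_cancel' hd'.1]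
  rw [Finset.sum_congr rfl h1, ← Finset.sum_biUnion]
  · apply Finset.sum_le_sum_of_subset_of_nonneg
    · intro x hx
      simp only [Finset.mem_biUnion, Nat.mem_divisorsAntidiagonal, Finset.mem_Icc] at hx
      obtain ⟨n, ⟨hn1, hn2⟩, h, h0⟩ := hx
      have ha : x.1 ≠ 0 := by rintro h'; simp [h'] at h; omega
      have hb : x.2 ≠ 0 := by rintro h'; simp [h'] at h; omega
      have := Nat.le_mul_of_pos_right x.1 (Nat.pos_of_ne_zero hb)
      have := Nat.le_mul_of_pos_left x.2 (Nat.pos_of_ne_zero ha)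
      simp only [Finset.mem_product, Finset.mem_Icc]
      omega
    · intros; positivity
  · intro a _ b _ hab
    refine Finset.disjoint_left.2 fun x hx hx' => hab ?_
    simp only [Nat.mem_divisorsAntidiagonal] at hx hx'
    omega

lemma aux_omega (Y k : ℕ) :
    ∑ n ∈ (Finset.Icc 1 Y).filter (fun n => k < n.primeFactors.card), (1:ℝ) / n ≤
      (1/2) ^ k * (1 + Real.log Y) ^ 2 := by
  refine le_trans ?_ (mul_le_mul_of_nonneg_left (aux_tau Y) (by positivity))
  rw [Finset.mul_sum]
  refine le_trans ?_ (Finset.sum_le_sum_of_subset_of_nonneg (Finset.filter_subset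
    (fun n => k < n.primeFactors.card) _) (fun _ _ _ => by positivity))
  apply Finset.sum_le_sum
  intro n hn
  simp only [Finset.mem_filter, Finset.mem_Icc] at hn
  rw [← mul_div_assoc]
  gcongr
  have h1 := aux_two_pow n (by omega)
  have h2 : 2 ^ k ≤ n.divisors.card := le_trans (Nat.pow_le_pow_right (by norm_num) hn.2.le) h1
  have h3 : (2:ℝ) ^ k ≤ n.divisors.card := by exact_mod_cast h2
  calc (1:ℝ) = (1/2)^k * 2^k := by rw [← mul_pow]; norm_num
    _ ≤ _ := by gcongr

lemma aux_sqrt_sum (n : ℕ) : ∑ j ∈ Finset.Icc 1 n, 1 / √(j:ℝ) ≤ 2 * √n := by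
  induction n with
  | zero => simp
  | succ n ih =>
    rw [Finset.sum_Icc_succ_top (by omega)]
    have h1 : (0:ℝ) < √((n+1 : ℕ):ℝ) := Real.sqrt_pos.2 (by positivity)
    have h2 := Real.sq_sqrt (show (0:ℝ) ≤ ((n+1:ℕ):ℝ) by positivity)
    have h3 := Real.sq_sqrt (show (0:ℝ) ≤ (n:ℝ) by positivity)
    have h4 := Real.sqrt_nonneg (n:ℝ)
    have : 1 / √((n+1 : ℕ):ℝ) ≤ 2 * (√((n+1 : ℕ):ℝ) - √(n:ℝ)) := by
      rw [div_le_iff₀ h1]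
      push_cast at *
      nlinarith [sq_nonneg (√((n:ℝ)+1) - √(n:ℝ))]
    linarith

lemma aux_sqrt_set (S : Finset ℕ) (hS : ∀ q ∈ S, 1 ≤ q) :
    ∑ q ∈ S, 1 / √(q:ℝ) ≤ 3 * √(S.card) := by
  rw [← Finset.sum_filter_add_sum_filter_not S (fun q => q ≤ S.card)]
  have h1 : ∑ q ∈ S.filter (fun q => q ≤ S.card), 1 / √(q:ℝ) ≤ 2 * √(S.card) := by
    refine le_trans ?_ (aux_sqrt_sum S.card)
    apply Finset.sum_le_sum_of_subset_of_nonneg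
    · intro q hq
      simp only [Finset.mem_filter] at hq
      exact Finset.mem_Icc.2 ⟨hS q hq.1, hq.2⟩
    · intros; positivity
  have h2 : ∑ q ∈ S.filter (fun q => ¬ q ≤ S.card), 1 / √(q:ℝ) ≤ √(S.card) := by
    rcases Nat.eq_zero_or_pos S.card with h | h
    · rw [Finset.card_eq_zero] at h; subst h; simp
    have hc : (0:ℝ) < √(S.card) := Real.sqrt_pos.2 (by exact_mod_cast h)
    calc _ ≤ ∑ q ∈ S.filter (fun q => ¬ q ≤ S.card), 1 / √(S.card) := by
          apply Finset.sum_le_sum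
          intro q hq
          simp only [Finset.mem_filter, not_le] at hq
          have : (S.card : ℝ) ≤ q := by exact_mod_cast hq.2.le
          gcongr
      _ ≤ S.card * (1 / √(S.card)) := by
          rw [Finset.sum_const, nsmul_eq_mul]
          gcongr
          exact Finset.filter_subset _ _
      _ = √(S.card) := by
          rw [mul_one_div, Real.div_sqrt]
  linarith

open scoped Pointwise in
/-- the divisor sum of `1/√d` -/
lemma aux_div_mul (a b : ℕ) :
    ∑ d ∈ (a * b).divisors, 1 / √(d:ℝ) ≤
      (∑ d ∈ a.divisors, 1 / √(d:ℝ)) * ∑ d ∈ b.divisors, 1 / √(d:ℝ) := by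
  rw [Finset.sum_mul_sum, ← Finset.sum_product', Nat.divisors_mul]
  have : a.divisors * b.divisors = (a.divisors ×ˢ b.divisors).image (fun x => x.1 * x.2) := by
    ext x; simp [Finset.mem_mul, and_assoc]
  rw [this]
  refine le_trans (Finset.sum_image_le_of_nonneg (fun _ _ => by positivity)) ?_
  apply le_of_eq
  apply Finset.sum_congr rfl
  intro x _
  push_cast
  rw [Real.sqrt_mul (by positivity), one_div_mul_one_div]

lemma aux_prime_pow (p n : ℕ) (hp : p.Prime) :
    ∑ d ∈ (p ^ n).divisors, 1 / √(d:ℝ) ≤ Real.exp (4 * (1 / √(p:ℝ))) := by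
  rw [Nat.sum_divisors_prime_pow hp]
  set x := 1 / √(p:ℝ) with hx
  have h2 : (4/3:ℝ) ≤ √(p:ℝ) := by
    apply Real.le_sqrt_of_sq_le
    have : (2:ℝ) ≤ p := by exact_mod_cast hp.two_le
    norm_num; linarith
  have hx1 : x ≤ 3/4 := by
    rw [hx, div_le_iff₀ (by linarith)]; linarith
  have hx0 : 0 ≤ x := by positivity
  have : ∀ i, 1 / √((p ^ i : ℕ):ℝ) = x ^ i := by
    intro i
    rw [hx, div_pow, one_pow]
    push_cast
    congr 1
    rw [Real.sqrt_eq_iff_mul_self_eq (by positivity) (by positivity), ← mul_pow, Real.mul_self_sqrt (by positivity)]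
  simp only [this]
  have h3 : (∑ i ∈ Finset.range (n+1), x ^ i) * (1 - x) ≤ 1 := by
    have := geom_sum_mul x (n+1)
    have := pow_nonneg hx0 (n+1)
    nlinarith
  have h4 := Real.add_one_le_exp (4 * x)
  refine le_trans ?_ h4
  have : (1:ℝ) ≤ (4*x+1)*(1-x) := by nlinarith
  exact le_of_mul_le_mul_right (h3.trans this) (by linarith)

lemma aux_div_sum (N : ℕ) (hN : N ≠ 0) :
    ∑ d ∈ N.divisors, 1 / √(d:ℝ) ≤ Real.exp (4 * ∑ q ∈ N.primeFactors, 1 / √(q:ℝ)) := by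
  revert hN
  induction N using Nat.recOnPosPrimePosCoprime with
  | prime_pow p n hp hn =>
    intro _
    rw [Nat.primeFactors_prime_pow hn.ne' hp, Finset.sum_singleton]
    exact aux_prime_pow p n hp
  | zero => simp
  | one => simp
  | coprime a b ha hb hab iha ihb =>
    intro _
    rw [hab.primeFactors_mul, Finset.sum_union hab.disjoint_primeFactors, mul_add, Real.exp_add]
    refine (aux_div_mul a b).trans ?_
    exact mul_le_mul (iha (by omega)) (ihb (by omega)) (Finset.sum_nonneg (fun _ _ => by positivity)) (by positivity)

lemma aux_div_large (N k : ℕ) (hN : N ≠ 0) (hk : N.primeFactors.card ≤ k ^ 2) (D : ℝ) (hD : 0 < D) :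
    ∑ d ∈ N.divisors.filter (fun d : ℕ => D < d), (1:ℝ) / d ≤ 1 / √D * Real.exp (12 * k) := by
  have h1 : ∑ d ∈ N.divisors, 1 / √(d:ℝ) ≤ Real.exp (12 * k) := by
    refine (aux_div_sum N hN).trans (Real.exp_le_exp.2 ?_)
    have h := aux_sqrt_set N.primeFactors (fun q hq => (Nat.prime_of_mem_primeFactors hq).one_le)
    have h2 : √(N.primeFactors.card : ℝ) ≤ k := by
      rw [Real.sqrt_le_left (by positivity)]
      exact_mod_cast hk
    linarith
  refine le_trans ?_ (mul_le_mul_of_nonneg_left h1 (by positivity))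
  rw [Finset.mul_sum]
  refine le_trans ?_ (Finset.sum_le_sum_of_subset_of_nonneg (Finset.filter_subset
    (fun d : ℕ => D < d) _) (fun _ _ _ => by positivity))
  apply Finset.sum_le_sum
  intro d hd
  have hd2 := (Finset.mem_filter.1 hd).2
  have : (d:ℝ) = √d * √d := (Real.mul_self_sqrt (by positivity)).symm
  rw [one_div_mul_one_div]
  nth_rw 1 [this]
  have hs : 0 < √D := Real.sqrt_pos.2 hD
  have : √D ≤ √d := Real.sqrt_le_sqrt hd2.le
  have : 0 < √(d:ℝ) := by linarith
  gcongr

lemma aux_lcm_dvd (n : ℕ) (hn : n ≠ 0) : n.primeFactors.lcm (fun p => p - 1) ∣ carmichael n := by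
  apply Finset.lcm_dvd
  intro p hp
  have hpp := Nat.prime_of_mem_primeFactors hp
  have hd := Nat.dvd_of_mem_primeFactors hp
  have : Fact p.Prime := ⟨hpp⟩
  have : NeZero n := ⟨hn⟩
  have h := MonoidHom.exponent_dvd (ZMod.unitsMap_surjective hd)
  rwa [IsCyclic.exponent_eq_card, Nat.card_eq_fintype_card, ZMod.card_units] at h

lemma aux_carm_pos (n : ℕ) (hn : n ≠ 0) : 0 < carmichael n := by
  have : NeZero n := ⟨hn⟩
  exact Nat.pos_of_ne_zero Monoid.exponent_ne_zero_of_finite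

lemma aux_prod_lcm (f : ℕ → ℕ) (D : ℝ) (hD : 0 ≤ D) (S : Finset ℕ) (hf : ∀ p ∈ S, f p ≠ 0)
    (h : ∀ p ∈ S, (Nat.gcd (f p) (∏ q ∈ S.erase p, f q) : ℝ) ≤ D) :
    ((∏ p ∈ S, f p : ℕ) : ℝ) ≤ D ^ S.card * (S.lcm f : ℕ) := by
  induction S using Finset.induction_on with
  | empty => simp
  | insert a S ha ih =>
    have hS := ih (fun p hp => hf p (Finset.mem_insert_of_mem hp)) (fun p hp => by
      refine le_trans ?_ (h p (Finset.mem_insert_of_mem hp))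
      have hne : a ≠ p := by rintro rfl; exact ha hp
      rw [Finset.erase_insert_of_ne hne, Finset.prod_insert (by simp [ha])]
      have : f p ≠ 0 := hf p (Finset.mem_insert_of_mem hp)
      exact_mod_cast Nat.le_of_dvd (Nat.gcd_pos_of_pos_left _ (Nat.pos_of_ne_zero this))
        (Nat.gcd_dvd_gcd_of_dvd_right _ (Dvd.intro_left _ rfl)))
    have haa := h a (Finset.mem_insert_self _ _)
    rw [Finset.erase_insert ha] at haa
    have hfa := hf a (Finset.mem_insert_self _ _)
    have hg : (Nat.gcd (f a) (S.lcm f) : ℝ) ≤ D := by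
      refine le_trans ?_ haa
      exact_mod_cast Nat.le_of_dvd (Nat.gcd_pos_of_pos_left _ (Nat.pos_of_ne_zero hfa))
        (Nat.gcd_dvd_gcd_of_dvd_right _ (Finset.lcm_dvd fun q hq => Finset.dvd_prod_of_mem f hq))
    rw [Finset.prod_insert ha, Finset.card_insert_of_notMem ha, Finset.lcm_insert]
    have key : (Nat.gcd (f a) (S.lcm f) : ℝ) * (Nat.lcm (f a) (S.lcm f) : ℕ) = f a * (S.lcm f : ℕ) := by
      exact_mod_cast Nat.gcd_mul_lcm _ _
    have : (GCDMonoid.lcm (f a) (S.lcm f)) = Nat.lcm (f a) (S.lcm f) := rfl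
    rw [this]
    push_cast at *
    calc (f a : ℝ) * ∏ p ∈ S, (f p : ℝ) ≤ f a * (D ^ S.card * (S.lcm f : ℕ)) := by gcongr
      _ = D ^ S.card * (f a * (S.lcm f : ℕ)) := by ring
      _ = D ^ S.card * ((Nat.gcd (f a) (S.lcm f) : ℝ) * (Nat.lcm (f a) (S.lcm f) : ℕ)) := by rw [key]
      _ ≤ D ^ S.card * (D * (Nat.lcm (f a) (S.lcm f) : ℕ)) := by gcongr
      _ = _ := by ring

lemma aux_det (n k : ℕ) (hn : n ≠ 0) (B D : ℝ) (hB : 0 ≤ B) (hD : 1 ≤ D)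
    (hk : n.primeFactors.card ≤ k) (hb : ∀ b : ℕ, b ^ 2 ∣ n → (b:ℝ) ≤ B)
    (hg : ∀ p ∈ n.primeFactors,
      (Nat.gcd (p - 1) (∏ q ∈ n.primeFactors.erase p, (q - 1)) : ℝ) ≤ D) :
    (n:ℝ) ≤ B ^ 2 * 2 ^ k * D ^ k * carmichael n := by
  obtain ⟨a, b, hab, hsq⟩ := Nat.sq_mul_squarefree n
  have hbB := hb b (Dvd.intro _ hab)
  have h1 : ((∏ p ∈ n.primeFactors, (p - 1) : ℕ) : ℝ) ≤ D ^ k * carmichael n := by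
    refine (aux_prod_lcm (fun p => p - 1) D (by linarith) _ (fun p hp => ?_) hg).trans ?_
    · have := (Nat.prime_of_mem_primeFactors hp).two_le
      omega
    · have h3 : ((n.primeFactors.lcm (fun p => p - 1) : ℕ) : ℝ) ≤ carmichael n := by
        exact_mod_cast Nat.le_of_dvd (aux_carm_pos n hn) (aux_lcm_dvd n hn)
      have h4 : D ^ n.primeFactors.card ≤ D ^ k := pow_le_pow_right₀ hD hk
      gcongr
  have h2 : a ≤ 2 ^ k * ∏ p ∈ n.primeFactors, (p - 1) := by
    have ha : a = ∏ p ∈ a.primeFactors, p := (Nat.prod_primeFactors_of_squarefree hsq).symm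
    have hsub : a.primeFactors ⊆ n.primeFactors := Nat.primeFactors_mono (Dvd.intro_left _ hab) hn
    have h5 : a ≤ ∏ p ∈ n.primeFactors, p := by
      rw [ha]
      refine Nat.le_of_dvd (Finset.prod_pos fun p hp => (Nat.prime_of_mem_primeFactors hp).pos) ?_
      exact Finset.prod_dvd_prod_of_subset _ _ _ hsub
    have h6 : ∏ p ∈ n.primeFactors, p ≤ ∏ p ∈ n.primeFactors, (2 * (p - 1)) := by
      apply Finset.prod_le_prod'
      intro p hp
      have := (Nat.prime_of_mem_primeFactors hp).two_le
      omega
    rw [Finset.prod_mul_distrib, Finset.prod_const] at h6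
    refine h5.trans (h6.trans ?_)
    exact Nat.mul_le_mul_right _ (Nat.pow_le_pow_right (by norm_num) hk)
  have h2' : (a:ℝ) ≤ 2 ^ k * (D ^ k * carmichael n) := by
    have : (a:ℝ) ≤ 2 ^ k * ((∏ p ∈ n.primeFactors, (p - 1) : ℕ) : ℝ) := by exact_mod_cast h2
    refine this.trans ?_
    gcongr
  have : (n:ℝ) = (b:ℝ) ^ 2 * a := by rw [← hab]; push_cast; ring
  rw [this]
  calc (b:ℝ) ^ 2 * a ≤ B ^ 2 * (2 ^ k * (D ^ k * carmichael n)) := by gcongr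
    _ = _ := by ring

/-- multiples of `m` up to `Y` -/
lemma aux_mult (Y m : ℕ) : (((Finset.Icc 1 Y).filter (fun n => m ∣ n)).card : ℝ) ≤ Y / m := by
  have : ((Finset.Icc 1 Y).filter (fun n => m ∣ n)).card = Y / m := by
    have := Nat.Ioc_filter_dvd_card_eq_div Y m
    rwa [show Finset.Ioc 0 Y = Finset.Icc 1 Y from by ext; simp [Nat.succ_le_iff]] at this
  rw [this]
  exact Nat.cast_div_le

lemma aux_A1 (Y k : ℕ) :
    (((Finset.Icc 1 Y).filter (fun n => k < n.primeFactors.card)).card : ℝ) ≤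
      Y * ((1/2) ^ k * (1 + Real.log Y) ^ 2) := by
  refine le_trans ?_ (mul_le_mul_of_nonneg_left (aux_omega Y k) (by positivity))
  rw [Finset.mul_sum, Finset.card_eq_sum_ones]
  push_cast
  apply Finset.sum_le_sum
  intro n hn
  simp only [Finset.mem_filter, Finset.mem_Icc] at hn
  have h1 : (0:ℝ) < n := by exact_mod_cast hn.1.1
  have h2 : (n:ℝ) ≤ Y := by exact_mod_cast hn.1.2
  rw [mul_one_div, le_div_iff₀ h1]
  linarith

lemma aux_A2 (Y k : ℕ) :
    (((Finset.Icc 1 Y).filter (fun n => ∃ q ∈ n.primeFactors, k < (q-1).primeFactors.card)).card : ℝ) ≤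
      Y * ((1/2) ^ k * (1 + Real.log Y) ^ 2) := by
  refine le_trans ?_ (mul_le_mul_of_nonneg_left (aux_omega Y k) (by positivity))
  have hsub : (Finset.Icc 1 Y).filter (fun n => ∃ q ∈ n.primeFactors, k < (q-1).primeFactors.card) ⊆
      ((Finset.Icc 1 Y).filter (fun j => k < j.primeFactors.card)).biUnion
        (fun j => (Finset.Icc 1 Y).filter (fun n => (j + 1) ∣ n)) := by
    intro n hn
    simp only [Finset.mem_filter, Finset.mem_Icc, Finset.mem_biUnion] at hn ⊢
    obtain ⟨hn1, q, hq, hk⟩ := hn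
    have h1 := (Nat.prime_of_mem_primeFactors hq).two_le
    have h2 := Nat.dvd_of_mem_primeFactors hq
    have h3 := Nat.le_of_dvd (by omega) h2
    refine ⟨q - 1, ⟨by omega, hk⟩, hn1, ?_⟩
    rwa [Nat.sub_add_cancel (by omega)]
  refine le_trans (Nat.cast_le.2 ((Finset.card_le_card hsub).trans Finset.card_biUnion_le)) ?_
  rw [Finset.mul_sum]
  push_cast
  apply Finset.sum_le_sum
  intro j hj
  simp only [Finset.mem_filter, Finset.mem_Icc] at hj
  have h1 : (0:ℝ) < j := by exact_mod_cast hj.1.1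
  refine (aux_mult Y (j+1)).trans ?_
  rw [mul_one_div]
  push_cast
  gcongr
  linarith

open scoped Classical in
lemma aux_A3 (Y : ℕ) (B : ℝ) (hB : 0 < B) :
    (((Finset.Icc 1 Y).filter (fun n => ∃ b : ℕ, B < b ∧ b ^ 2 ∣ n)).card : ℝ) ≤
      Y * (1 / B * (1 + Real.log Y)) := by
  classical
  refine le_trans ?_ (mul_le_mul_of_nonneg_left (mul_le_mul_of_nonneg_left (aux_harm Y)
    (show 0 ≤ 1 / B by positivity)) (by positivity))
  have hsub : (Finset.Icc 1 Y).filter (fun n => ∃ b : ℕ, B < b ∧ b ^ 2 ∣ n) ⊆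
      ((Finset.Icc 1 Y).filter (fun b : ℕ => B < b)).biUnion
        (fun b => (Finset.Icc 1 Y).filter (fun n => b ^ 2 ∣ n)) := by
    intro n hn
    simp only [Finset.mem_filter, Finset.mem_Icc, Finset.mem_biUnion] at hn ⊢
    obtain ⟨hn1, b, hb, hd⟩ := hn
    have h0 : 0 < b := by
      have : (0:ℝ) < b := hB.trans hb
      exact_mod_cast this
    have h3 := Nat.le_of_dvd (by omega) hd
    have h4 : b ≤ b ^ 2 := Nat.le_self_pow (by norm_num) b
    exact ⟨b, ⟨by omega, hb⟩, hn1, hd⟩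
  refine le_trans (Nat.cast_le.2 ((Finset.card_le_card hsub).trans Finset.card_biUnion_le)) ?_
  rw [Finset.mul_sum, Finset.mul_sum]
  push_cast
  refine le_trans ?_ (Finset.sum_le_sum_of_subset_of_nonneg (Finset.filter_subset
    (fun b : ℕ => B < b) _) (fun _ _ _ => by positivity))
  apply Finset.sum_le_sum
  intro b hb
  have hb' := (Finset.mem_filter.1 hb).2
  refine (aux_mult Y (b^2)).trans ?_
  have h0 : (0:ℝ) < b := hB.trans hb'
  rw [one_div_mul_one_div, mul_one_div]
  push_cast
  rw [sq]
  gcongr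

lemma aux_N_card (m k : ℕ) (hk : m.primeFactors.card ≤ k)
    (hq : ∀ q ∈ m.primeFactors, (q-1).primeFactors.card ≤ k) :
    (∏ q ∈ m.primeFactors, (q-1)).primeFactors.card ≤ k ^ 2 := by
  have hsub : (∏ q ∈ m.primeFactors, (q-1)).primeFactors ⊆
      m.primeFactors.biUnion (fun q => (q-1).primeFactors) := by
    intro r hr
    have hp := Nat.prime_of_mem_primeFactors hr
    have hd := Nat.dvd_of_mem_primeFactors hr
    obtain ⟨q, hq, hrq⟩ := (hp.prime.dvd_finsetProd_iff _).1 hd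
    have := (Nat.prime_of_mem_primeFactors hq).two_le
    exact Finset.mem_biUnion.2 ⟨q, hq, Nat.mem_primeFactors.2 ⟨hp, hrq, by omega⟩⟩
  refine (Finset.card_le_card hsub).trans ((Finset.card_biUnion_le_card_mul _ _ k hq).trans ?_)
  rw [sq]
  exact Nat.mul_le_mul_right _ hk

lemma aux_A4 (Y k : ℕ) (D : ℝ) (hD : 0 < D) :
    (((Finset.Icc 1 Y).filter (fun n => n.primeFactors.card ≤ k ∧
      (∀ q ∈ n.primeFactors, (q-1).primeFactors.card ≤ k) ∧ ∃ p ∈ n.primeFactors,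
      D < (Nat.gcd (p - 1) (∏ q ∈ n.primeFactors.erase p, (q - 1)) : ℝ))).card : ℝ) ≤
      Y * (1 / √D * Real.exp (12 * k) * (1 + Real.log Y)) := by
  classical
  refine le_trans ?_ (mul_le_mul_of_nonneg_left (mul_le_mul_of_nonneg_left (aux_harm Y)
    (show 0 ≤ 1 / √D * Real.exp (12 * k) by positivity)) (by positivity))
  have hN0 : ∀ m : ℕ, ∏ q ∈ m.primeFactors, (q-1) ≠ 0 := by
    intro m
    refine Finset.prod_ne_zero_iff.2 fun q hq => ?_
    have := (Nat.prime_of_mem_primeFactors hq).two_le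
    omega
  have hsub : (Finset.Icc 1 Y).filter (fun n => n.primeFactors.card ≤ k ∧
      (∀ q ∈ n.primeFactors, (q-1).primeFactors.card ≤ k) ∧ ∃ p ∈ n.primeFactors,
      D < (Nat.gcd (p - 1) (∏ q ∈ n.primeFactors.erase p, (q - 1)) : ℝ)) ⊆
      ((Finset.Icc 1 Y).filter (fun m : ℕ =>
          (∏ q ∈ m.primeFactors, (q-1)).primeFactors.card ≤ k ^ 2)).biUnion
        (fun m => ((∏ q ∈ m.primeFactors, (q-1)).divisors.filter (fun d : ℕ => D < d)).biUnion
          (fun d => (Finset.Icc 1 (Y / (m * d))).image (fun j => m * (d * j + 1)))) := by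
    intro n hn
    simp only [Finset.mem_filter, Finset.mem_Icc] at hn
    obtain ⟨hn1, hk, hqk, p, hp, hDp⟩ := hn
    have hpp := Nat.prime_of_mem_primeFactors hp
    have h2 := hpp.two_le
    obtain ⟨m, rfl⟩ := Nat.dvd_of_mem_primeFactors hp
    have hm0 : m ≠ 0 := by rintro rfl; simp at hn1
    have hmsub : m.primeFactors ⊆ (p * m).primeFactors :=
      Nat.primeFactors_mono (Dvd.intro_left _ rfl) (by omega)
    set d := Nat.gcd (p - 1) (∏ q ∈ (p * m).primeFactors.erase p, (q - 1)) with hd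
    have hd0 : 0 < d := Nat.gcd_pos_of_pos_left _ (by omega)
    have hdN : d ∣ ∏ q ∈ m.primeFactors, (q-1) := by
      refine (Nat.gcd_dvd_right _ _).trans (Finset.prod_dvd_prod_of_subset _ _ _ ?_)
      intro q hq
      have hq1 := Finset.mem_erase.1 hq
      have hqp := Nat.prime_of_mem_primeFactors hq1.2
      rcases (hqp.dvd_mul).1 (Nat.dvd_of_mem_primeFactors hq1.2) with h | h
      · exact absurd ((Nat.prime_dvd_prime_iff_eq hqp hpp).1 h) hq1.1
      · exact Nat.mem_primeFactors.2 ⟨hqp, h, hm0⟩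
    obtain ⟨j, hj⟩ : d ∣ p - 1 := Nat.gcd_dvd_left _ _
    have hpj : p = d * j + 1 := by omega
    simp only [Finset.mem_biUnion, Finset.mem_filter, Finset.mem_image, Finset.mem_Icc,
      Nat.mem_divisors]
    refine ⟨m, ⟨⟨by omega, ?_⟩, aux_N_card m k ((Finset.card_le_card hmsub).trans hk)
      (fun q hq => hqk q (hmsub hq))⟩, d, ⟨⟨hdN, hN0 m⟩, hDp⟩, j, ⟨?_, ?_⟩, ?_⟩
    · exact (Nat.le_mul_of_pos_left m hpp.pos).trans hn1.2
    · rcases Nat.eq_zero_or_pos j with h | h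
      · rw [h] at hj; omega
      · exact h
    · rw [Nat.le_div_iff_mul_le (Nat.mul_pos (by omega) hd0)]
      refine le_trans ?_ hn1.2
      rw [hpj]
      nlinarith
    · rw [← hpj, mul_comm]
  refine le_trans (Nat.cast_le.2 ((Finset.card_le_card hsub).trans (Finset.card_biUnion_le.trans
    (Finset.sum_le_sum fun m _ => Finset.card_biUnion_le.trans
      (Finset.sum_le_sum fun d _ => Finset.card_image_le))))) ?_
  rw [Finset.mul_sum, Finset.mul_sum]
  push_cast
  refine le_trans ?_ (Finset.sum_le_sum_of_subset_of_nonneg (Finset.filter_subset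
    (fun m : ℕ => (∏ q ∈ m.primeFactors, (q-1)).primeFactors.card ≤ k ^ 2) _)
      (fun _ _ _ => by positivity))
  apply Finset.sum_le_sum
  intro m hm
  have hm2 := (Finset.mem_filter.1 hm).2
  have key := aux_div_large _ k (hN0 m) hm2 D hD
  calc _ ≤ ∑ d ∈ (∏ q ∈ m.primeFactors, (q-1)).divisors.filter (fun d : ℕ => D < d),
        (Y:ℝ) * (1 / m) * (1 / d) := by
        apply Finset.sum_le_sum
        intro d _
        rw [Nat.card_Icc, Nat.add_sub_cancel]
        refine Nat.cast_div_le.trans (le_of_eq ?_)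
        push_cast
        rw [mul_assoc, one_div_mul_one_div, mul_one_div]
    _ = (Y:ℝ) * (1 / m) * ∑ d ∈ (∏ q ∈ m.primeFactors, (q-1)).divisors.filter (fun d : ℕ => D < d),
        (1 / (d:ℝ)) := by rw [Finset.mul_sum]
    _ ≤ (Y:ℝ) * (1 / m) * (1 / √D * Real.exp (12 * k)) := by gcongr
    _ = _ := by ring

lemma aux_total (Y k : ℕ) (B D E : ℝ) (hB : 0 < B) (hD : 1 ≤ D)
    (hE : B ^ 2 * 2 ^ k * D ^ k < E) :
    (((Finset.Icc 1 Y).filter (fun n => (carmichael n : ℝ) * E ≤ n)).card : ℝ) ≤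
      Y * (2 * ((1/2) ^ k * (1 + Real.log Y) ^ 2) + 1 / B * (1 + Real.log Y) +
        1 / √D * Real.exp (12 * k) * (1 + Real.log Y)) := by
  classical
  have hsub : (Finset.Icc 1 Y).filter (fun n => (carmichael n : ℝ) * E ≤ n) ⊆
      (((Finset.Icc 1 Y).filter (fun n => k < n.primeFactors.card)) ∪
      ((Finset.Icc 1 Y).filter (fun n => ∃ q ∈ n.primeFactors, k < (q-1).primeFactors.card))) ∪
      (((Finset.Icc 1 Y).filter (fun n => ∃ b : ℕ, B < b ∧ b ^ 2 ∣ n)) ∪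
      ((Finset.Icc 1 Y).filter (fun n => n.primeFactors.card ≤ k ∧
      (∀ q ∈ n.primeFactors, (q-1).primeFactors.card ≤ k) ∧ ∃ p ∈ n.primeFactors,
      D < (Nat.gcd (p - 1) (∏ q ∈ n.primeFactors.erase p, (q - 1)) : ℝ)))) := by
    intro n hn
    have hn' := Finset.mem_filter.1 hn
    have hY := hn'.1
    have hn0 : n ≠ 0 := by have := Finset.mem_Icc.1 hY; omega
    by_contra hcon
    simp only [Finset.mem_union, Finset.mem_filter, hY, true_and, not_or, not_and, not_exists,
      not_lt] at hcon
    obtain ⟨⟨h1, h2⟩, h3, h4⟩ := hcon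
    have h5 := aux_det n k hn0 B D hB.le hD h1
      (fun b hb => by by_contra hlt; exact h3 b (not_le.1 hlt) hb)
      (h4 h1 h2)
    have hc : (0:ℝ) < carmichael n := by exact_mod_cast aux_carm_pos n hn0
    have := mul_lt_mul_of_pos_right hE hc
    have := hn'.2
    linarith
  have h := (Finset.card_le_card hsub).trans ((Finset.card_union_le _ _).trans
    (add_le_add (Finset.card_union_le _ _) (Finset.card_union_le _ _)))
  have h' := (Nat.cast_le (α := ℝ)).2 h
  push_cast at h'
  have a1 := aux_A1 Y k
  have a2 := aux_A2 Y k
  have a3 := aux_A3 Y B hB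
  have a4 := aux_A4 Y k D (by linarith)
  refine h'.trans (le_trans (add_le_add (add_le_add a1 a2) (add_le_add a3 a4)) (le_of_eq ?_))
  ring

lemma aux_num (Y : ℕ) (hY : 1 ≤ Y) (L T Δ : ℝ) (hT : 2 ≤ T) (hL : 1 ≤ L) (hLT : 20 * L ≤ T)
    (hΔ : 10000 * T ^ 2 ≤ Δ) (hYL : Real.log Y ≤ Real.exp L) :
    (((Finset.Icc 1 Y).filter (fun n => (carmichael n : ℝ) * Real.exp Δ ≤ n)).card : ℝ) ≤
      Y * Real.exp (-0.69 * T) := by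
  obtain ⟨k, hk1, hk2⟩ : ∃ k : ℕ, 4 * T ≤ k ∧ (k:ℝ) ≤ 5 * T :=
    ⟨⌈4 * T⌉₊, Nat.le_ceil _, by have := Nat.ceil_lt_add_one (show 0 ≤ 4 * T by linarith); linarith⟩
  have hk0 : (0:ℝ) < k := by linarith
  have hΔ0 : 0 < Δ := by nlinarith
  have hlog2 : Real.log 2 < 0.6931471808 := Real.log_two_lt_d9
  have hlog2' : 0.6931471803 < Real.log 2 := Real.log_two_gt_d9
  have h2k : (2:ℝ) ^ k = Real.exp (k * Real.log 2) := by
    rw [Real.exp_nat_mul, Real.exp_log (by norm_num)]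
  have hE : Real.exp (Δ / 8) ^ 2 * 2 ^ k * Real.exp (Δ / (2 * k)) ^ k < Real.exp Δ := by
    rw [h2k, ← Real.exp_nat_mul, ← Real.exp_nat_mul, ← Real.exp_add, ← Real.exp_add]
    apply Real.exp_lt_exp.2
    have : (k:ℝ) * (Δ / (2 * k)) = Δ / 2 := by field_simp
    rw [this]
    push_cast
    nlinarith
  have hmain := aux_total Y k (Real.exp (Δ / 8)) (Real.exp (Δ / (2 * k))) (Real.exp Δ)
    (Real.exp_pos _) (Real.one_le_exp (by positivity)) hE
  refine hmain.trans (mul_le_mul_of_nonneg_left ?_ (by positivity))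
  set H := 1 + Real.log Y with hH
  have hH0 : 0 ≤ H := by
    have := Real.log_natCast_nonneg Y
    linarith
  have hHT : H ≤ Real.exp (T / 10) := by
    have h1 : H ≤ 2 * Real.exp L := by
      have := Real.one_le_exp (show 0 ≤ L by linarith)
      linarith
    have h2 : (2:ℝ) ≤ Real.exp L := by
      have := Real.add_one_le_exp L
      linarith
    have h3 : H ≤ Real.exp (L + L) := by
      rw [Real.exp_add]
      nlinarith
    exact h3.trans (Real.exp_le_exp.2 (by linarith))
  have hexp0 := Real.exp_pos (T/10)
  have e1 : (1/2:ℝ) ^ k * H ^ 2 ≤ Real.exp (-2 * T) := by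
    have : (1/2:ℝ) ^ k = Real.exp (-(k * Real.log 2)) := by
      rw [Real.exp_neg, ← h2k]; simp
    rw [this]
    calc _ ≤ Real.exp (-(k * Real.log 2)) * Real.exp (T/10) ^ 2 := by gcongr
      _ = Real.exp (-(k * Real.log 2) + 2 * (T / 10)) := by
          rw [← Real.exp_nat_mul, ← Real.exp_add]; norm_num
      _ ≤ _ := Real.exp_le_exp.2 (by nlinarith)
  have e2 : 1 / Real.exp (Δ / 8) * H ≤ Real.exp (-2 * T) := by
    rw [one_div, ← Real.exp_neg]
    calc _ ≤ Real.exp (-(Δ / 8)) * Real.exp (T / 10) := by gcongr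
      _ = Real.exp (-(Δ / 8) + T / 10) := by rw [← Real.exp_add]
      _ ≤ _ := Real.exp_le_exp.2 (by nlinarith)
  have e3 : 1 / √(Real.exp (Δ / (2 * k))) * Real.exp (12 * k) * H ≤ Real.exp (-2 * T) := by
    rw [one_div, ← Real.exp_half, ← Real.exp_neg]
    have hq : 500 * T ≤ Δ / (2 * k) / 2 := by
      rw [div_div, le_div_iff₀ (by positivity)]
      nlinarith
    calc _ ≤ Real.exp (-(Δ / (2 * k) / 2)) * Real.exp (12 * k) * Real.exp (T / 10) := by gcongr
      _ = Real.exp (-(Δ / (2 * k) / 2) + 12 * k + T / 10) := by rw [← Real.exp_add, ← Real.exp_add]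
      _ ≤ _ := Real.exp_le_exp.2 (by linarith)
  have e4 : 4 * Real.exp (-2 * T) ≤ Real.exp (-0.69 * T) := by
    have h4 : (4:ℝ) ≤ Real.exp (1.31 * T) := by
      have h5 : (4:ℝ) = Real.exp (2 * Real.log 2) := by
        rw [two_mul, Real.exp_add, Real.exp_log (by norm_num)]; norm_num
      rw [h5]
      exact Real.exp_le_exp.2 (by linarith)
    calc _ ≤ Real.exp (1.31 * T) * Real.exp (-2 * T) := by gcongr
      _ = _ := by rw [← Real.exp_add]; congr 1; ring
  linarith

lemma aux_delta : ∀ᶠ Δ : ℝ in atTop, 2 ≤ (Δ * Real.log Δ) ^ ((1 : ℝ) / 3) ∧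
    20 * Δ ^ ((1 : ℝ) / 3) ≤ (Δ * Real.log Δ) ^ ((1 : ℝ) / 3) ∧
    10000 * ((Δ * Real.log Δ) ^ ((1 : ℝ) / 3)) ^ 2 ≤ Δ := by
  have h1 := (isLittleO_log_rpow_atTop (show (0:ℝ) < 1/2 by norm_num)).bound
    (show (0:ℝ) < 1/1000000 by norm_num)
  have h2 := Real.tendsto_log_atTop.eventually_ge_atTop (8000:ℝ)
  filter_upwards [h1, h2, eventually_ge_atTop 1] with Δ h1 h2 h3
  have h0 : (0:ℝ) ≤ Δ := by linarith
  have hl0 : 0 ≤ Real.log Δ := by linarith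
  rw [Real.norm_of_nonneg hl0, Real.norm_of_nonneg (by positivity), ← Real.sqrt_eq_rpow] at h1
  have hb : 20 * Δ ^ ((1 : ℝ) / 3) ≤ (Δ * Real.log Δ) ^ ((1 : ℝ) / 3) := by
    rw [Real.mul_rpow h0 hl0, mul_comm]
    gcongr
    have : (20:ℝ) = 8000 ^ ((1:ℝ)/3) := by
      rw [show (8000:ℝ) = 20 ^ (3:ℝ) by norm_num, ← Real.rpow_mul (by norm_num)]; norm_num
    rw [this]
    exact Real.rpow_le_rpow (by norm_num) h2 (by norm_num)
  have hone : 1 ≤ Δ ^ ((1 : ℝ) / 3) := Real.one_le_rpow h3 (by norm_num)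
  refine ⟨by linarith, hb, ?_⟩
  set T := (Δ * Real.log Δ) ^ ((1 : ℝ) / 3) with hT
  have hT3 : T ^ 3 = Δ * Real.log Δ := by
    rw [hT, ← Real.rpow_natCast, ← Real.rpow_mul (by positivity)]; norm_num
  have hs0 := Real.sqrt_nonneg Δ
  have hs := Real.sq_sqrt h0
  have h6 : T ^ 3 ≤ (√Δ / 100) ^ 3 := by
    rw [hT3]
    calc Δ * Real.log Δ ≤ Δ * (1/1000000 * √Δ) := by gcongr
      _ = √Δ ^ 2 * (1/1000000 * √Δ) := by rw [hs]
      _ = _ := by ring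
  have h7 : T ≤ √Δ / 100 := le_of_pow_le_pow_left₀ (by norm_num) (by positivity) h6
  have h8 : T ^ 2 ≤ (√Δ / 100) ^ 2 := pow_le_pow_left₀ (by linarith) h7 2
  have h9 : (√Δ / 100) ^ 2 = Δ / 10000 := by rw [div_pow, hs]; norm_num
  linarith

theorem stmt7 :
    ∀ᶠ X : ℝ in atTop, ∀ Δ : ℝ, Real.log (Real.log X) ^ 3 ≤ Δ →
      (Nat.card {n : ℕ | 0 < n ∧ (n : ℝ) ≤ X ∧
          (carmichael n : ℝ) ≤ (n : ℝ) * Real.exp (-Δ)} : ℝ) ≤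
        X * Real.exp (-0.69 * (Δ * Real.log Δ) ^ ((1 : ℝ) / 3)) := by
  obtain ⟨Δ₀, hΔ₀⟩ := eventually_atTop.1 aux_delta
  have hlim : Tendsto (fun X : ℝ => Real.log (Real.log X)) atTop atTop :=
    Real.tendsto_log_atTop.comp Real.tendsto_log_atTop
  filter_upwards [hlim.eventually_ge_atTop (max 1 Δ₀), eventually_ge_atTop (1:ℝ),
    Real.tendsto_log_atTop.eventually_ge_atTop (1:ℝ)] with X hX hX1 hX2 Δ hΔ
  set L := Real.log (Real.log X) with hL
  have hL1 : 1 ≤ L := le_trans (le_max_left _ _) hX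
  have hL2 : Δ₀ ≤ L := le_trans (le_max_right _ _) hX
  have hLL : L ≤ L ^ 3 := le_self_pow₀ hL1 (by norm_num)
  obtain ⟨hT2, hT20, hTΔ⟩ := hΔ₀ Δ (by linarith)
  set T := (Δ * Real.log Δ) ^ ((1 : ℝ) / 3) with hT
  have hLΔ : L ≤ Δ ^ ((1:ℝ)/3) := by
    have h := Real.rpow_le_rpow (by positivity) hΔ (show (0:ℝ) ≤ 1/3 by norm_num)
    rwa [← Real.rpow_natCast, ← Real.rpow_mul (by linarith), show ((3:ℕ):ℝ) * (1/3) = 1 by norm_num,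
      Real.rpow_one] at h
  have hY1 : 1 ≤ ⌊X⌋₊ := Nat.le_floor (by simpa using hX1)
  have hYX : (⌊X⌋₊ : ℝ) ≤ X := Nat.floor_le (by linarith)
  have hY0 : (0:ℝ) < (⌊X⌋₊ : ℝ) := by exact_mod_cast hY1
  have hYL : Real.log (⌊X⌋₊ : ℝ) ≤ Real.exp L := by
    rw [hL, Real.exp_log (by linarith)]
    exact Real.log_le_log hY0 hYX
  have hmain := aux_num ⌊X⌋₊ hY1 L T Δ hT2 hL1 (by linarith) hTΔ hYL
  have hset : {n : ℕ | 0 < n ∧ (n : ℝ) ≤ X ∧ (carmichael n : ℝ) ≤ (n : ℝ) * Real.exp (-Δ)} =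
      ((Finset.Icc 1 ⌊X⌋₊).filter (fun n => (carmichael n : ℝ) * Real.exp Δ ≤ n) : Finset ℕ) := by
    ext n
    simp only [Set.mem_ofPred_eq, Finset.coe_filter, Finset.mem_Icc]
    rw [Nat.le_floor_iff (by linarith), Real.exp_neg, ← div_eq_mul_inv, le_div_iff₀ (Real.exp_pos _),
      and_assoc, Nat.succ_le_iff]
  rw [hset, Nat.card_coe_set_eq, Set.ncard_coe_finset]
  refine hmain.trans ?_
  gcongr
end
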